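/- arXiv:2602.05740 — 3 statements merged into one kernel-verified Lean document; each statement's English description precedes it below -/
import Mathlib

section
/- Let X be a nonempty complete proper metric space equipped with a geodesic structure σ that is Busemann convex and geodesically complete with respect to σ, and let m be a Borel measure on X that is locally finite, positive on every nonempty open set, and satisfies MCP(0,N) with respect to σ for some real N ≥ 1. Then for all p, x, y ∈ X and all t ∈ [0,1], dist (σ p x t) (σ p y t) = t · dist x y. -/
open Metric MeasureTheory ENNReal Filter

/-- A geodesic structure on a metric space. -/
structure GeodesicStructure (X : Type*) [MetricSpace X] where
  σ : X → X → ℝ → X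
  σ_zero : ∀ x y, σ x y 0 = x
  σ_one : ∀ x y, σ x y 1 = y
  dist_σ : ∀ x y, ∀ s ∈ Set.Icc (0:ℝ) 1, ∀ t ∈ Set.Icc (0:ℝ) 1,
    dist (σ x y s) (σ x y t) = |s - t| * dist x y
  σ_comp : ∀ x y, ∀ s ∈ Set.Icc (0:ℝ) 1, ∀ t ∈ Set.Icc (0:ℝ) 1,
    σ x (σ x y t) s = σ x y (s * t)

/-- Busemann convexity of a geodesic structure. -/
def GeodesicStructure.BusemannConvex {X : Type*} [MetricSpace X]
    (G : GeodesicStructure X) : Prop :=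
  ∀ p x y : X, ∀ t ∈ Set.Icc (0:ℝ) 1, dist (G.σ p x t) (G.σ p y t) ≤ t * dist x y

/-- Geodesic completeness with respect to a geodesic structure. -/
def GeodesicStructure.GeodComplete {X : Type*} [MetricSpace X]
    (G : GeodesicStructure X) : Prop :=
  ∀ x y : X, x ≠ y → ∀ R : ℝ, dist x y ≤ R →
    ∃ z : X, dist x z = R ∧ G.σ x z (dist x y / R) = y

/-- The measure contraction property MCP(0,N) with respect to a geodesic structure. -/
def GeodesicStructure.MCPzero {X : Type*} [MetricSpace X] [MeasurableSpace X]
    (G : GeodesicStructure X) (m : Measure X) (N : ℝ) : Prop :=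
  ∀ p : X, ∀ A : Set X, MeasurableSet A → ∀ t ∈ Set.Icc (0:ℝ) 1,
    ENNReal.ofReal (t ^ N) * m A ≤ m ((fun x => G.σ p x t) '' A)

namespace GeodesicStructure

section Basic

variable {X : Type*} [MetricSpace X] {G : GeodesicStructure X}

lemma dist_left_σ (G : GeodesicStructure X) (x y : X) {t : ℝ} (ht : t ∈ Set.Icc (0:ℝ) 1) :
    dist x (G.σ x y t) = t * dist x y := by
  have h := G.dist_σ x y 0 ⟨le_rfl, zero_le_one⟩ t ht
  rwa [G.σ_zero, zero_sub, abs_neg, abs_of_nonneg ht.1] at h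

lemma dist_σ_right (G : GeodesicStructure X) (x y : X) {t : ℝ} (ht : t ∈ Set.Icc (0:ℝ) 1) :
    dist (G.σ x y t) y = (1 - t) * dist x y := by
  have h := G.dist_σ x y t ht 1 ⟨zero_le_one, le_rfl⟩
  rwa [G.σ_one, abs_sub_comm, abs_of_nonneg (sub_nonneg.2 ht.2)] at h

lemma σ_self (G : GeodesicStructure X) (x : X) {t : ℝ} (ht : t ∈ Set.Icc (0:ℝ) 1) :
    G.σ x x t = x := by
  have h := G.dist_left_σ x x ht
  rw [dist_self, mul_zero] at h
  exact (dist_eq_zero.1 h).symm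

/-- The distance to a point is convex along the geodesics of a Busemann convex structure. -/
lemma BusemannConvex.dist_σ_le (hB : G.BusemannConvex) (p x z : X) {t : ℝ}
    (ht : t ∈ Set.Icc (0:ℝ) 1) :
    dist (G.σ p x t) z ≤ t * dist x z + (1 - t) * dist p z := by
  calc dist (G.σ p x t) z ≤ dist (G.σ p x t) (G.σ p z t) + dist (G.σ p z t) z :=
        dist_triangle _ _ _
    _ ≤ _ := by rw [G.dist_σ_right p z ht]; linarith [hB p x z t ht]

/-- Points can be lifted along the contraction centred at `o`. -/
lemma GeodComplete.exists_lift (hGC : G.GeodComplete) (o z : X) {τ : ℝ} (h0 : 0 < τ)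
    (h1 : τ ≤ 1) : ∃ w, G.σ o w τ = z ∧ dist o w = dist o z / τ := by
  rcases eq_or_ne o z with rfl | h
  · exact ⟨o, G.σ_self o ⟨h0.le, h1⟩, by simp⟩
  · have hd : 0 < dist o z := dist_pos.2 h
    obtain ⟨w, hw, hw'⟩ := hGC o z h (dist o z / τ) (by
      rw [le_div_iff₀ h0]; nlinarith)
    refine ⟨w, ?_, hw⟩
    rwa [div_div_cancel₀ hd.ne'] at hw'

/-- If `y` lies on the geodesic from `a` to a far away point `z`, then `y` is closer than `a` to
the points near `z`, by almost the distance between `a` and `y`. -/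
lemma BusemannConvex.dist_mul_le_sub (hB : G.BusemannConvex) {a y z w : X} {lam ρ : ℝ}
    (hlam : 0 < lam) (haz : dist a z = lam) (hay : dist a y ≤ lam)
    (hσ : G.σ a z (dist a y / lam) = y) (hzw : dist z w ≤ ρ * lam) :
    dist a y * (1 - 2 * ρ) ≤ dist a w - dist y w := by
  set t := dist a y / lam with ht
  have htm : t ∈ Set.Icc (0:ℝ) 1 := ⟨by positivity, by rw [ht, div_le_one hlam]; exact hay⟩
  have hy : dist a y = t * lam := by rw [ht]; field_simp
  have h1 : dist y w ≤ t * dist z w + (1 - t) * dist a w := by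
    simpa only [hσ] using hB.dist_σ_le a z w htm
  have h2 : lam - ρ * lam ≤ dist a w := by
    have := dist_triangle_right a z w
    linarith
  have h3 := mul_le_mul_of_nonneg_left hzw htm.1
  have h4 := mul_le_mul_of_nonneg_left h2 htm.1
  rw [hy]
  nlinarith

lemma continuous_contraction (hB : G.BusemannConvex) (p : X) {t : ℝ}
    (ht : t ∈ Set.Icc (0:ℝ) 1) : Continuous fun x => G.σ p x t := by
  have : LipschitzWith ⟨t, ht.1⟩ fun x => G.σ p x t :=
    LipschitzWith.of_dist_le_mul fun x y => hB p x y t ht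
  exact this.continuous

end Basic

section Volume

variable {X : Type*} [MetricSpace X] [ProperSpace X] [MeasurableSpace X] [BorelSpace X]
  {G : GeodesicStructure X} {m : Measure X} {N : ℝ}

lemma measureReal_ball_pos [IsLocallyFiniteMeasure m] [m.IsOpenPosMeasure] (x : X) {r : ℝ}
    (hr : 0 < r) : 0 < m.real (ball x r) :=
  ENNReal.toReal_pos (measure_ball_pos m x hr).ne' measure_ball_lt_top.ne

lemma measureReal_ball_mono [IsLocallyFiniteMeasure m] {x y : X} {r R : ℝ}
    (h : ball x r ⊆ ball y R) : m.real (ball x r) ≤ m.real (ball y R) :=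
  measureReal_mono h measure_ball_lt_top.ne

/-- The Bishop-Gromov inequality. -/
lemma MCPzero.pow_mul_ball_le [IsLocallyFiniteMeasure m] (hMCP : G.MCPzero m N) (x : X) (r : ℝ)
    {t : ℝ} (h0 : 0 < t) (h1 : t ≤ 1) :
    t ^ N * m.real (ball x r) ≤ m.real (ball x (t * r)) := by
  have h := hMCP x (ball x r) measurableSet_ball t ⟨h0.le, h1⟩
  have hsub : (fun z => G.σ x z t) '' ball x r ⊆ ball x (t * r) := by
    rintro _ ⟨z, hz, rfl⟩
    rw [mem_ball'] at hz ⊢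
    rw [G.dist_left_σ x z ⟨h0.le, h1⟩]
    gcongr
  have h' := ENNReal.toReal_mono measure_ball_lt_top.ne (h.trans (measure_mono hsub))
  rwa [ENNReal.toReal_mul, ENNReal.toReal_ofReal (by positivity)] at h'

/-- A separated set in a ball has bounded cardinality. -/
lemma MCPzero.card_le [IsLocallyFiniteMeasure m] [m.IsOpenPosMeasure] (hMCP : G.MCPzero m N)
    {o : X} {R η : ℝ} (hR : 0 < R) (h0 : 0 < η) (h1 : η ≤ 1) {F : Finset X}
    (hF : ∀ x ∈ F, dist o x ≤ R) (hsep : ∀ x ∈ F, ∀ y ∈ F, x ≠ y → η * R ≤ dist x y) :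
    (F.card : ℝ) ≤ (6 / η) ^ N := by
  have hV : 0 < m.real (ball o (2 * R)) := measureReal_ball_pos o (by linarith)
  have hdisj : (F : Set X).PairwiseDisjoint fun x => ball x (η * R / 2) := by
    intro x hx y hy hxy
    exact ball_disjoint_ball (by linarith [hsep x hx y hy hxy])
  have hsub : (⋃ x ∈ F, ball x (η * R / 2)) ⊆ ball o (2 * R) := by
    refine Set.iUnion₂_subset fun x hx => ball_subset_ball' ?_
    have := hF x hx
    rw [dist_comm] at this
    nlinarith
  have hsum : ∑ x ∈ F, m.real (ball x (η * R / 2)) ≤ m.real (ball o (2 * R)) := by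
    rw [← measureReal_biUnion_finset hdisj (fun _ _ => measurableSet_ball)
      (fun _ _ => measure_ball_lt_top.ne)]
    exact measureReal_mono hsub measure_ball_lt_top.ne
  have hlow : ∀ x ∈ F, (η / 6) ^ N * m.real (ball o (2 * R)) ≤ m.real (ball x (η * R / 2)) := by
    intro x hx
    have h := hMCP.pow_mul_ball_le x (3 * R) (t := η / 6) (by positivity) (by linarith)
    rw [show η / 6 * (3 * R) = η * R / 2 by ring] at h
    refine le_trans ?_ h
    have : ball o (2 * R) ⊆ ball x (3 * R) := ball_subset_ball' (by linarith [hF x hx])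
    exact mul_le_mul_of_nonneg_left (measureReal_ball_mono this) (by positivity)
  have hcard := (Finset.card_nsmul_le_sum F _ _ hlow).trans hsum
  rw [nsmul_eq_mul, ← mul_assoc] at hcard
  have h2 : (F.card : ℝ) * (η / 6) ^ N ≤ 1 := by
    by_contra! h
    nlinarith
  rw [← inv_div η 6, Real.inv_rpow (by positivity), ← one_div, le_div_iff₀ (by positivity)]
  exact h2

/-- A ball has a separated net of bounded cardinality. -/
lemma MCPzero.exists_net [IsLocallyFiniteMeasure m] [m.IsOpenPosMeasure] (hMCP : G.MCPzero m N)
    (o : X) {R η : ℝ} (hR : 0 < R) (h0 : 0 < η) (h1 : η ≤ 1) :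
    ∃ F : Finset X, (∀ x ∈ F, dist o x ≤ R) ∧ (F.card : ℝ) ≤ (6 / η) ^ N ∧
      ∀ p, dist o p ≤ R → ∃ x ∈ F, dist p x < η * R := by
  classical
  let P : ℕ → Prop := fun n => ∃ F : Finset X, F.card = n ∧ (∀ x ∈ F, dist o x ≤ R) ∧
    ∀ x ∈ F, ∀ y ∈ F, x ≠ y → η * R ≤ dist x y
  have hP0 : P 0 := ⟨∅, by simp⟩
  have hbd : ∀ n, P n → n ≤ ⌊(6 / η) ^ N⌋₊ := by
    rintro n ⟨F, rfl, hF, hsep⟩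
    exact Nat.le_floor (hMCP.card_le hR h0 h1 hF hsep)
  obtain ⟨F, hcard, hF, hsep⟩ := Nat.findGreatest_spec (P := P)
    (Nat.zero_le ⌊(6 / η) ^ N⌋₊) hP0
  refine ⟨F, hF, hMCP.card_le hR h0 h1 hF hsep, fun p hp => ?_⟩
  by_contra! hfar
  have hpF : p ∉ F := fun h => by
    have := hfar p h
    rw [dist_self] at this
    nlinarith
  have hPn : P (F.card + 1) := by
    refine ⟨insert p F, Finset.card_insert_of_notMem hpF, ?_, ?_⟩
    · intro x hx
      rcases Finset.mem_insert.1 hx with rfl | hx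
      exacts [hp, hF x hx]
    · intro x hx y hy hxy
      rcases Finset.mem_insert.1 hx with hx' | hx' <;>
        rcases Finset.mem_insert.1 hy with hy' | hy'
      · exact absurd (hx'.trans hy'.symm) hxy
      · exact hx' ▸ hfar y hy'
      · rw [dist_comm]; exact hy' ▸ hfar x hx'
      · exact hsep x hx' y hy' hxy
  have hle : F.card + 1 ≤ Nat.findGreatest P ⌊(6 / η) ^ N⌋₊ :=
    Nat.le_findGreatest (hbd _ hPn) hPn
  omega

end Volume

end GeodesicStructure

namespace GeodesicStructure

section Asymptotic

variable {X : Type*} [MetricSpace X] {G : GeodesicStructure X}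

/-- A finite `η * R`-separated subset of the closed ball of radius `R` around `o`. -/
def IsSeparatedIn (o : X) (η R : ℝ) (F : Finset X) : Prop :=
  (∀ x ∈ F, dist o x ≤ R) ∧ ∀ x ∈ F, ∀ y ∈ F, x ≠ y → η * R ≤ dist x y

/-- The cardinality of a finite set plus the sum of its mutual distances at scale `R`. -/
noncomputable def scaledEnergy (R : ℝ) (F : Finset X) : ℝ :=
  F.card + ∑ z ∈ F ×ˢ F, dist z.1 z.2 / R

/-- The supremum of the energy over all separated subsets of a ball. -/
noncomputable def maxEnergy (o : X) (η R : ℝ) : ℝ :=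
  sSup (scaledEnergy R '' {F | IsSeparatedIn o η R F})

/-- Separated sets can be lifted along a contraction centred at `o`. -/
lemma GeodComplete.exists_lift_finset (hB : G.BusemannConvex) (hGC : G.GeodComplete) (o : X)
    {s : ℝ} (h0 : 0 < s) (h1 : s ≤ 1) : ∃ l : X → X, (∀ z, G.σ o (l z) s = z) ∧
      (∀ x y, dist x y ≤ s * dist (l x) (l y)) ∧
      ∀ η R (F : Finset X), IsSeparatedIn o η (s * R) F →
        ∃ F' : Finset X, IsSeparatedIn o η R F' ∧ (∀ z, z ∈ F' ↔ ∃ x ∈ F, l x = z) ∧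
          scaledEnergy R F' = F.card + ∑ z ∈ F ×ˢ F, dist (l z.1) (l z.2) / R := by
  classical
  choose l hl hl' using fun z => hGC.exists_lift o z h0 h1
  have hinj : Function.Injective l := fun x y hxy => by rw [← hl x, hxy, hl]
  have hd : ∀ x y, dist x y ≤ s * dist (l x) (l y) := fun x y => by
    have := hB o (l x) (l y) s ⟨h0.le, h1⟩
    rwa [hl, hl] at this
  refine ⟨l, hl, hd, fun η R F hF => ⟨F.image l, ⟨?_, ?_⟩, fun z => Finset.mem_image, ?_⟩⟩
  · intro z hz
    obtain ⟨x, hx, rfl⟩ := Finset.mem_image.1 hz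
    rw [hl', div_le_iff₀ h0, mul_comm R]
    exact hF.1 x hx
  · intro z hz z' hz' hne
    obtain ⟨x, hx, rfl⟩ := Finset.mem_image.1 hz
    obtain ⟨y, hy, rfl⟩ := Finset.mem_image.1 hz'
    have h2 := hF.2 x hx y hy (fun h => hne (h ▸ rfl))
    have h3 := hd x y
    by_contra! h
    nlinarith
  · rw [scaledEnergy, Finset.card_image_of_injective _ hinj, Finset.sum_product,
      Finset.sum_product, Finset.sum_image hinj.injOn]
    congr 1
    exact Finset.sum_congr rfl fun x _ => Finset.sum_image hinj.injOn

lemma nonempty_scaledEnergy (o : X) (η R : ℝ) :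
    (scaledEnergy R '' {F | IsSeparatedIn o η R F}).Nonempty :=
  ⟨_, ∅, ⟨by simp, by simp⟩, rfl⟩

/-- Adding a point to a separated set increases its energy by at least one. -/
lemma IsSeparatedIn.exists_insert {o : X} {η R : ℝ} (hη : 0 < η) (hR : 0 < R) {F : Finset X}
    (hF : IsSeparatedIn o η R F) {p : X} (hp : dist o p ≤ R) (hfar : ∀ x ∈ F, η * R ≤ dist p x) :
    ∃ F', IsSeparatedIn o η R F' ∧ scaledEnergy R F + 1 ≤ scaledEnergy R F' := by
  classical
  have hpF : p ∉ F := fun h => by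
    have := hfar p h
    rw [dist_self] at this
    nlinarith
  refine ⟨insert p F, ⟨?_, ?_⟩, ?_⟩
  · intro x hx
    rcases Finset.mem_insert.1 hx with hx' | hx'
    exacts [hx' ▸ hp, hF.1 x hx']
  · intro x hx y hy hxy
    rcases Finset.mem_insert.1 hx with hx' | hx' <;> rcases Finset.mem_insert.1 hy with hy' | hy'
    · exact absurd (hx'.trans hy'.symm) hxy
    · exact hx' ▸ hfar y hy'
    · rw [dist_comm]; exact hy' ▸ hfar x hx'
    · exact hF.2 x hx' y hy' hxy
  · have hsub := Finset.subset_insert p F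
    have : ∑ z ∈ F ×ˢ F, dist z.1 z.2 / R ≤ ∑ z ∈ insert p F ×ˢ insert p F, dist z.1 z.2 / R :=
      Finset.sum_le_sum_of_subset_of_nonneg (Finset.product_subset_product hsub hsub)
        fun _ _ _ => by positivity
    rw [scaledEnergy, scaledEnergy, Finset.card_insert_of_notMem hpF]
    push_cast
    linarith

variable [ProperSpace X] [MeasurableSpace X] [BorelSpace X] {m : Measure X} {N : ℝ}
  [IsLocallyFiniteMeasure m] [m.IsOpenPosMeasure]

lemma MCPzero.scaledEnergy_le (hMCP : G.MCPzero m N) {o : X} {η R : ℝ} (hR : 0 < R)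
    (h0 : 0 < η) (h1 : η ≤ 1) {F : Finset X} (hF : IsSeparatedIn o η R F) :
    scaledEnergy R F ≤ (6 / η) ^ N + (6 / η) ^ N * (6 / η) ^ N * 2 := by
  have hc := hMCP.card_le hR h0 h1 hF.1 hF.2
  have hs : ∑ z ∈ F ×ˢ F, dist z.1 z.2 / R ≤ (F ×ˢ F).card • (2 : ℝ) := by
    refine Finset.sum_le_card_nsmul _ _ _ fun z hz => ?_
    rw [Finset.mem_product] at hz
    rw [div_le_iff₀ hR]
    linarith [dist_triangle_left z.1 z.2 o, hF.1 _ hz.1, hF.1 _ hz.2]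
  rw [Finset.card_product, nsmul_eq_mul, Nat.cast_mul] at hs
  have : (F.card : ℝ) * F.card ≤ (6 / η) ^ N * (6 / η) ^ N := by gcongr
  rw [scaledEnergy]
  linarith

lemma MCPzero.bddAbove_scaledEnergy (hMCP : G.MCPzero m N) (o : X) {η R : ℝ} (hR : 0 < R)
    (h0 : 0 < η) (h1 : η ≤ 1) : BddAbove (scaledEnergy R '' {F | IsSeparatedIn o η R F}) := by
  refine ⟨(6 / η) ^ N + (6 / η) ^ N * (6 / η) ^ N * 2, ?_⟩
  rintro _ ⟨F, hF, rfl⟩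
  exact hMCP.scaledEnergy_le hR h0 h1 hF

lemma MCPzero.maxEnergy_mono (hMCP : G.MCPzero m N) (hB : G.BusemannConvex)
    (hGC : G.GeodComplete) (o : X) {η r R : ℝ} (h0 : 0 < η) (h1 : η ≤ 1) (hr : 0 < r)
    (hrR : r ≤ R) : maxEnergy o η r ≤ maxEnergy o η R := by
  have hR : 0 < R := hr.trans_le hrR
  refine csSup_le (nonempty_scaledEnergy o η r) ?_
  rintro _ ⟨F, hF, rfl⟩
  have hs : 0 < r / R := div_pos hr hR
  obtain ⟨l, -, hd, hlift⟩ := hGC.exists_lift_finset hB o hs ((div_le_one hR).2 hrR)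
  have hrR' : r / R * R = r := by field_simp
  obtain ⟨F', hF', -, hE⟩ := hlift η R F (by rw [hrR']; exact hF)
  refine le_trans ?_ (le_csSup (hMCP.bddAbove_scaledEnergy o hR h0 h1) ⟨F', hF', rfl⟩)
  rw [hE, scaledEnergy]
  refine add_le_add le_rfl (Finset.sum_le_sum fun z _ => ?_)
  rw [div_le_div_iff₀ hr hR]
  have h := hd z.1 z.2
  rw [div_mul_eq_mul_div, le_div_iff₀ hR] at h
  linarith

/-- At large scales, the contraction centred at `o` is almost a homothety. -/
theorem MCPzero.exists_asymptotic_homothety (hMCP : G.MCPzero m N) (hB : G.BusemannConvex)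
    (hGC : G.GeodComplete) (o : X) {s ε : ℝ} (hs0 : 0 < s) (hs1 : s ≤ 1) (hε : 0 < ε) :
    ∃ R₀ > 0, ∀ R ≥ R₀, ∀ p q, dist o p ≤ R → dist o q ≤ R →
      s * dist p q ≤ dist (G.σ o p s) (G.σ o q s) + ε * R := by
  classical
  set η := min 1 (ε / 8) with hη
  set θ := min (1 / 2) (ε / 4) with hθ
  have h0 : 0 < η := by positivity
  have h1 : η ≤ 1 := min_le_left _ _
  have hη2 : η ≤ ε / 8 := min_le_right _ _
  have hθ0 : 0 < θ := by positivity
  have hθ1 : θ ≤ 1 / 2 := min_le_left _ _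
  have hθ2 : θ ≤ ε / 4 := min_le_right _ _
  have hbdd : BddAbove (maxEnergy o η '' Set.Ioi 0) := by
    refine ⟨(6 / η) ^ N + (6 / η) ^ N * (6 / η) ^ N * 2, ?_⟩
    rintro _ ⟨R, hR, rfl⟩
    refine csSup_le (nonempty_scaledEnergy o η R) ?_
    rintro _ ⟨F, hF, rfl⟩
    exact hMCP.scaledEnergy_le hR h0 h1 hF
  obtain ⟨_, ⟨R₁, hR₁, rfl⟩, hsup⟩ := exists_lt_of_lt_csSup
    (Set.Nonempty.image (maxEnergy o η) (Set.nonempty_Ioi (a := (0 : ℝ))))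
    (sub_lt_self (sSup (maxEnergy o η '' Set.Ioi 0)) hθ0)
  rw [Set.mem_Ioi] at hR₁
  refine ⟨R₁ / s, by positivity, fun R hR p q hp hq => ?_⟩
  have hR₁R : R₁ ≤ s * R := by rwa [ge_iff_le, div_le_iff₀' hs0] at hR
  have hRpos : 0 < R := (div_pos hR₁ hs0).trans_le hR
  have hsR : 0 < s * R := by positivity
  have hT : maxEnergy o η R ≤ maxEnergy o η (s * R) + θ := by
    have h2 := le_csSup hbdd ⟨R, hRpos, rfl⟩
    have h3 := hMCP.maxEnergy_mono hB hGC o h0 h1 hR₁ hR₁R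
    linarith
  obtain ⟨_, ⟨F, hF, rfl⟩, hlt⟩ := exists_lt_of_lt_csSup (nonempty_scaledEnergy o η (s * R))
    (sub_lt_self (maxEnergy o η (s * R)) hθ0)
  obtain ⟨l, hl, hd, hlift⟩ := hGC.exists_lift_finset hB o hs0 hs1
  obtain ⟨F', hF', hmem, hE⟩ := hlift η R F hF
  have hterm : ∀ z ∈ F ×ˢ F, 0 ≤ dist (l z.1) (l z.2) / R - dist z.1 z.2 / (s * R) := by
    intro z _
    rw [sub_nonneg, div_le_div_iff₀ hsR hRpos]
    have := mul_le_mul_of_nonneg_right (hd z.1 z.2) hRpos.le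
    linarith
  have hdiff : scaledEnergy R F' - scaledEnergy (s * R) F =
      ∑ z ∈ F ×ˢ F, (dist (l z.1) (l z.2) / R - dist z.1 z.2 / (s * R)) := by
    rw [hE, scaledEnergy, Finset.sum_sub_distrib]
    ring
  have hup : ∀ F'' : Finset X, IsSeparatedIn o η R F'' →
      scaledEnergy R F'' < scaledEnergy (s * R) F + 2 * θ := by
    intro F'' hF''
    have : scaledEnergy R F'' ≤ maxEnergy o η R :=
      le_csSup (hMCP.bddAbove_scaledEnergy o hRpos h0 h1) ⟨F'', hF'', rfl⟩
    linarith
  have hpair : ∀ x ∈ F, ∀ y ∈ F, s * dist (l x) (l y) ≤ dist x y + 2 * θ * (s * R) := by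
    intro x hx y hy
    have h2 := Finset.single_le_sum hterm (Finset.mk_mem_product hx hy)
    have h3 : dist (l x) (l y) / R ≤ dist x y / (s * R) + 2 * θ := by
      have := hup F' hF'
      simp only at h2
      linarith
    calc s * dist (l x) (l y) = s * R * (dist (l x) (l y) / R) := by field_simp
      _ ≤ s * R * (dist x y / (s * R) + 2 * θ) := by gcongr
      _ = _ := by field_simp
  have hdense : ∀ p, dist o p ≤ R → ∃ x ∈ F, dist p (l x) < η * R := by
    intro p hp
    by_contra! hfar
    obtain ⟨F'', hF'', hle⟩ := hF'.exists_insert h0 hRpos hp fun x hx => by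
      obtain ⟨y, hy, rfl⟩ := (hmem x).1 hx
      exact hfar y hy
    have h2 := hup F'' hF''
    have h4 := Finset.sum_nonneg hterm
    linarith
  obtain ⟨x, hx, hpx⟩ := hdense p hp
  obtain ⟨y, hy, hqy⟩ := hdense q hq
  have h2 := hpair x hx y hy
  have h3 : dist p q ≤ dist (l x) (l y) + 2 * (η * R) := by
    linarith [dist_triangle4 p (l x) (l y) q, dist_comm q (l y)]
  have h4 := hB o (l x) p s ⟨hs0.le, hs1⟩
  have h5 := hB o q (l y) s ⟨hs0.le, hs1⟩
  rw [hl] at h4 h5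
  have h6 := dist_triangle4 x (G.σ o p s) (G.σ o q s) y
  have h7 : s * dist (l x) p ≤ η * R :=
    (mul_le_of_le_one_left dist_nonneg hs1).trans (by rw [dist_comm]; exact hpx.le)
  have h8 : s * dist q (l y) ≤ η * R := (mul_le_of_le_one_left dist_nonneg hs1).trans hqy.le
  have h9 : s * dist p q ≤ s * dist (l x) (l y) + 2 * (η * R) := by
    have := mul_le_mul_of_nonneg_left h3 hs0.le
    have := mul_le_of_le_one_left (mul_pos h0 hRpos).le hs1
    linarith
  have h10 : 2 * θ * (s * R) ≤ ε / 2 * R :=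
    mul_le_mul (by linarith) (mul_le_of_le_one_left hRpos.le hs1) hsR.le (by positivity)
  have h11 := mul_le_mul_of_nonneg_right hη2 hRpos.le
  linarith

/-- The geodesic from `q` to `o` almost passes through the points of the geodesic from `o` to `q`,
if `q` is far away. -/
theorem MCPzero.exists_asymptotic_reversibility (hMCP : G.MCPzero m N) (hB : G.BusemannConvex)
    (hGC : G.GeodComplete) (o : X) {s κ : ℝ} (hs0 : 0 < s) (hs1 : s ≤ 1) (hκ : 0 < κ) :
    ∃ R₀ > 0, ∀ q, R₀ ≤ dist o q →
      dist (G.σ q o (1 - s)) (G.σ o q s) ≤ κ * dist o q := by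
  have hsm : s ∈ Set.Icc (0:ℝ) 1 := ⟨hs0.le, hs1⟩
  set C : ℝ := (6 / (1 / 8 : ℝ)) ^ N with hC
  have hC0 : 0 < C := by positivity
  obtain ⟨n, hn⟩ := exists_nat_ge (8 * C / κ)
  have hn0 : (0 : ℝ) < n := lt_of_lt_of_le (by positivity) hn
  have hsn : 0 < s ^ n := by positivity
  obtain ⟨R₀, hR₀, hA⟩ := hMCP.exists_asymptotic_homothety hB hGC o hs0 hs1
    (ε := κ * s ^ n / 16) (by positivity)
  refine ⟨R₀, hR₀, fun q hq => ?_⟩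
  set Λ := dist o q with hΛ
  have hΛ0 : 0 < Λ := hR₀.trans_le hq
  set a := G.σ q o (1 - s) with ha
  set y := G.σ o q s with hy
  have hoy : dist o y = s * Λ := G.dist_left_σ o q hsm
  have hoa : dist o a = s * Λ := by
    rw [dist_comm, ha, G.dist_σ_right q o ⟨by linarith, by linarith⟩, dist_comm q o]
    ring
  rcases eq_or_ne a y with h | hne
  · rw [h, dist_self]; positivity
  set δ := dist a y with hδ
  have hδ1 : δ ≤ 2 * Λ := by nlinarith [dist_triangle_left a y o]
  set R := 4 * Λ / s ^ n with hR
  have hRΛ : s ^ n * R = 4 * Λ := by rw [hR]; field_simp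
  have hΛR : Λ ≤ R := by nlinarith [pow_le_one₀ hs0.le hs1 (n := n)]
  have hR0 : 0 < R := by positivity
  obtain ⟨F, hF, hFcard, hnet⟩ := hMCP.exists_net o hR0 (η := 1 / 8) (by norm_num) (by norm_num)
  have hpm : ∀ k : ℕ, s ^ k ∈ Set.Icc (0:ℝ) 1 := fun k => ⟨by positivity, pow_le_one₀ hs0.le hs1⟩
  have hstep : ∀ U (k : ℕ), G.σ o U (s ^ (k + 1)) = G.σ o (G.σ o U (s ^ k)) s := fun U k => by
    rw [G.σ_comp o U s hsm _ (hpm k), pow_succ']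
  let f : X → ℕ → ℝ := fun U k => dist o (G.σ o U (s ^ k)) - dist y (G.σ o U (s ^ k))
  have he0 : ∀ U k, 0 ≤ f U k - f U (k + 1) := by
    intro U k
    simp only [f, hstep]
    have h2 := G.dist_left_σ o (G.σ o U (s ^ k)) hsm
    have h3 := G.dist_σ_right o (G.σ o U (s ^ k)) hsm
    linarith [dist_triangle y (G.σ o (G.σ o U (s ^ k)) s) (G.σ o U (s ^ k))]
  have hsum : ∀ U, ∑ k ∈ Finset.range n, (f U k - f U (k + 1)) ≤ 2 * (s * Λ) := by
    intro U
    rw [Finset.sum_range_sub']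
    simp only [f]
    linarith [dist_triangle o y (G.σ o U (s ^ 0)),
      dist_triangle_left y (G.σ o U (s ^ n)) o]
  have htot : ∑ k ∈ Finset.range n, ∑ U ∈ F, (f U k - f U (k + 1)) ≤
      ∑ k ∈ Finset.range n, C * (2 * (s * Λ)) / n := by
    rw [Finset.sum_comm, Finset.sum_const, Finset.card_range, nsmul_eq_mul,
      mul_div_cancel₀ _ hn0.ne']
    calc _ ≤ F.card • (2 * (s * Λ)) := Finset.sum_le_card_nsmul _ _ _ fun U _ => hsum U
      _ ≤ _ := by rw [nsmul_eq_mul]; gcongr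
  obtain ⟨k, hk, hke⟩ := Finset.exists_le_of_sum_le
    (Finset.nonempty_range_iff.2 (by rintro rfl; simp at hn0)) htot
  rw [Finset.mem_range] at hk
  have hsk : 0 < s ^ k := by positivity
  set lam := s ^ k * R / 2 with hlam
  have hlam2 : 2 * Λ ≤ lam := by
    have : s ^ n * R ≤ s ^ k * R := by
      gcongr ?_ * R
      exact pow_le_pow_of_le_one hs0.le hs1 hk.le
    linarith
  obtain ⟨z, hz, hz'⟩ := hGC a y hne lam (hδ1.trans hlam2)
  have hoz : dist o z ≤ s ^ k * R := by
    have := dist_triangle o a z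
    nlinarith
  obtain ⟨L, hL, hL'⟩ := hGC.exists_lift o z hsk (hpm k).2
  obtain ⟨U, hU, hLU⟩ := hnet L (by rw [hL', div_le_iff₀' hsk]; exact hoz)
  set w := G.σ o U (s ^ k) with hw
  have hzw : dist z w ≤ 1 / 4 * lam := by
    have := hB o L U (s ^ k) (hpm k)
    rw [hL] at this
    have h2 := mul_le_mul_of_nonneg_left hLU.le hsk.le
    linarith
  have h1 := hB.dist_mul_le_sub (by linarith) hz (hδ1.trans hlam2) hz' hzw
  have h2 : dist a w ≤ (1 - s) * dist o w + s * dist q w := by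
    have := hB.dist_σ_le q o w (t := 1 - s) ⟨by linarith, by linarith⟩
    linarith
  have how : dist o w ≤ R := by
    rw [hw, G.dist_left_σ o U (hpm k)]
    nlinarith [hF U hU, (hpm k).2, dist_nonneg (x := o) (y := U)]
  have h3 := hA R (hq.trans hΛR) q w hΛR how
  have h4 := Finset.single_le_sum (fun U _ => he0 U k) hU
  have h5 := h4.trans hke
  simp only [f, hstep] at h5
  rw [G.dist_left_σ o (G.σ o U (s ^ k)) hsm] at h5
  have h6 : κ * s ^ n / 16 * R = κ * Λ / 4 := by
    rw [show κ * s ^ n / 16 * R = κ / 16 * (s ^ n * R) by ring, hRΛ]; ring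
  have h7 : C * (2 * (s * Λ)) / n ≤ κ * Λ / 4 := by
    rw [div_le_iff₀ hn0]
    rw [div_le_iff₀ hκ] at hn
    nlinarith [mul_le_mul_of_nonneg_right hs1 (mul_pos hC0 hΛ0).le]
  linarith

end Asymptotic

end GeodesicStructure

/-- The integral of the cone function `z ↦ (R - dist x z)⁺`. -/
noncomputable def coneIntegral {X : Type*} [MetricSpace X] [MeasurableSpace X] (m : Measure X)
    (R : ℝ) (x : X) : ℝ :=
  ∫ z, max (R - dist x z) 0 ∂m

namespace GeodesicStructure

section Cone

lemma MCPzero.smul_map_le {X : Type*} [MetricSpace X] [MeasurableSpace X] [BorelSpace X]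
    {G : GeodesicStructure X} {m : Measure X} {N : ℝ} (hMCP : G.MCPzero m N)
    (hB : G.BusemannConvex) (p : X) {t : ℝ} (ht : t ∈ Set.Icc (0:ℝ) 1) :
    ENNReal.ofReal (t ^ N) • m.map (fun z => G.σ p z t) ≤ m := by
  have hmeas := (continuous_contraction hB p ht).measurable
  refine Measure.le_iff.2 fun A hA => ?_
  rw [Measure.smul_apply, Measure.map_apply hmeas hA, smul_eq_mul]
  exact (hMCP p _ (hmeas hA) t ht).trans (measure_mono (Set.image_preimage_subset _ _))

lemma integral_indicator_const_eq {X : Type*} [MeasurableSpace X] {m : Measure X} {s : Set X}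
    (hs : MeasurableSet s) (c : ℝ) :
    ∫ z, s.indicator (fun _ => c) z ∂m = c * m.real s := by
  rw [integral_indicator_const c hs, smul_eq_mul, mul_comm]

variable {X : Type*} [MetricSpace X] [ProperSpace X] [MeasurableSpace X] [BorelSpace X]
  {G : GeodesicStructure X} {m : Measure X} {N : ℝ} [IsLocallyFiniteMeasure m]

lemma integrable_cone (R : ℝ) (x : X) : Integrable (fun z => max (R - dist x z) 0) m := by
  refine Continuous.integrable_of_hasCompactSupport (by fun_prop) ?_
  refine HasCompactSupport.intro (isCompact_closedBall x R) fun z hz => ?_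
  rw [mem_closedBall', not_le] at hz
  exact max_eq_right (by linarith)

lemma integrable_indicator_const {s : Set X} (hs : MeasurableSet s) {x : X} {r : ℝ}
    (h : s ⊆ ball x r) (c : ℝ) : Integrable (s.indicator fun _ => c) m :=
  (integrable_indicator_iff hs).2
    (integrableOn_const ((measure_mono h).trans_lt measure_ball_lt_top).ne)

lemma coneIntegral_le {R : ℝ} (hR : 0 ≤ R) (o : X) :
    coneIntegral m R o ≤ R * m.real (ball o (2 * R)) := by
  rw [← integral_indicator_const_eq measurableSet_ball, coneIntegral]
  refine integral_mono (integrable_cone R o)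
    (integrable_indicator_const measurableSet_ball subset_rfl R) fun z => ?_
  by_cases hz : z ∈ ball o (2 * R)
  · simp only [Set.indicator_of_mem hz]
    exact max_le (by linarith [dist_nonneg (x := o) (y := z)]) hR
  · simp only [Set.indicator_of_notMem hz]
    rw [mem_ball', not_lt] at hz
    exact max_le (by linarith) le_rfl

lemma coneIntegral_le_add {R : ℝ} {o x : X} (hx : dist o x ≤ R) (y : X) :
    coneIntegral m R x ≤ coneIntegral m R y + dist x y * m.real (ball o (2 * R)) := by
  have hi := integrable_indicator_const (m := m) (x := o) (r := 2 * R) measurableSet_ball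
    subset_rfl (dist x y)
  rw [← integral_indicator_const_eq measurableSet_ball, coneIntegral, coneIntegral,
    ← integral_add (integrable_cone R y) hi]
  refine integral_mono (integrable_cone R x) ((integrable_cone R y).add hi) fun z => ?_
  by_cases hz : z ∈ ball o (2 * R)
  · simp only [Set.indicator_of_mem hz]
    refine max_le ?_ (by positivity)
    linarith [le_max_left (R - dist y z) 0, dist_triangle_left y z x]
  · simp only [Set.indicator_of_notMem hz]
    rw [mem_ball', not_lt] at hz
    rw [add_zero, max_eq_right (by linarith [dist_triangle o x z])]
    exact le_max_right _ _

lemma MCPzero.pow_mul_coneIntegral_le (hMCP : G.MCPzero m N) (hB : G.BusemannConvex) (q o : X)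
    (R : ℝ) {t : ℝ} (ht : t ∈ Set.Icc (0:ℝ) 1) :
    t ^ N * coneIntegral m R o ≤ coneIntegral m R (G.σ q o t) := by
  have hmeas := (continuous_contraction hB q ht).measurable
  have hnn : ∀ x, 0 ≤ᵐ[m] fun z => max (R - dist x z) 0 :=
    fun x => Filter.Eventually.of_forall fun z => le_max_right _ _
  have hφ : Measurable fun z => ENNReal.ofReal (max (R - dist (G.σ q o t) z) 0) := by
    have : Continuous fun z => max (R - dist (G.σ q o t) z) 0 := by fun_prop
    exact this.measurable.ennreal_ofReal
  have hpos : 0 ≤ coneIntegral m R (G.σ q o t) := integral_nonneg fun z => le_max_right _ _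
  rw [← ENNReal.ofReal_le_ofReal_iff hpos, ENNReal.ofReal_mul (Real.rpow_nonneg ht.1 N),
    coneIntegral, coneIntegral, ofReal_integral_eq_lintegral_ofReal (integrable_cone R o) (hnn o),
    ofReal_integral_eq_lintegral_ofReal (integrable_cone R _) (hnn _)]
  calc _ ≤ ENNReal.ofReal (t ^ N) *
        ∫⁻ z, ENNReal.ofReal (max (R - dist (G.σ q o t) (G.σ q z t)) 0) ∂m := by
        gcongr with z
        refine (hB q o z t ht).trans (mul_le_of_le_one_left dist_nonneg ht.2)
    _ = ∫⁻ z, ENNReal.ofReal (max (R - dist (G.σ q o t) z) 0)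
          ∂(ENNReal.ofReal (t ^ N) • m.map (fun z => G.σ q z t)) := by
        rw [lintegral_smul_measure, lintegral_map hφ hmeas, smul_eq_mul]
    _ ≤ _ := lintegral_mono' (hMCP.smul_map_le hB q ht) le_rfl

/-- Bishop-Gromov bound for the volume of a shell. -/
lemma MCPzero.shell_le (hMCP : G.MCPzero m N) (hN : 0 ≤ N) (p : X) {R δ ε : ℝ} (hR : 0 < R)
    (hδ : 0 ≤ δ) (hδε : δ ≤ ε * R) (hε1 : ε < 1) :
    m.real (ball p (R + δ) \ ball p (R - δ)) ≤
      (1 - ((1 - ε) / (1 + ε)) ^ N) * m.real (ball p (R + δ)) := by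
  have hε0 : 0 ≤ ε := by
    by_contra! h
    nlinarith
  have hδR : δ < R := by nlinarith
  rw [measureReal_sdiff (ball_subset_ball (by linarith)) measurableSet_ball
    measure_ball_lt_top.ne]
  have h := hMCP.pow_mul_ball_le p (R + δ) (t := (R - δ) / (R + δ))
    (div_pos (by linarith) (by linarith)) ((div_le_one (by linarith)).2 (by linarith))
  rw [div_mul_cancel₀ _ (by linarith)] at h
  have h2 : ((1 - ε) / (1 + ε)) ^ N ≤ ((R - δ) / (R + δ)) ^ N := by
    refine Real.rpow_le_rpow (div_nonneg (by linarith) (by linarith)) ?_ hN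
    rw [div_le_div_iff₀ (by linarith) (by linarith)]
    nlinarith
  nlinarith [mul_le_mul_of_nonneg_right h2 (measureReal_nonneg (μ := m) (s := ball p (R + δ)))]

/-- The cone integral is concave along geodesics up to a boundary term, with a definite gain if the
convexity inequality of the distance is strict on a set of positive measure. -/
lemma BusemannConvex.coneIntegral_concave (hB : G.BusemannConvex) (p x : X) {t R e : ℝ}
    (ht : t ∈ Set.Icc (0:ℝ) 1) {E : Set X} (hE : MeasurableSet E)
    (hER : E ⊆ ball p (R - dist p x))
    (hEe : ∀ z ∈ E, e ≤ t * dist x z + (1 - t) * dist p z - dist (G.σ p x t) z) :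
    t * coneIntegral m R x + (1 - t) * coneIntegral m R p + e * m.real E ≤
      coneIntegral m R (G.σ p x t) +
        2 * (t * dist p x) * m.real (ball p (R + dist p x) \ ball p (R - dist p x)) := by
  set δ := dist p x with hδ
  set a := G.σ p x t with ha
  have hδ0 : 0 ≤ δ := dist_nonneg
  set S := ball p (R + δ) \ ball p (R - δ) with hS
  have hSm : MeasurableSet S := measurableSet_ball.diff measurableSet_ball
  have i1 := (integrable_cone (m := m) R x).const_mul t
  have i2 := (integrable_cone (m := m) R p).const_mul (1 - t)
  have i12 : Integrable
      (fun z => t * max (R - dist x z) 0 + (1 - t) * max (R - dist p z) 0) m := i1.add i2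
  have i3 := integrable_indicator_const (m := m) hE hER e
  have i4 := integrable_cone (m := m) R a
  have i5 := integrable_indicator_const (m := m) hSm (Set.sdiff_subset) (2 * (t * δ))
  rw [← integral_indicator_const_eq hE, ← integral_indicator_const_eq hSm]
  unfold coneIntegral
  rw [← integral_const_mul, ← integral_const_mul, ← integral_add i1 i2,
    ← integral_add i12 i3, ← integral_add i4 i5]
  refine integral_mono (i12.add i3) (i4.add i5) fun z => ?_
  have hconv := hB.dist_σ_le p x z ht
  have hxp := dist_triangle p x z
  have hpx := dist_triangle_left x z p
  have hap : dist p a = t * δ := G.dist_left_σ p x ht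
  have hapz := dist_triangle_left a z p
  rcases lt_or_ge (dist p z) (R - δ) with h1 | h1
  · have hzS : z ∉ S := fun h => h.2 (mem_ball'.2 h1)
    rw [Set.indicator_of_notMem hzS, max_eq_left (by linarith), max_eq_left (by linarith)]
    have h2 : E.indicator (fun _ => e) z ≤ t * dist x z + (1 - t) * dist p z - dist a z := by
      by_cases hz : z ∈ E
      · rw [Set.indicator_of_mem hz]
        exact hEe z hz
      · rw [Set.indicator_of_notMem hz]
        linarith
    linarith [le_max_left (R - dist a z) 0]
  · have hzE : z ∉ E := fun h => by
      have := mem_ball'.1 (hER h)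
      linarith
    rw [Set.indicator_of_notMem hzE]
    rcases lt_or_ge (dist p z) (R + δ) with h2 | h2
    · have hzS : z ∈ S := ⟨mem_ball'.2 h2, fun h => by
        have := mem_ball'.1 h
        linarith⟩
      rw [Set.indicator_of_mem hzS]
      have h3 : max (R - dist x z) 0 ≤ max (R - dist p z) 0 + δ :=
        max_le (by linarith [le_max_left (R - dist p z) 0])
          (by linarith [le_max_right (R - dist p z) 0])
      have h4 : max (R - dist p z) 0 ≤ max (R - dist a z) 0 + t * δ :=
        max_le (by linarith [le_max_left (R - dist a z) 0])
          (by linarith [le_max_right (R - dist a z) 0, mul_nonneg ht.1 hδ0])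
      linarith [mul_le_mul_of_nonneg_left h3 ht.1]
    · have hzS : z ∉ S := fun h => by
        have := mem_ball'.1 h.1
        linarith
      rw [Set.indicator_of_notMem hzS, max_eq_right (b := (0:ℝ)) (by linarith),
        max_eq_right (b := (0:ℝ)) (a := R - dist p z) (by linarith)]
      linarith [le_max_right (R - dist a z) 0]

end Cone

end GeodesicStructure

/-- A function continuous at zero and vanishing there is small at some positive number below one. -/
lemma exists_pos_lt_one_of_continuousAt {f : ℝ → ℝ} (hf : ContinuousAt f 0) (h0 : f 0 = 0)
    {c : ℝ} (hc : 0 < c) : ∃ s, 0 < s ∧ s < 1 ∧ f s ≤ c := by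
  have h1 : ∀ᶠ s in nhdsWithin (0 : ℝ) (Set.Ioi 0), f s < c :=
    (hf.eventually_lt_const (by rwa [h0])).filter_mono nhdsWithin_le_nhds
  have h2 : ∀ᶠ s in nhdsWithin (0 : ℝ) (Set.Ioi 0), s ∈ Set.Ioo (0 : ℝ) 1 :=
    Ioo_mem_nhdsGT one_pos
  obtain ⟨s, hs, hs'⟩ := (h1.and h2).exists
  exact ⟨s, hs'.1, hs'.2, hs.le⟩

/-- Relatively thin shells have small relative volume. -/
lemma exists_shell_width {N c : ℝ} (hN : 0 ≤ N) (hc : 0 < c) :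
    ∃ ε, 0 < ε ∧ ε < 1 ∧ 1 - ((1 - ε) / (1 + ε)) ^ N ≤ c := by
  refine exists_pos_lt_one_of_continuousAt (f := fun ε : ℝ => 1 - ((1 - ε) / (1 + ε)) ^ N)
    ?_ (by simp) hc
  have h : ContinuousAt (fun ε : ℝ => (1 - ε) / (1 + ε)) 0 :=
    ContinuousAt.div (by fun_prop) (by fun_prop) (by norm_num)
  exact continuousAt_const.sub (h.rpow_const (Or.inr hN))

namespace GeodesicStructure

section Rigidity

variable {X : Type*} [MetricSpace X] [ProperSpace X] [MeasurableSpace X] [BorelSpace X]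
  {G : GeodesicStructure X} {m : Measure X} {N : ℝ} [IsLocallyFiniteMeasure m]
  [m.IsOpenPosMeasure]

/-- At large scales the cone integral does not decrease to first order when its centre moves by a
bounded distance. -/
theorem MCPzero.exists_coneIntegral_ge (hMCP : G.MCPzero m N) (hN : 0 ≤ N)
    (hB : G.BusemannConvex) (hGC : G.GeodComplete) (o y : X) {ζ : ℝ} (hζ : 0 < ζ) :
    ∃ R₀ > 0, ∀ R ≥ R₀,
      coneIntegral m R o - ζ * m.real (ball o (2 * R)) ≤ coneIntegral m R y := by
  rcases eq_or_ne o y with rfl | hne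
  · refine ⟨1, one_pos, fun R _ => ?_⟩
    have := mul_nonneg hζ.le (measureReal_nonneg (μ := m) (s := ball o (2 * R)))
    linarith
  set D := dist o y with hD
  have hD0 : 0 < D := dist_pos.2 hne
  obtain ⟨ε, hε0, hε1, hε⟩ := exists_shell_width (N := N) (c := ζ / (6 * D)) hN (by positivity)
  obtain ⟨s, hs0, hs1, hs⟩ := exists_pos_lt_one_of_continuousAt
    (f := fun s : ℝ => 1 - (1 - s) ^ N)
    (continuousAt_const.sub ((by fun_prop : ContinuousAt (fun s : ℝ => 1 - s) 0).rpow_const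
      (Or.inr hN))) (by simp) (c := ζ * ε / (3 * D)) (by positivity)
  obtain ⟨Λ₀, hΛ₀, hΛ⟩ := hMCP.exists_asymptotic_reversibility hB hGC o hs0 hs1.le
    (κ := ζ * s / (3 * D)) (by positivity)
  refine ⟨max (Λ₀ / ε) (D / ε), by positivity, fun R hR => ?_⟩
  have hR1 : Λ₀ ≤ ε * R := by
    rw [← div_le_iff₀' hε0]; exact (le_max_left _ _).trans hR
  have hR2 : D ≤ ε * R := by
    rw [← div_le_iff₀' hε0]; exact (le_max_right _ _).trans hR
  have hR0 : 0 < R := by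
    by_contra! h
    nlinarith
  have hL0 : 0 < ε * R := by positivity
  have hLR : ε * R ≤ R := mul_le_of_le_one_left hR0.le hε1.le
  have hLs : ε * R ≤ ε * R / s := by
    rw [le_div_iff₀ hs0]
    exact mul_le_of_le_one_right hL0.le hs1.le
  obtain ⟨q, hq, hqy⟩ := hGC o y hne (ε * R / s) (hR2.trans hLs)
  have hsm : s ∈ Set.Icc (0:ℝ) 1 := ⟨hs0.le, hs1.le⟩
  have hsm' : 1 - s ∈ Set.Icc (0:ℝ) 1 := ⟨by linarith, by linarith⟩
  set t := D / (ε * R) with ht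
  have htm : t ∈ Set.Icc (0:ℝ) 1 := ⟨by positivity, (div_le_one hL0).2 hR2⟩
  have hx : dist o (G.σ o q s) = ε * R := by
    rw [G.dist_left_σ o q hsm, hq]; field_simp
  have hxy : G.σ o (G.σ o q s) t = y := by
    rw [G.σ_comp o q t htm s hsm, ← hqy, ht, hD]
    congr 1
    field_simp
  have hoa : dist o (G.σ q o (1 - s)) ≤ R := by
    rw [dist_comm, G.dist_σ_right q o hsm', dist_comm q o, hq]
    refine le_trans (le_of_eq ?_) hLR
    field_simp
    ring
  set V := m.real (ball o (2 * R)) with hV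
  have hV0 : 0 < V := measureReal_ball_pos o (by linarith)
  have h1 := hMCP.pow_mul_coneIntegral_le hB q o R hsm'
  have h2 := coneIntegral_le (m := m) hR0.le o
  have h3 := coneIntegral_le_add (m := m) hoa (G.σ o q s)
  have h4 := hΛ q (by rw [hq]; exact hR1.trans hLs)
  have h5 := hB.coneIntegral_concave (m := m) (E := ∅) (R := R) (e := 0) o (G.σ o q s) htm
    MeasurableSet.empty (Set.empty_subset _) (by simp)
  have h6 := hMCP.shell_le hN o hR0 hL0.le le_rfl hε1
  rw [hx, hxy, measureReal_empty, mul_zero, add_zero] at h5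
  have h7 : (1 - ((1 - ε) / (1 + ε)) ^ N) * m.real (ball o (R + ε * R)) ≤ ζ / (6 * D) * V :=
    mul_le_mul hε (measureReal_ball_mono (ball_subset_ball (by linarith))) measureReal_nonneg
      (by positivity)
  have h8 : coneIntegral m R o - ζ * ε / (3 * D) * (R * V) ≤
      coneIntegral m R (G.σ q o (1 - s)) := by
    have h0 : 0 ≤ coneIntegral m R o := integral_nonneg fun z => le_max_right _ _
    have := mul_le_mul hs h2 h0 (by positivity)
    linarith
  have h9 : dist (G.σ q o (1 - s)) (G.σ o q s) ≤ ζ * ε / (3 * D) * R := by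
    refine h4.trans (le_of_eq ?_)
    rw [hq]
    field_simp
  have h10 : coneIntegral m R o - 2 * (ζ * ε / (3 * D) * (R * V)) ≤
      coneIntegral m R (G.σ o q s) := by
    have := mul_le_mul_of_nonneg_right h9 hV0.le
    linarith
  have h11 : t * (2 * (ζ * ε / (3 * D) * (R * V))) = 2 / 3 * ζ * V := by
    rw [ht]; field_simp
  have h12 : 2 * (t * (ε * R)) * (ζ / (6 * D) * V) = ζ * V / 3 := by
    rw [ht]; field_simp; norm_num
  have h13 := mul_le_mul_of_nonneg_left h10 htm.1
  have h14 := mul_le_mul_of_nonneg_left (h6.trans h7) (by positivity : 0 ≤ 2 * (t * (ε * R)))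
  linarith

/-- The convexity inequality of the distance is almost an equality somewhere close to any far away
point. -/
lemma MCPzero.exists_almost_affine (hMCP : G.MCPzero m N) (hN : 0 ≤ N) (hB : G.BusemannConvex)
    (hGC : G.GeodComplete) (p x : X) {t : ℝ} (ht : t ∈ Set.Icc (0:ℝ) 1) {η e : ℝ} (hη : 0 < η)
    (hη1 : η ≤ 1 / 4) (he : 0 < e) :
    ∃ R₀ > 0, ∀ R ≥ R₀, ∀ w, dist x w = R / 2 → ∃ z, dist w z ≤ η * R ∧
      t * dist x z + (1 - t) * dist p z - dist (G.σ p x t) z ≤ e := by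
  set δ := dist p x with hδ
  have hδ0 : 0 ≤ δ := dist_nonneg
  set a := G.σ p x t with ha
  set c := e * (η / 4) ^ N with hc
  have hc0 : 0 < c := by positivity
  obtain ⟨ε, hε0, hε1, hε⟩ := exists_shell_width (N := N) (c := c / (8 * (δ + 1))) hN
    (by positivity)
  obtain ⟨R₁, hR₁, h₁⟩ := hMCP.exists_coneIntegral_ge hN hB hGC a x (ζ := c / 4) (by positivity)
  obtain ⟨R₂, hR₂, h₂⟩ := hMCP.exists_coneIntegral_ge hN hB hGC a p (ζ := c / 4) (by positivity)
  refine ⟨max (max R₁ R₂) (max (δ / ε) (8 * δ)), by positivity, fun R hR w hw => ?_⟩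
  have hRR₁ : R₁ ≤ R := ((le_max_left _ _).trans (le_max_left _ _)).trans hR
  have hRR₂ : R₂ ≤ R := ((le_max_right _ _).trans (le_max_left _ _)).trans hR
  have hRε : δ ≤ ε * R := by
    rw [← div_le_iff₀' hε0]
    exact ((le_max_left _ _).trans (le_max_right _ _)).trans hR
  have hRδ : 8 * δ ≤ R := ((le_max_right _ _).trans (le_max_right _ _)).trans hR
  have hR0 : 0 < R := hR₁.trans_le hRR₁
  by_contra! hfar
  have hap : dist p a = t * δ := G.dist_left_σ p x ht
  have hax : dist a x = (1 - t) * δ := G.dist_σ_right p x ht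
  have htδ : t * δ ≤ δ := mul_le_of_le_one_left hδ0 ht.2
  have htδ' : 0 ≤ t * δ := mul_nonneg ht.1 hδ0
  have hηR : η * R ≤ R / 4 := by linarith [mul_le_mul_of_nonneg_right hη1 hR0.le]
  set V := m.real (ball a (2 * R)) with hV
  have hV0 : 0 < V := measureReal_ball_pos a (by linarith)
  have h1 := h₁ R hRR₁
  have h2 := h₂ R hRR₂
  have h3 := hB.coneIntegral_concave (m := m) (R := R) (e := e) p x ht
    (E := ball w (η * R)) measurableSet_ball
    (ball_subset_ball' (by
      rw [dist_comm w p]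
      linarith [dist_triangle p x w]))
    fun z hz => (hfar z (mem_ball'.1 hz).le).le
  have h4 := hMCP.shell_le hN p hR0 hδ0 hRε hε1
  have h5 : m.real (ball p (R + δ)) ≤ V :=
    measureReal_ball_mono (ball_subset_ball' (by linarith))
  have h6 : (1 - ((1 - ε) / (1 + ε)) ^ N) * m.real (ball p (R + δ)) ≤ c / (8 * (δ + 1)) * V :=
    mul_le_mul hε h5 measureReal_nonneg (by positivity)
  have h7 : c * V ≤ e * m.real (ball w (η * R)) := by
    have h8 := hMCP.pow_mul_ball_le w (4 * R) (t := η / 4) (by positivity) (by linarith)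
    rw [show η / 4 * (4 * R) = η * R by ring] at h8
    have h9 : V ≤ m.real (ball w (4 * R)) := measureReal_ball_mono (ball_subset_ball' (by
      linarith [dist_triangle a x w]))
    rw [hc, mul_assoc]
    exact mul_le_mul_of_nonneg_left
      ((mul_le_mul_of_nonneg_left h9 (by positivity)).trans h8) he.le
  have h10 : 2 * (t * δ) * (c / (8 * (δ + 1)) * V) ≤ c * V / 4 := by
    calc 2 * (t * δ) * (c / (8 * (δ + 1)) * V) ≤ 2 * (δ + 1) * (c / (8 * (δ + 1)) * V) := by
          gcongr
          linarith
      _ = c * V / 4 := by field_simp; norm_num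
  have h11 := mul_le_mul_of_nonneg_left (h4.trans h6) (by positivity : 0 ≤ 2 * (t * δ))
  have h12 := mul_le_mul_of_nonneg_left h1 ht.1
  have h13 := mul_le_mul_of_nonneg_left h2 (sub_nonneg.2 ht.2)
  have h14 : 0 < c * V := mul_pos hc0 hV0
  linarith

theorem MCPzero.mul_dist_le (hMCP : G.MCPzero m N) (hN : 0 ≤ N) (hB : G.BusemannConvex)
    (hGC : G.GeodComplete) (p x y : X) {t : ℝ} (ht : t ∈ Set.Icc (0:ℝ) 1) :
    t * dist x y ≤ dist (G.σ p x t) (G.σ p y t) := by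
  rcases eq_or_ne x y with rfl | hne
  · simp
  set d := dist x y with hd
  have hd0 : 0 < d := dist_pos.2 hne
  refine le_of_forall_pos_le_add fun e he => ?_
  set η := min (1 / 4) (e / (8 * d)) with hη
  have hη0 : 0 < η := by positivity
  have hηd : 4 * η * d ≤ e / 2 := by
    have h : η ≤ e / (8 * d) := min_le_right _ _
    rw [le_div_iff₀ (by positivity)] at h
    linarith
  obtain ⟨R₀, hR₀, h⟩ := hMCP.exists_almost_affine hN hB hGC p x ht hη0 (min_le_left _ _)
    (half_pos he)
  set R := max R₀ (2 * d) with hR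
  have hdR : d ≤ R / 2 := by linarith [le_max_right R₀ (2 * d)]
  obtain ⟨w, hw, hwy⟩ := hGC x y hne (R / 2) hdR
  obtain ⟨z, hwz, hz⟩ := h R (le_max_left _ _) w hw
  have h1 := hB.dist_mul_le_sub (ρ := 2 * η) (by linarith) hw hdR hwy (w := z) (by linarith)
  have h2 := hB.dist_σ_le p y z ht
  have h3 := dist_triangle (G.σ p x t) (G.σ p y t) z
  have h4 := mul_le_mul_of_nonneg_left h1 ht.1
  have h5 := mul_le_of_le_one_left (by positivity : 0 ≤ 4 * η * d) ht.2
  linarith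

end Rigidity

end GeodesicStructure

theorem busemann_mcp_cone_type
    (X : Type*) [MetricSpace X] [Nonempty X] [CompleteSpace X] [ProperSpace X]
    [MeasurableSpace X] [BorelSpace X]
    (G : GeodesicStructure X) (hB : G.BusemannConvex) (hGC : G.GeodComplete)
    (m : Measure X) (hlf : IsLocallyFiniteMeasure m) (hpos : m.IsOpenPosMeasure)
    (N : ℝ) (hN : 1 ≤ N) (hMCP : G.MCPzero m N) :
    ∀ p x y : X, ∀ t ∈ Set.Icc (0:ℝ) 1,
      dist (G.σ p x t) (G.σ p y t) = t * dist x y := by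
  exact fun p x y t ht => le_antisymm (hB p x y t ht)
    (hMCP.mul_dist_le (zero_le_one.trans hN) hB hGC p x y ht)
end

section
/- Let X be a nonempty complete proper geodesic metric space with a local Busemann–MCP(K,N) structure for a Borel measure m, where K ≤ 0 and N ≥ 1. (i) If X contains a k-manifold point and a k'-manifold point (k, k' ∈ ℕ), then k = k'. (ii) If X contains a k-manifold point, then the set of k-manifold points is dense in X. -/
open Metric MeasureTheory ENNReal Filter

/-- A geodesic structure on a subset `U` of a metric space: a map `σ` defined on all of `X`
whose geodesic properties hold for points of `U`, and which maps `U` into itself. -/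
structure LocalGeodesicStructure (X : Type*) [MetricSpace X] (U : Set X) where
  σ : X → X → ℝ → X
  σ_mem : ∀ x ∈ U, ∀ y ∈ U, ∀ t ∈ Set.Icc (0:ℝ) 1, σ x y t ∈ U
  σ_zero : ∀ x ∈ U, ∀ y ∈ U, σ x y 0 = x
  σ_one : ∀ x ∈ U, ∀ y ∈ U, σ x y 1 = y
  dist_σ : ∀ x ∈ U, ∀ y ∈ U, ∀ s ∈ Set.Icc (0:ℝ) 1, ∀ t ∈ Set.Icc (0:ℝ) 1,
    dist (σ x y s) (σ x y t) = |s - t| * dist x y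
  σ_comp : ∀ x ∈ U, ∀ y ∈ U, ∀ s ∈ Set.Icc (0:ℝ) 1, ∀ t ∈ Set.Icc (0:ℝ) 1,
    σ x (σ x y t) s = σ x y (s * t)

/-- The integrand of the MCP(K,N) condition; for `K = 0` or `N = 1` it is interpreted
as `t ^ N`. -/
noncomputable def mcpCoeff (K N t d : ℝ) : ℝ :=
  if K = 0 ∨ N = 1 then t ^ N
  else t * (Real.sinh (t * d * Real.sqrt (-K / (N - 1))) /
      Real.sinh (d * Real.sqrt (-K / (N - 1)))) ^ (N - 1)

/-- `X` carries a local Busemann–MCP(K,N) structure for the Borel measure `m`: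
`m` is locally finite and positive on nonempty open sets, and every point has an open ball
around it carrying a Busemann convex geodesic structure satisfying the MCP(K,N) inequality. -/
def LocalBusemannMCP (X : Type*) [MetricSpace X] [MeasurableSpace X]
    (m : Measure X) (K N : ℝ) : Prop :=
  IsLocallyFiniteMeasure m ∧ m.IsOpenPosMeasure ∧
    ∀ z : X, ∃ r : ℝ, 0 < r ∧ ∃ L : LocalGeodesicStructure X (ball z r),
      (∀ p ∈ ball z r, ∀ x ∈ ball z r, ∀ y ∈ ball z r, ∀ t ∈ Set.Icc (0:ℝ) 1,
        dist (L.σ p x t) (L.σ p y t) ≤ t * dist x y) ∧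
      (∀ p ∈ ball z r, ∀ A : Set X, A ⊆ ball z r → MeasurableSet A →
        ∀ t ∈ Set.Icc (0:ℝ) 1,
          (∫⁻ a in A, ENNReal.ofReal (mcpCoeff K N t (dist p a)) ∂m) ≤
            m ((fun a => L.σ p a t) '' A))

/-- `X` is a geodesic metric space: any two points are joined by a shortest path. -/
def IsGeodesicMetricSpace (X : Type*) [MetricSpace X] : Prop :=
  ∀ x y : X, ∃ g : ℝ → X, g 0 = x ∧ g (dist x y) = y ∧
    ∀ s ∈ Set.Icc 0 (dist x y), ∀ t ∈ Set.Icc 0 (dist x y), dist (g s) (g t) = |s - t|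

/-- A point `p` is a `k`-manifold point if it has an open neighborhood homeomorphic to `ℝ^k`. -/
def IsManifoldPoint {X : Type*} [TopologicalSpace X] (k : ℕ) (p : X) : Prop :=
  ∃ U : Set X, IsOpen U ∧ p ∈ U ∧ Nonempty (U ≃ₜ (Fin k → ℝ))

section Brouwer

variable {E : Type*} [NormedAddCommGroup E] [InnerProductSpace ℝ E] [FiniteDimensional ℝ E]

/-- A family of integrals that depends polynomially on a parameter and is constant near `0` is
constant. -/
theorem integral_eq_of_polynomial {α : Type*} [MeasurableSpace α] {μ : Measure α}
    (f : ℝ → α → ℝ) (d : ℕ) {t₀ I₀ : ℝ} (ht₀ : 0 < t₀)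
    (hp : ∀ x, ∃ p : Polynomial ℝ, p.natDegree ≤ d ∧ ∀ t, p.eval t = f t x)
    (hint : ∀ t, Integrable (f t) μ) (hI : ∀ t, 0 < t → t < t₀ → ∫ x, f t x ∂μ = I₀) (s : ℝ) :
    ∫ x, f s x ∂μ = I₀ := by
  classical
  set v : ℕ → ℝ := fun i => t₀ / (i + 2) with hv
  set S := Finset.range (d + 1) with hS
  have hinj : Set.InjOn v S := by
    intro i _ j _ hij
    simp only [hv] at hij
    have h1 : (0 : ℝ) < i + 2 := by positivity
    have h2 : (0 : ℝ) < j + 2 := by positivity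
    rw [div_eq_div_iff h1.ne' h2.ne'] at hij
    have := mul_left_cancel₀ ht₀.ne' hij
    exact_mod_cast (by linarith : (i : ℝ) = j)
  have key : ∀ x, f s x = ∑ i ∈ S, f (v i) x * (Lagrange.basis S v i).eval s := by
    intro x
    obtain ⟨p, hpd, hpe⟩ := hp x
    have hdeg : p.degree < S.card := by
      rw [hS, Finset.card_range]
      exact lt_of_le_of_lt Polynomial.degree_le_natDegree (by exact_mod_cast Nat.lt_succ_of_le hpd)
    have := congrArg (Polynomial.eval s) (Lagrange.eq_interpolate hinj hdeg)
    rw [Lagrange.interpolate_apply, Polynomial.eval_finsetSum] at this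
    simpa [hpe] using this
  simp_rw [key]
  rw [integral_finsetSum _ fun i _ => (hint (v i)).mul_const _]
  have hlt : ∀ i, ∫ x, f (v i) x ∂μ = I₀ := by
    intro i
    have h1 : (1 : ℝ) < i + 2 := by
      have : (0 : ℝ) ≤ i := i.cast_nonneg
      linarith
    exact hI _ (by positivity) (div_lt_self ht₀ h1)
  simp_rw [integral_mul_const, hlt, ← Finset.mul_sum]
  rw [← Polynomial.eval_finsetSum, Lagrange.sum_basis hinj ⟨0, by simp [hS]⟩]
  simp

theorem exists_polynomial_det (A : E →L[ℝ] E) :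
    ∃ p : Polynomial ℝ, p.natDegree ≤ Module.finrank ℝ E ∧
      ∀ t : ℝ, p.eval t = (ContinuousLinearMap.id ℝ E + t • A).det := by
  classical
  set b := Module.finBasis ℝ E
  set M := LinearMap.toMatrix b b (A : E →ₗ[ℝ] E)
  refine ⟨((Polynomial.X : Polynomial ℝ) • M.map Polynomial.C +
      (1 : Matrix _ _ ℝ).map Polynomial.C).det, ?_, fun t => ?_⟩
  · simpa using Polynomial.natDegree_det_X_add_C_le M 1
  · rw [← Polynomial.coe_evalRingHom, RingHom.map_det]
    change _ = LinearMap.det ((ContinuousLinearMap.id ℝ E + t • A : E →L[ℝ] E) : E →ₗ[ℝ] E)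
    rw [← LinearMap.det_toMatrix b]
    congr 1
    have : ((ContinuousLinearMap.id ℝ E + t • A : E →L[ℝ] E) : E →ₗ[ℝ] E) =
      LinearMap.id + t • (A : E →ₗ[ℝ] E) := rfl
    have h2 : LinearMap.toMatrix b b (LinearMap.id + t • (A : E →ₗ[ℝ] E)) = 1 + t • M := by
      rw [map_add, map_smul, LinearMap.toMatrix_id]
    rw [this, h2]
    ext i j
    simp only [RingHom.mapMatrix_apply, Matrix.map_apply, Matrix.add_apply, Matrix.smul_apply,
      smul_eq_mul, Polynomial.coe_evalRingHom, Polynomial.eval_add, Polynomial.eval_mul,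
      Polynomial.eval_X, Polynomial.eval_C]
    ring

theorem det_id_add_smul_pos {A : E →L[ℝ] E} {C : ℝ} (hA : ∀ v, ‖A v‖ ≤ C * ‖v‖) {t : ℝ}
    (ht : 0 ≤ t) (htC : t * C < 1) : 0 < (ContinuousLinearMap.id ℝ E + t • A).det := by
  set g : ℝ → ℝ := fun s => (ContinuousLinearMap.id ℝ E + s • A).det with hg
  have hcont : Continuous g := ContinuousLinearMap.continuous_det.comp (by fun_prop)
  have hne : ∀ s ∈ Set.Icc 0 t, g s ≠ 0 := by
    intro s hs h0
    have := LinearMap.bot_lt_ker_of_det_eq_zero h0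
    obtain ⟨v, hv, hv0⟩ := SetLike.exists_of_lt this
    rw [LinearMap.mem_ker] at hv
    have hv' : v + s • A v = 0 := hv
    have hvne : v ≠ 0 := by simpa using hv0
    have hn : ‖v‖ = s * ‖A v‖ := by
      rw [eq_neg_of_add_eq_zero_left hv', norm_neg, norm_smul, Real.norm_of_nonneg hs.1,
        ← eq_neg_of_add_eq_zero_left hv']
    have hpos : 0 < ‖v‖ := norm_pos_iff.2 hvne
    have h1 : s * ‖A v‖ ≤ s * (C * ‖v‖) := mul_le_mul_of_nonneg_left (hA v) hs.1
    have h2 : s * C < 1 := by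
      rcases le_total 0 C with hC | hC
      · exact lt_of_le_of_lt (mul_le_mul_of_nonneg_right hs.2 hC) htC
      · exact lt_of_le_of_lt (mul_nonpos_of_nonneg_of_nonpos hs.1 hC) one_pos
    nlinarith
  have h0 : g 0 = 1 := by
    have : ContinuousLinearMap.id ℝ E + (0 : ℝ) • A = ContinuousLinearMap.id ℝ E := by simp
    simp only [hg, this]
    exact LinearMap.det_id
  by_contra hneg
  obtain ⟨s, hs, hs0⟩ := intermediate_value_Icc' ht hcont.continuousOn
    (show (0 : ℝ) ∈ Set.Icc (g t) (g 0) from ⟨not_lt.1 hneg, by rw [h0]; exact zero_le_one⟩)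
  exact hne s hs hs0

/-- A `C¹` perturbation of the identity supported in the unit ball hits the origin. -/
theorem exists_add_eq_zero_of_contDiff {w : E → E} (hw : ContDiff ℝ 1 w)
    (hw0 : ∀ x, 1 ≤ ‖x‖ → w x = 0) : ∃ x, x + w x = 0 := by
  by_contra! hcon
  borelize E
  set μ : Measure E := volume
  set B : Set E := ball 0 1 with hB
  have hBm : MeasurableSet B := measurableSet_ball
  have hfin : μ B < ∞ := measure_ball_lt_top
  have hcs : HasCompactSupport w := HasCompactSupport.intro (isCompact_closedBall (0 : E) 1)
    fun x hx => hw0 x (by simpa using (not_le.1 (by simpa using hx)).le)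
  obtain ⟨L, hL⟩ := hw.lipschitzWith_of_hasCompactSupport hcs one_ne_zero
  have hL' : ∀ x y, ‖w x - w y‖ ≤ L * ‖x - y‖ := fun x y => by
    simpa [dist_eq_norm] using hL.dist_le_mul x y
  have hdw : ∀ x, HasFDerivAt w (fderiv ℝ w x) x := fun x =>
    (hw.differentiable one_ne_zero x).hasFDerivAt
  have hdL : ∀ x v, ‖fderiv ℝ w x v‖ ≤ L * ‖v‖ := fun x v =>
    (ContinuousLinearMap.le_opNorm _ _).trans
      (mul_le_mul_of_nonneg_right (norm_fderiv_le_of_lipschitz ℝ hL) (norm_nonneg _))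
  have hcd : Continuous (fderiv ℝ w) := hw.continuous_fderiv one_ne_zero
  -- lower and upper bounds on the closed unit ball
  have hFc : Continuous fun x => ‖x + w x‖ := by have := hw.continuous; fun_prop
  have hcpt := isCompact_closedBall (0 : E) 1
  obtain ⟨x₀, hx₀, hmin⟩ := hcpt.exists_isMinOn ⟨0, by simp⟩ hFc.continuousOn
  obtain ⟨x₁, hx₁, hmax⟩ := hcpt.exists_isMaxOn ⟨0, by simp⟩ hFc.continuousOn
  set δ := ‖x₀ + w x₀‖ with hδ
  have hδ0 : 0 < δ := norm_pos_iff.2 (hcon x₀)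
  set M := max ‖x₁ + w x₁‖ 1 with hM
  have hM1 : 1 ≤ M := le_max_right _ _
  have hlow : ∀ x ∈ B, δ ≤ ‖x + w x‖ := fun x hx => hmin (ball_subset_closedBall hx)
  have hup : ∀ x ∈ B, ‖x + w x‖ ≤ M := fun x hx =>
    (hmax (ball_subset_closedBall hx) : ‖x + w x‖ ≤ ‖x₁ + w x₁‖).trans (le_max_left _ _)
  have hδM : δ ≤ M := (hlow 0 (by simp [hB])).trans (hup 0 (by simp [hB]))
  set P : ℕ → E → ℝ := fun n y => (1 - ‖y‖ ^ 2 / M ^ 2) ^ n with hP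
  set f : ℕ → ℝ → E → ℝ := fun n t x =>
    P n (x + t • w x) * (ContinuousLinearMap.id ℝ E + t • fderiv ℝ w x).det with hf
  have hfc : ∀ n t, Continuous (f n t) := by
    intro n t
    refine Continuous.mul ?_ (ContinuousLinearMap.continuous_det.comp (by fun_prop))
    have := hw.continuous
    simp only [hP]
    fun_prop
  have hint : ∀ (g : E → ℝ), Continuous g → Integrable g (μ.restrict B) := fun g hg =>
    (hg.continuousOn.integrableOn_compact hcpt).mono_set ball_subset_closedBall
  have hpoly : ∀ n x, ∃ p : Polynomial ℝ, p.natDegree ≤ n * 2 + Module.finrank ℝ E ∧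
      ∀ t, p.eval t = f n t x := by
    intro n x
    obtain ⟨p, hp1, hp2⟩ := exists_polynomial_det (fderiv ℝ w x)
    set q : Polynomial ℝ := Polynomial.C (-(‖w x‖ ^ 2 / M ^ 2)) * Polynomial.X ^ 2 +
      Polynomial.C (-(2 * inner ℝ x (w x) / M ^ 2)) * Polynomial.X +
      Polynomial.C (1 - ‖x‖ ^ 2 / M ^ 2) with hq
    refine ⟨q ^ n * p, ?_, fun t => ?_⟩
    · refine Polynomial.natDegree_mul_le.trans (add_le_add ?_ hp1)
      exact Polynomial.natDegree_pow_le.trans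
        (Nat.mul_le_mul_left _ Polynomial.natDegree_quadratic_le)
    · rw [Polynomial.eval_mul, Polynomial.eval_pow, hp2]
      simp only [hf, hP]
      congr 2
      rw [norm_add_sq_real, norm_smul, inner_smul_right, mul_pow, Real.norm_eq_abs, sq_abs]
      simp only [hq, Polynomial.eval_add, Polynomial.eval_mul, Polynomial.eval_C,
        Polynomial.eval_pow, Polynomial.eval_X]
      ring
  -- change of variables for small times
  have hsmall : ∀ (n : ℕ) (t : ℝ), 0 < t → t < 1 / (L + 1) →
      ∫ x in B, f n t x ∂μ = ∫ x in B, P n x ∂μ := by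
    intro n t ht0 ht1
    have hL1 : (0 : ℝ) < L + 1 := by positivity
    have htL : t * L < 1 := by
      have h1 := (lt_div_iff₀ hL1).1 ht1
      nlinarith
    set G : E → E := fun x => x + t • w x with hG
    have hGout : ∀ x, x ∉ B → G x = x := fun x hx => by
      have : 1 ≤ ‖x‖ := by simpa [hB] using hx
      simp [hG, hw0 x this]
    have hinj : Function.Injective G := by
      intro x y hxy
      by_contra hne
      have h1 : x - y = t • (w y - w x) := by
        have : x + t • w x = y + t • w y := hxy
        rw [smul_sub, sub_eq_sub_iff_add_eq_add, this]
        abel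
      have h2 : ‖x - y‖ = t * ‖w y - w x‖ := by
        conv_lhs => rw [h1]
        rw [norm_smul, Real.norm_of_nonneg ht0.le]
      have h3 := hL' y x
      rw [norm_sub_rev y x] at h3
      have h4 : 0 < ‖x - y‖ := norm_pos_iff.2 (sub_ne_zero.2 hne)
      nlinarith
    have hsurj : Function.Surjective G := by
      intro y
      have hc : ContractingWith ⟨t * L, by positivity⟩ (fun x => y - t • w x) := by
        refine ⟨by exact_mod_cast htL, LipschitzWith.of_dist_le_mul fun a b => ?_⟩
        rw [dist_eq_norm, dist_eq_norm, _root_.sub_sub_sub_cancel_left, ← smul_sub, norm_smul,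
          Real.norm_of_nonneg ht0.le, norm_sub_rev a b]
        have := mul_le_mul_of_nonneg_left (hL' b a) ht0.le
        exact this.trans_eq (mul_assoc _ _ _).symm
      refine ⟨ContractingWith.fixedPoint _ hc, ?_⟩
      have := hc.fixedPoint_isFixedPt
      have h2 : y - t • w (ContractingWith.fixedPoint _ hc) = ContractingWith.fixedPoint _ hc :=
        this
      simp only [hG]
      nth_rewrite 1 [← h2]
      abel
    have himg : G '' B = B := by
      ext y
      constructor
      · rintro ⟨x, hx, rfl⟩
        by_contra hn
        exact hn (by rw [hinj (hGout _ hn)]; exact hx)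
      · intro hy
        obtain ⟨x, rfl⟩ := hsurj y
        by_cases hx : x ∈ B
        · exact ⟨x, hx, rfl⟩
        · rw [hGout x hx] at hy
          exact absurd hy hx
    have hcv := integral_image_eq_integral_abs_det_fderiv_smul μ hBm
      (f := G) (f' := fun x => ContinuousLinearMap.id ℝ E + t • fderiv ℝ w x)
      (fun x _ => ((hasFDerivAt_id x).add ((hdw x).const_smul t)).hasFDerivWithinAt)
      hinj.injOn (P n)
    rw [himg] at hcv
    rw [hcv]
    congr 1
    ext x
    rw [abs_of_pos (det_id_add_smul_pos (hdL x) ht0.le htL), smul_eq_mul, mul_comm]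
  have hone : ∀ n, ∫ x in B, f n 1 x ∂μ = ∫ x in B, P n x ∂μ := fun n =>
    integral_eq_of_polynomial (f n) _ (by positivity) (hpoly n) (fun t => hint _ (hfc n t))
      (hsmall n) 1
  -- compare the growth of both sides
  set J : E → ℝ := fun x => (ContinuousLinearMap.id ℝ E + (1 : ℝ) • fderiv ℝ w x).det with hJ
  have hJc : Continuous J := ContinuousLinearMap.continuous_det.comp (by fun_prop)
  set a := 1 - δ ^ 2 / M ^ 2 with ha
  set b := 1 - (δ / 2) ^ 2 / M ^ 2 with hb
  have hM0 : 0 < M := by linarith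
  have ha0 : 0 ≤ a := by
    have : δ ^ 2 / M ^ 2 ≤ 1 := by
      rw [div_le_one (by positivity)]
      gcongr
    linarith
  have hab : a < b := by
    have : (δ / 2) ^ 2 / M ^ 2 < δ ^ 2 / M ^ 2 := by
      gcongr
      linarith
    linarith
  have hupper : ∀ n, ∫ x in B, f n 1 x ∂μ ≤ a ^ n * ∫ x in B, |J x| ∂μ := by
    intro n
    rw [← integral_const_mul]
    refine setIntegral_mono_on (hint _ (hfc n 1)) (hint _ (by fun_prop)) hBm fun x hx => ?_
    simp only [hf, hP, one_smul]
    have h1 : 0 ≤ 1 - ‖x + w x‖ ^ 2 / M ^ 2 := by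
      have : ‖x + w x‖ ^ 2 / M ^ 2 ≤ 1 := by
        rw [div_le_one (by positivity)]
        have := hup x hx
        gcongr
      linarith
    have h2 : 1 - ‖x + w x‖ ^ 2 / M ^ 2 ≤ a := by
      have := hlow x hx
      rw [ha]
      gcongr
    calc _ ≤ (1 - ‖x + w x‖ ^ 2 / M ^ 2) ^ n * |J x| := by
          refine mul_le_mul_of_nonneg_left ?_ (pow_nonneg h1 n)
          simpa [hJ] using le_abs_self (J x)
      _ ≤ _ := by gcongr
  set s := min (δ / 2) 1 with hs
  have hs0 : 0 < s := by positivity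
  set V := μ.real (ball (0 : E) s) with hV
  have hV0 : 0 < V := by
    rw [hV, measureReal_def]
    exact ENNReal.toReal_pos (measure_ball_pos μ _ hs0).ne' measure_ball_lt_top.ne
  have hPc : ∀ n, Continuous (P n) := fun n => by simp only [hP]; fun_prop
  have hlower : ∀ n, b ^ n * V ≤ ∫ x in B, P n x ∂μ := by
    intro n
    have hsub : ball (0 : E) s ⊆ B := ball_subset_ball (min_le_right _ _)
    have h1 : ∫ x in ball (0 : E) s, P n x ∂μ ≤ ∫ x in B, P n x ∂μ := by
      refine setIntegral_mono_set (hint _ (hPc n)) ?_ hsub.eventuallyLE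
      refine (ae_restrict_mem hBm).mono fun x hx => ?_
      have hx1 : ‖x‖ < 1 := by simpa [hB] using hx
      have : ‖x‖ ^ 2 / M ^ 2 ≤ 1 := by
        rw [div_le_one (by positivity)]
        have : ‖x‖ ≤ M := by linarith
        gcongr
      exact pow_nonneg (by linarith) n
    refine le_trans ?_ h1
    have h2 : b ^ n * V = ∫ _x in ball (0 : E) s, b ^ n ∂μ := by
      rw [setIntegral_const, smul_eq_mul, mul_comm]
    rw [h2]
    refine setIntegral_mono_on (integrableOn_const measure_ball_lt_top.ne)
      ((hint _ (hPc n)).mono_measure (Measure.restrict_mono hsub le_rfl)) measurableSet_ball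
      fun x hx => ?_
    have hx1 : ‖x‖ < s := by simpa using hx
    have hx2 : ‖x‖ ≤ δ / 2 := hx1.le.trans (min_le_left _ _)
    simp only [hP, hb]
    have h0 : 0 ≤ b := by linarith
    refine pow_le_pow_left₀ h0 ?_ n
    rw [hb]
    gcongr
  set I := ∫ x in B, |J x| ∂μ with hI
  have hall : ∀ n, b ^ n * V ≤ a ^ n * I := fun n =>
    (hlower n).trans ((hone n).symm.le.trans (hupper n))
  have hb0 : 0 < b := by linarith
  have hratio : ∀ n, V ≤ (a / b) ^ n * I := by
    intro n
    rw [div_pow, div_mul_eq_mul_div, le_div_iff₀ (by positivity), mul_comm]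
    exact hall n
  have hlim : Tendsto (fun n : ℕ => (a / b) ^ n * I) atTop (nhds (0 * I)) :=
    (tendsto_pow_atTop_nhds_zero_of_lt_one (by positivity) ((div_lt_one hb0).2 hab)).mul_const I
  rw [zero_mul] at hlim
  linarith [ge_of_tendsto' hlim hratio]

/-- A continuous perturbation of the identity of size at most `1/4` hits the origin. -/
theorem exists_add_eq_zero_of_norm_le {u : E → E} (hu : Continuous u)
    (hb : ∀ x, ‖u x‖ ≤ 1 / 4) : ∃ x, ‖x‖ ≤ 1 ∧ x + u x = 0 := by
  by_contra! hcon
  have hFc : Continuous fun x => ‖x + u x‖ := by fun_prop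
  obtain ⟨x₀, hx₀, hmin⟩ := (isCompact_closedBall (0 : E) 1).exists_isMinOn ⟨0, by simp⟩
    hFc.continuousOn
  have hδ0 : 0 < ‖x₀ + u x₀‖ := norm_pos_iff.2 (hcon x₀ (by simpa using hx₀))
  set δ := min ‖x₀ + u x₀‖ (1 / 8) with hδ
  obtain ⟨v, hv, hvu, -⟩ := hu.exists_contDiff_approx 1 (ε := fun _ => δ) continuous_const
    (fun _ => by positivity)
  let χ : ContDiffBump (0 : E) := ⟨1 / 2, 1, by norm_num, by norm_num⟩
  have hχ : ContDiff ℝ 1 χ := χ.contDiff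
  obtain ⟨x, hx⟩ := exists_add_eq_zero_of_contDiff (w := fun x => χ x • v x)
    (hχ.smul (by exact_mod_cast hv)) fun x hx => by
      rw [χ.zero_of_le_dist (by simpa [χ] using hx), zero_smul]
  have hvx : ‖v x - u x‖ < δ := by simpa [dist_eq_norm] using hvu x
  have hv1 : ‖v x‖ ≤ 3 / 8 := by
    have h1 : ‖v x‖ ≤ ‖u x‖ + ‖v x - u x‖ := by
      simpa using norm_add_le (u x) (v x - u x)
    have h2 : δ ≤ 1 / 8 := min_le_right _ _
    linarith [hb x]
  have hxn : ‖x‖ ≤ 3 / 8 := by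
    rw [eq_neg_of_add_eq_zero_left hx, norm_neg, norm_smul, Real.norm_of_nonneg χ.nonneg]
    exact (mul_le_of_le_one_left (norm_nonneg _) χ.le_one).trans hv1
  have hχ1 : χ x = 1 := χ.one_of_mem_closedBall (by simp [χ]; linarith)
  simp only [hχ1, one_smul] at hx
  have h1 : ‖x₀ + u x₀‖ ≤ ‖x + u x‖ := hmin (by simp; linarith)
  have h2 : x + u x = -(v x - u x) := by
    have h3 := eq_neg_of_add_eq_zero_right hx
    rw [h3]; abel
  rw [h2, norm_neg] at h1
  linarith [min_le_left ‖x₀ + u x₀‖ (1 / 8)]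

end Brouwer

/-- A continuous self-map of a ball of `ℝ^k` that is close to the identity attains all values
near the centre. -/
theorem exists_near_id_surjective (k : ℕ) : ∃ a : ℝ, 0 < a ∧ a < 1 ∧
    ∀ (c : Fin k → ℝ) (R : ℝ), 0 < R → ∀ p : (Fin k → ℝ) → (Fin k → ℝ),
      ContinuousOn p (closedBall c R) → (∀ x ∈ closedBall c R, ‖p x - x‖ ≤ a * R) →
      ∀ y ∈ closedBall c (a * R), ∃ x ∈ closedBall c R, p x = y := by
  set e := EuclideanSpace.equiv (Fin k) ℝ with he
  have he1 : ∀ x, ‖e x‖ ≤ ‖x‖ := fun x =>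
    (pi_norm_le_iff_of_nonneg (norm_nonneg _)).2 fun i => PiLp.norm_apply_le x i
  set C := ‖(e.symm : (Fin k → ℝ) →L[ℝ] EuclideanSpace ℝ (Fin k))‖ + 1 with hC
  have hC1 : 1 ≤ C := by simp [hC]
  have he2 : ∀ y, ‖e.symm y‖ ≤ C * ‖y‖ := fun y =>
    (ContinuousLinearMap.le_opNorm (e.symm : (Fin k → ℝ) →L[ℝ] EuclideanSpace ℝ (Fin k)) y).trans
      (mul_le_mul_of_nonneg_right (by simp [hC]) (norm_nonneg _))
  have hC0 : 0 < C := by linarith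
  refine ⟨1 / (8 * C), by positivity, ?_, ?_⟩
  · rw [div_lt_one (by positivity)]; linarith
  intro c R hR p hp hpx y hy
  set r : EuclideanSpace ℝ (Fin k) → EuclideanSpace ℝ (Fin k) := fun x => (max 1 ‖x‖)⁻¹ • x with hr
  have hrc : Continuous r := by
    refine ((continuous_const.max continuous_norm).inv₀ fun x => ?_).smul continuous_id
    have : (1 : ℝ) ≤ max 1 ‖x‖ := le_max_left _ _
    linarith
  have hr1 : ∀ x, ‖r x‖ ≤ 1 := by
    intro x
    have h1 : (1 : ℝ) ≤ max 1 ‖x‖ := le_max_left _ _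
    rw [hr, norm_smul, norm_inv, Real.norm_of_nonneg (by linarith), inv_mul_le_iff₀ (by linarith),
      mul_one]
    exact le_max_right _ _
  set q : EuclideanSpace ℝ (Fin k) → (Fin k → ℝ) := fun x => c + R • e (r x) with hq
  have hqc : Continuous q := by fun_prop
  have hqm : ∀ x, q x ∈ closedBall c R := by
    intro x
    rw [mem_closedBall, dist_eq_norm, hq, add_sub_cancel_left, norm_smul, Real.norm_of_nonneg hR.le]
    exact mul_le_of_le_one_right hR.le ((he1 _).trans (hr1 x))
  set u : EuclideanSpace ℝ (Fin k) → EuclideanSpace ℝ (Fin k) :=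
    fun x => R⁻¹ • e.symm ((p (q x) - q x) + (c - y)) with hu
  have hpq : Continuous fun x => p (q x) := hp.comp_continuous hqc hqm
  have huc : Continuous u := by
    have h1 : Continuous fun x => (p (q x) - q x) + (c - y) :=
      (hpq.sub hqc).add continuous_const
    have h2 := e.symm.continuous.comp h1
    exact h2.const_smul R⁻¹
  have hub : ∀ x, ‖u x‖ ≤ 1 / 4 := by
    intro x
    rw [hu, norm_smul, norm_inv, Real.norm_of_nonneg hR.le, inv_mul_le_iff₀ hR]
    refine (he2 _).trans ?_
    have h1 := norm_add_le (p (q x) - q x) (c - y)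
    have h2 := hpx _ (hqm x)
    have h3 : ‖c - y‖ ≤ 1 / (8 * C) * R := by
      rw [← dist_eq_norm, dist_comm]; exact hy
    calc C * ‖(p (q x) - q x) + (c - y)‖ ≤ C * (1 / (8 * C) * R + 1 / (8 * C) * R) := by
          gcongr; linarith
      _ = R * (1 / 4) := by field_simp; ring
  obtain ⟨x, hx1, hx⟩ := exists_add_eq_zero_of_norm_le huc hub
  refine ⟨q x, hqm x, ?_⟩
  have hrx : r x = x := by simp [hr, max_eq_left hx1]
  have h1 : x = -(R⁻¹ • e.symm ((p (q x) - q x) + (c - y))) := eq_neg_of_add_eq_zero_left hx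
  have h2 : R • e x = -((p (q x) - q x) + (c - y)) := by
    conv_lhs => rw [h1]
    rw [map_neg, map_smul, e.apply_symm_apply, smul_neg, smul_smul, mul_inv_cancel₀ hR.ne',
      one_smul]
  have h3 : q x = c + R • e x := by simp only [hq]; rw [hrx]
  have h4 : q x - c = R • e x := by rw [h3]; abel
  rw [h2] at h4
  have h5 : p (q x) - y = 0 := by
    have : q x - c + ((p (q x) - q x) + (c - y)) = 0 := by rw [h4]; abel
    rw [← this]; abel
  exact sub_eq_zero.1 h5

/-- `y` is attained on `P ∩ W` by every continuous map on `P` sufficiently close to `g`. -/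
def StablyAttained {V : Type*} [PseudoMetricSpace V] (P W : Set V) (g : V → V) (y : V) : Prop :=
  ∃ ε > 0, ∀ g' : V → V, ContinuousOn g' P → (∀ x ∈ P, dist (g' x) (g x) < ε) →
    ∃ x ∈ P, x ∈ W ∧ g' x = y

/-- Perturbations of a map supported on disjoint sets can be glued. -/
theorem exists_glued_perturbation {Y V : Type*} [TopologicalSpace Y] [NormedAddCommGroup V]
    [NormedSpace ℝ V] {ι : Type*} (S : Finset ι) {P : Set Y} {g : Y → V} (hg : ContinuousOn g P)
    {ε : ℝ} (hε : 0 < ε) (l : ι → Y → ℝ) (hl : ∀ i ∈ S, ContinuousOn (l i) P)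
    (hl0 : ∀ i x, 0 ≤ l i x) (hl1 : ∀ i x, l i x ≤ 1)
    (hdisj : ∀ x ∈ P, ∀ i ∈ S, ∀ j ∈ S, l i x ≠ 0 → l j x ≠ 0 → i = j)
    (G : ι → Y → V) (hG : ∀ i ∈ S, ContinuousOn (G i) P)
    (hGg : ∀ i ∈ S, ∀ x ∈ P, dist (G i x) (g x) < ε) :
    ∃ H : Y → V, ContinuousOn H P ∧ (∀ x ∈ P, dist (H x) (g x) < ε) ∧
      ∀ x ∈ P, ∀ i ∈ S, l i x = 1 → H x = G i x := by
  have single : ∀ x ∈ P, ∀ i ∈ S, l i x ≠ 0 →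
      ∑ j ∈ S, l j x • (G j x - g x) = l i x • (G i x - g x) := fun x hx i hi hne =>
    Finset.sum_eq_single i (fun j hj hji => by
      by_cases h0 : l j x = 0
      · rw [h0, zero_smul]
      · exact absurd (hdisj x hx j hj i hi h0 hne) hji) fun h => absurd hi h
  refine ⟨fun x => g x + ∑ i ∈ S, l i x • (G i x - g x), ?_, fun x hx => ?_, fun x hx i hi h1 => ?_⟩
  · exact hg.add (continuousOn_finsetSum _ fun i hi => (hl i hi).smul ((hG i hi).sub hg))
  · rw [dist_eq_norm, add_sub_cancel_left]
    by_cases hex : ∃ i ∈ S, l i x ≠ 0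
    · obtain ⟨i, hi, hne⟩ := hex
      rw [single x hx i hi hne, norm_smul, Real.norm_of_nonneg (hl0 i x), ← dist_eq_norm]
      exact (mul_le_of_le_one_left dist_nonneg (hl1 i x)).trans_lt (hGg i hi x hx)
    · push Not at hex
      rw [Finset.sum_eq_zero fun i hi => by rw [hex i hi, zero_smul], norm_zero]
      exact hε
  · have hne : l i x ≠ 0 := by rw [h1]; exact one_ne_zero
    simp only [single x hx i hi hne, h1, one_smul, add_sub_cancel]

/-- A tent cutoff in a metric space. -/
noncomputable def tentCutoff {Y : Type*} [PseudoMetricSpace Y] (w : Y) (s : ℝ) (y : Y) : ℝ :=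
  max 0 (min 1 (2 - 2 * dist y w / s))

section tentCutoff

variable {Y : Type*} [PseudoMetricSpace Y] {w y : Y} {s : ℝ}

theorem tentCutoff_nonneg : 0 ≤ tentCutoff w s y := le_max_left _ _

theorem tentCutoff_le_one : tentCutoff w s y ≤ 1 := max_le zero_le_one (min_le_left _ _)

theorem continuous_tentCutoff : Continuous (tentCutoff w s) := by
  unfold tentCutoff
  fun_prop

theorem dist_lt_of_tentCutoff_ne_zero (hs : 0 < s) (h : tentCutoff w s y ≠ 0) : dist y w < s := by
  by_contra! hle
  refine h (max_eq_left (min_le_of_right_le ?_))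
  have : 1 ≤ dist y w / s := (one_le_div hs).2 hle
  rw [mul_div_assoc]
  linarith

theorem tentCutoff_eq_one (hs : 0 < s) (h : dist y w ≤ s / 2) : tentCutoff w s y = 1 := by
  have : dist y w / s ≤ 1 / 2 := by rw [div_le_iff₀ hs]; linarith
  have h2 : 1 ≤ 2 - 2 * dist y w / s := by rw [mul_div_assoc]; linarith
  rw [tentCutoff, min_eq_left h2, max_eq_right zero_le_one]

end tentCutoff

section LatticeRetraction

variable {k : ℕ}

/-- The vector of distances of the coordinates to the nearest integers. -/
noncomputable def latticeDist (y : Fin k → ℝ) : Fin k → ℝ := fun i => |y i - round (y i)|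

/-- The radial projection from the nearest lattice points onto the boundaries of the cubes of
side one centred at the lattice points. -/
noncomputable def latticeRetraction (y : Fin k → ℝ) : Fin k → ℝ := fun i =>
  y i + (y i - round (y i)) * (1 - 2 * ‖latticeDist y‖) / (2 * ‖latticeDist y‖)

theorem continuous_latticeDist : Continuous (latticeDist (k := k)) := by
  have : Continuous fun t : ℝ => |t - round t| := by
    refine (LipschitzWith.of_le_add fun s t => ?_).continuous
    calc |s - round s| ≤ |s - round t| := round_le s (round t)
      _ = |(t - round t) + (s - t)| := by congr 1; ring
      _ ≤ _ := abs_add_le _ _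
  exact continuous_pi fun i => this.comp (continuous_apply i)

theorem norm_latticeDist_le (y : Fin k → ℝ) : ‖latticeDist y‖ ≤ 1 / 2 :=
  (pi_norm_le_iff_of_nonneg (by norm_num)).2 fun i => by
    simpa [latticeDist] using abs_sub_round (y i)

theorem abs_sub_round_le_norm (y : Fin k → ℝ) (i : Fin k) :
    |y i - round (y i)| ≤ ‖latticeDist y‖ := by
  simpa [latticeDist] using norm_le_pi_norm (latticeDist y) i

theorem continuousAt_latticeRetraction {y : Fin k → ℝ} (hy : latticeDist y ≠ 0) :
    ContinuousAt latticeRetraction y := by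
  have hM : Continuous fun z : Fin k → ℝ => ‖latticeDist z‖ := continuous_latticeDist.norm
  refine continuousAt_pi.2 fun i => ?_
  refine (continuous_apply i).continuousAt.add
    (ContinuousAt.div ?_ (continuousAt_const.mul hM.continuousAt) ?_)
  swap
  · simpa using hy
  rcases (norm_latticeDist_le y).lt_or_eq with hlt | heq
  · have h1 : |y i - round (y i)| < 1 / 2 := (abs_sub_round_le_norm y i).trans_lt hlt
    have h2 : ContinuousAt (fun z : Fin k → ℝ => (z i - round (y i)) * (1 - 2 * ‖latticeDist z‖))
        y := by fun_prop
    refine h2.congr ?_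
    have h3 : Continuous fun z : Fin k → ℝ => |z i - round (y i)| := by fun_prop
    filter_upwards [h3.continuousAt.eventually_lt_const h1] with z hz
    have h4 := abs_sub_round (z i)
    have h5 : |((round (z i) : ℤ) : ℝ) - round (y i)| < 1 := by
      calc _ = |(z i - round (y i)) - (z i - round (z i))| := by congr 1; ring
        _ ≤ _ := abs_sub _ _
        _ < 1 := by linarith
    have h6 : |round (z i) - round (y i)| < 1 := by exact_mod_cast h5
    rw [show round (z i) = round (y i) by rw [Int.abs_lt_one_iff] at h6; lia]
  · rw [ContinuousAt, heq]
    simp only [mul_one_div, ne_eq, OfNat.ofNat_ne_zero, not_false_eq_true, div_self, sub_self,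
      mul_zero]
    have h0 : Tendsto (fun z : Fin k → ℝ => 1 - 2 * ‖latticeDist z‖) (nhds y) (nhds 0) := by
      have : Continuous fun z : Fin k → ℝ => 1 - 2 * ‖latticeDist z‖ := by fun_prop
      have h := this.tendsto y
      rwa [heq, show (1 : ℝ) - 2 * (1 / 2) = 0 by norm_num] at h
    refine squeeze_zero_norm (fun z => ?_) h0
    have h1 := abs_sub_round (z i)
    have h2 := norm_latticeDist_le z
    rw [norm_mul, Real.norm_eq_abs, Real.norm_of_nonneg (by linarith)]
    exact mul_le_of_le_one_left (by linarith) (by linarith)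

theorem norm_latticeRetraction_sub_le {y : Fin k → ℝ} (hy : latticeDist y ≠ 0) :
    ‖latticeRetraction y - y‖ ≤ 1 := by
  refine (pi_norm_le_iff_of_nonneg zero_le_one).2 fun i => ?_
  have h1 := abs_sub_round_le_norm y i
  have h2 := norm_latticeDist_le y
  have h3 : 0 < ‖latticeDist y‖ := norm_pos_iff.2 hy
  rw [Pi.sub_apply, latticeRetraction, add_sub_cancel_left, norm_div, norm_mul, Real.norm_eq_abs,
    Real.norm_of_nonneg (by linarith), Real.norm_of_nonneg (by linarith), div_le_one (by linarith)]
  nlinarith [abs_nonneg (y i - round (y i))]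

/-- The points having a half-integer coordinate. -/
def halfLatticeWalls (k : ℕ) : Set (Fin k → ℝ) :=
  ⋃ (i : Fin k) (n : ℤ), {y | y i = n + 1 / 2}

theorem volume_halfLatticeWalls : volume (halfLatticeWalls k) = 0 := by
  refine measure_iUnion_null fun i => measure_iUnion_null fun n => ?_
  exact Measure.pi_hyperplane (fun _ => volume) i _

theorem latticeRetraction_mem {y : Fin k → ℝ} (hy : latticeDist y ≠ 0) :
    latticeRetraction y ∈ halfLatticeWalls k := by
  have hne : Nonempty (Fin k) := by
    by_contra h
    rw [not_nonempty_iff] at h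
    exact hy (Subsingleton.elim _ _)
  obtain ⟨i, hi⟩ := Finite.exists_max (latticeDist y)
  have h3 : 0 < ‖latticeDist y‖ := norm_pos_iff.2 hy
  have h4 : ‖latticeDist y‖ = |y i - round (y i)| := by
    refine le_antisymm ((pi_norm_le_iff_of_nonneg (abs_nonneg _)).2 fun j => ?_)
      (abs_sub_round_le_norm y i)
    rw [Real.norm_of_nonneg (show 0 ≤ latticeDist y j from abs_nonneg _)]
    exact hi j
  simp only [halfLatticeWalls, Set.mem_iUnion, Set.mem_ofPred_eq, latticeRetraction, h4]
  rw [h4] at h3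
  rcases abs_cases (y i - round (y i)) with ⟨he, h⟩ | ⟨he, h⟩
  · refine ⟨i, round (y i), ?_⟩
    rw [he] at h3 ⊢
    field_simp
    ring
  · refine ⟨i, round (y i) - 1, ?_⟩
    rw [he] at h3 ⊢
    have : y i - round (y i) ≠ 0 := h.ne
    push_cast
    have h5 : -(y i - ↑(round (y i))) ≠ 0 := h3.ne'
    have h6 : (y i - round (y i)) * (1 - 2 * -(y i - round (y i))) / (2 * -(y i - round (y i)))
      = -(1 - 2 * -(y i - round (y i))) / 2 := by
      field_simp
    rw [h6]
    ring

end LatticeRetraction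

section StableValue

variable {k : ℕ}

/-- A map on a compact set all of whose lattice values are unstable is uniformly close to a map with
null image. -/
theorem exists_null_image_of_lattice_unstable {P : Set (Fin k → ℝ)} (hP : IsCompact P)
    {g : (Fin k → ℝ) → (Fin k → ℝ)} (hg : ContinuousOn g P)
    (hun : ∀ y, ¬ StablyAttained P Set.univ g y) :
    ∃ h : (Fin k → ℝ) → (Fin k → ℝ), ContinuousOn h P ∧ (∀ x ∈ P, dist (h x) (g x) < 2) ∧
      volume (h '' P) = 0 := by
  have hex : ∀ y, ∃ G : (Fin k → ℝ) → (Fin k → ℝ), ContinuousOn G P ∧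
      (∀ x ∈ P, dist (G x) (g x) < 1 / 16) ∧ ∀ x ∈ P, G x ≠ y := by
    intro y
    by_contra! hcon
    refine hun y ⟨1 / 16, by norm_num, fun G hG hGg => ?_⟩
    obtain ⟨x, hx, hxy⟩ := hcon G hG hGg
    exact ⟨x, hx, trivial, hxy⟩
  choose G hGc hGg hGne using hex
  let ι : (Fin k → ℤ) → (Fin k → ℝ) := fun n i => n i
  have hιd : ∀ n n', dist (ι n) (ι n') < 1 → n = n' := by
    intro n n' h
    ext i
    have h1 := (dist_le_pi_dist (ι n) (ι n') i).trans_lt h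
    rw [Real.dist_eq] at h1
    change |(n i : ℝ) - n' i| < 1 at h1
    have h2 : |n i - n' i| < 1 := by exact_mod_cast h1
    rw [Int.abs_lt_one_iff] at h2
    lia
  obtain ⟨M, hM⟩ := (hP.image_of_continuousOn hg).isBounded.subset_closedBall 0
  let S : Finset (Fin k → ℤ) := Fintype.piFinset fun _ => Finset.Icc (-⌈M + 1⌉) ⌈M + 1⌉
  have hS : ∀ x ∈ P, ∀ n, dist (g x) (ι n) < 1 → n ∈ S := by
    intro x hx n hn
    have h1 : ‖g x‖ ≤ M := by simpa using hM ⟨x, hx, rfl⟩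
    rw [Fintype.mem_piFinset]
    intro i
    have h2 : ‖ι n i‖ ≤ M + 1 := by
      refine (norm_le_pi_norm (ι n) i).trans ?_
      have := norm_sub_norm_le (ι n) (g x)
      rw [← dist_eq_norm, dist_comm] at this
      linarith
    have h3 : |(n i : ℝ)| ≤ ⌈M + 1⌉ := h2.trans (Int.le_ceil _)
    have h4 : |n i| ≤ ⌈M + 1⌉ := by exact_mod_cast h3
    exact Finset.mem_Icc.2 (abs_le.1 h4)
  obtain ⟨H, hHc, hHg, hH⟩ := exists_glued_perturbation S hg (ε := 1 / 16) (by norm_num)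
    (fun n x => tentCutoff (ι n) (1 / 4) (g x))
    (fun n _ => continuous_tentCutoff.comp_continuousOn hg)
    (fun _ _ => tentCutoff_nonneg) (fun _ _ => tentCutoff_le_one)
    (fun x _ n _ n' _ h h' => hιd n n' <| by
      have h1 := dist_lt_of_tentCutoff_ne_zero (by norm_num) h
      have h2 := dist_lt_of_tentCutoff_ne_zero (by norm_num) h'
      linarith [dist_triangle_left (ι n) (ι n') (g x)])
    (fun n => G (ι n)) (fun n _ => hGc _) fun n _ => hGg _
  have hne : ∀ x ∈ P, latticeDist (H x) ≠ 0 := by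
    intro x hx h0
    have h1 : H x = ι fun i => round (H x i) := by
      ext i
      have := congrFun h0 i
      simpa [latticeDist, sub_eq_zero] using this
    set n := fun i => round (H x i)
    have h2 : dist (g x) (ι n) < 1 / 16 := by
      rw [← h1, dist_comm]
      exact hHg x hx
    have h3 := hH x hx n (hS x hx n (by linarith))
      (tentCutoff_eq_one (by norm_num) (by linarith))
    exact hGne (ι n) x hx (h3.symm.trans h1)
  refine ⟨fun x => latticeRetraction (H x), fun x hx =>
    (continuousAt_latticeRetraction (hne x hx)).comp_continuousWithinAt (hHc x hx),
    fun x hx => ?_, ?_⟩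
  · have h1 := norm_latticeRetraction_sub_le (hne x hx)
    rw [← dist_eq_norm] at h1
    linarith [dist_triangle (latticeRetraction (H x)) (H x) (g x), hHg x hx]
  · refine measure_mono_null ?_ volume_halfLatticeWalls
    rintro _ ⟨x, hx, rfl⟩
    exact latticeRetraction_mem (hne x hx)

theorem StablyAttained.of_smul {P W : Set (Fin k → ℝ)} {g : (Fin k → ℝ) → (Fin k → ℝ)}
    {y : Fin k → ℝ} {a : ℝ} (ha : 0 < a) (h : StablyAttained P W (fun x => a • g x) (a • y)) :
    StablyAttained P W g y := by
  obtain ⟨ε, hε, h⟩ := h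
  refine ⟨ε / a, by positivity, fun g' hg' hd => ?_⟩
  obtain ⟨x, hx, hxW, hxy⟩ := h (fun x => a • g' x) (hg'.const_smul a) fun x hx => by
    rw [dist_smul₀, Real.norm_of_nonneg ha.le]
    have := (lt_div_iff₀ ha).1 (hd x hx)
    linarith
  exact ⟨x, hx, hxW, (smul_right_injective _ ha.ne') hxy⟩

open scoped Pointwise in
/-- A map on a compact set without stable values is a uniform limit of maps with null image. -/
theorem exists_null_image_of_unstable {P : Set (Fin k → ℝ)} (hP : IsCompact P)
    {g : (Fin k → ℝ) → (Fin k → ℝ)} (hg : ContinuousOn g P)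
    (hun : ∀ y, ¬ StablyAttained P Set.univ g y) {δ : ℝ} (hδ : 0 < δ) :
    ∃ h : (Fin k → ℝ) → (Fin k → ℝ), ContinuousOn h P ∧ (∀ x ∈ P, dist (h x) (g x) < δ) ∧
      volume (h '' P) = 0 := by
  set a := 2 / δ with ha
  have ha0 : 0 < a := by positivity
  obtain ⟨h, hc, hd, hn⟩ := exists_null_image_of_lattice_unstable hP (hg.const_smul a) fun y hy =>
    hun (a⁻¹ • y) (StablyAttained.of_smul ha0 (by rwa [smul_inv_smul₀ ha0.ne']))
  refine ⟨fun x => a⁻¹ • h x, hc.const_smul a⁻¹, fun x hx => ?_, ?_⟩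
  · have h1 := hd x hx
    have h2 : g x = a⁻¹ • a • g x := by rw [inv_smul_smul₀ ha0.ne']
    rw [h2, dist_smul₀, norm_inv, Real.norm_of_nonneg ha0.le, inv_mul_lt_iff₀ ha0, ha,
      div_mul_cancel₀ _ hδ.ne']
    exact h1
  · have : (fun x => a⁻¹ • h x) '' P = a⁻¹ • (h '' P) := by
      rw [← Set.image_smul, Set.image_image]
    rw [this, Measure.addHaar_smul, hn, mul_zero]

/-- Near a finite fibre, a map on a compact set admits a locally constant approximate inverse. -/
theorem exists_locally_constant_near_fiber {Y Z : Type*} [MetricSpace Y] [MetricSpace Z]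
    [Nonempty Y] {P : Set Y} (hP : IsCompact P) {g : Y → Z} (hg : ContinuousOn g P) {y : Z}
    (hfin : (P ∩ g ⁻¹' {y}).Finite) {η : ℝ} (hη : 0 < η) :
    ∃ δ > 0, ∃ v : Y → Y, (Set.range v).Finite ∧ ∀ x ∈ P, dist (g x) y < δ →
      ContinuousAt v x ∧ dist (v x) x ≤ η := by
  classical
  set T := P ∩ g ⁻¹' {y} with hT
  obtain ⟨s₀, hs₀, hsep⟩ : ∃ s > 0, ∀ w ∈ T, ∀ w' ∈ T, w ≠ w' → s ≤ dist w w' := by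
    by_cases hne : T.offDiag.Nonempty
    · obtain ⟨p, hp, hmin⟩ := Set.exists_min_image T.offDiag (fun p => dist p.1 p.2)
        hfin.offDiag hne
      exact ⟨dist p.1 p.2, dist_pos.2 hp.2.2, fun w hw w' hw' hww => hmin (w, w') ⟨hw, hw', hww⟩⟩
    · exact ⟨1, one_pos, fun w hw w' hw' hww => absurd ⟨(w, w'), hw, hw', hww⟩ hne⟩
  set s := min η (s₀ / 2) with hs
  have hs0 : 0 < s := by positivity
  have hs2 : s ≤ s₀ / 2 := min_le_right _ _
  let v : Y → Y := fun x => if h : ∃ w ∈ T, dist x w < s then h.choose else Classical.arbitrary Y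
  have hv : ∀ w ∈ T, ∀ x, dist x w < s → v x = w := by
    intro w hw x hx
    have hex : ∃ w ∈ T, dist x w < s := ⟨w, hw, hx⟩
    have h1 := hex.choose_spec
    have h2 : v x = hex.choose := dif_pos hex
    rw [h2]
    by_contra hne
    linarith [hsep _ h1.1 w hw hne, dist_triangle_left hex.choose w x]
  have hvr : (Set.range v).Finite := by
    refine (hfin.union (Set.finite_singleton (Classical.arbitrary Y))).subset ?_
    rintro _ ⟨x, rfl⟩
    by_cases hex : ∃ w ∈ T, dist x w < s
    · left
      have h2 : v x = hex.choose := dif_pos hex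
      rw [h2]
      exact hex.choose_spec.1
    · right
      exact dif_neg hex
  have hgood : ∀ x, (∃ w ∈ T, dist x w < s) → ContinuousAt v x ∧ dist (v x) x ≤ η := by
    rintro x ⟨w, hw, hx⟩
    refine ⟨?_, ?_⟩
    · have : v =ᶠ[nhds x] fun _ => w := by
        filter_upwards [isOpen_ball.mem_nhds (show x ∈ ball w s from hx)] with x' hx'
        exact hv w hw x' hx'
      exact continuousAt_const.congr this.symm
    · rw [hv w hw x hx, dist_comm]
      exact hx.le.trans (min_le_left _ _)
  set N := ⋃ w ∈ T, ball w s with hN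
  have hNo : IsOpen N := isOpen_biUnion fun _ _ => isOpen_ball
  have hK : IsCompact (P \ N) := hP.diff hNo
  obtain ⟨δ, hδ, hfar⟩ : ∃ δ > 0, ∀ x ∈ P \ N, δ ≤ dist (g x) y := by
    rcases (P \ N).eq_empty_or_nonempty with he | hne
    · exact ⟨1, one_pos, fun x hx => by rw [he] at hx; exact hx.elim⟩
    · have hgc : ContinuousOn (fun x => dist (g x) y) (P \ N) :=
        fun x hx => ((hg x hx.1).mono Set.sdiff_subset).dist continuousWithinAt_const
      obtain ⟨x₀, hx₀, hmin⟩ := hK.exists_isMinOn hne hgc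
      refine ⟨dist (g x₀) y, dist_pos.2 fun h => hx₀.2 ?_, fun x hx => hmin hx⟩
      exact Set.mem_biUnion (show x₀ ∈ T from ⟨hx₀.1, h⟩) (mem_ball_self hs0)
  refine ⟨δ, hδ, v, hvr, fun x hx hxy => hgood x ?_⟩
  by_contra hcon
  refine (hfar x ⟨hx, fun h => hcon ?_⟩).not_gt hxy
  obtain ⟨w, hw, hxw⟩ := Set.mem_iUnion₂.1 h
  exact ⟨w, hw, hxw⟩

/-- A finite-to-one map from a ball of `ℝ^k` to `ℝ^k` has a stable value. -/
theorem exists_stablyAttained {c : Fin k → ℝ} {R : ℝ} (hR : 0 < R)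
    {g : (Fin k → ℝ) → (Fin k → ℝ)} (hg : ContinuousOn g (closedBall c R))
    (hfin : ∀ y, (closedBall c R ∩ g ⁻¹' {y}).Finite) :
    ∃ y, StablyAttained (closedBall c R) Set.univ g y := by
  by_contra! hun
  set P := closedBall c R with hPdef
  have hP : IsCompact P := isCompact_closedBall c R
  obtain ⟨a, ha0, -, hsurj⟩ := exists_near_id_surjective k
  have hη : 0 < a * R := by positivity
  choose δ hδ v hvr hv using fun y => exists_locally_constant_near_fiber hP hg (hfin y) hη
  obtain ⟨A, hA⟩ := (hP.image_of_continuousOn hg).elim_finite_subcover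
    (fun y => ball y (δ y / 4)) (fun _ => isOpen_ball)
    (fun y _ => Set.mem_iUnion.2 ⟨y, mem_ball_self (by linarith [hδ y])⟩)
  have hcov : ∀ x ∈ P, ∃ y ∈ A, dist (g x) y < δ y / 4 := by
    intro x hx
    obtain ⟨y, hy, hxy⟩ := Set.mem_iUnion₂.1 (hA ⟨x, hx, rfl⟩)
    exact ⟨y, hy, hxy⟩
  have hAne : A.Nonempty := by
    obtain ⟨y, hy, -⟩ := hcov c (mem_closedBall_self hR.le)
    exact ⟨y, hy⟩
  obtain ⟨y₁, -, hmin⟩ := A.exists_min_image δ hAne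
  obtain ⟨h, hhc, hhg, hhn⟩ := exists_null_image_of_unstable hP hg hun (δ := δ y₁ / 4)
    (by linarith [hδ y₁])
  let ψ : ∀ y : Fin k → ℝ, ContDiffBump y := fun y =>
    ⟨δ y / 4, δ y / 2, by linarith [hδ y], by linarith [hδ y]⟩
  have hψd : ∀ y, Differentiable ℝ (ψ y) := fun y =>
    ((ψ y).contDiff (n := 1)).differentiable one_ne_zero
  set D : (Fin k → ℝ) → ℝ := fun z => ∑ y ∈ A, ψ y z with hD
  have hDpos : ∀ x ∈ P, 0 < D (h x) := by
    intro x hx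
    obtain ⟨y, hy, hxy⟩ := hcov x hx
    refine Finset.sum_pos' (fun _ _ => (ψ _).nonneg) ⟨y, hy, (ψ y).pos_of_mem_ball ?_⟩
    rw [mem_ball]
    change dist (h x) y < δ y / 2
    linarith [dist_triangle (h x) (g x) y, hhg x hx, hmin y hy]
  have hclose : ∀ x ∈ P, ∀ y ∈ A, dist (h x) y ≤ δ y / 2 → dist (g x) y < δ y := by
    intro x hx y hy hxy
    have := hhg x hx
    rw [dist_comm] at this
    linarith [dist_triangle (g x) (h x) y, hmin y hy, hδ y]
  let p : (Fin k → ℝ) → (Fin k → ℝ) := fun x => (D (h x))⁻¹ • ∑ y ∈ A, ψ y (h x) • v y x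
  have hpc : ContinuousOn p P := by
    have hDc : Continuous D := continuous_finsetSum _ fun y _ => (ψ y).continuous
    refine ((hDc.comp_continuousOn hhc).inv₀ fun x hx => (hDpos x hx).ne').smul
      (continuousOn_finsetSum _ fun y hy x hx => ?_)
    by_cases hxy : dist (h x) y ≤ δ y / 2
    · exact ((ψ y).continuous.comp_continuousOn hhc x hx).smul
        (hv y x hx (hclose x hx y hy hxy)).1.continuousWithinAt
    · have h1 : ∀ᶠ x' in nhdsWithin x P, δ y / 2 < dist (h x') y :=
        ((hhc x hx).dist continuousWithinAt_const).eventually_const_lt (not_le.1 hxy)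
      have h2 : ∀ x', δ y / 2 < dist (h x') y → ψ y (h x') • v y x' = 0 := fun x' hx' => by
        rw [(ψ y).zero_of_le_dist hx'.le, zero_smul]
      exact (continuousWithinAt_const (b := (0 : Fin k → ℝ))).congr_of_eventuallyEq
        (h1.mono h2) (h2 x (not_le.1 hxy))
  have hpx : ∀ x ∈ P, ‖p x - x‖ ≤ a * R := by
    intro x hx
    have hD0 := hDpos x hx
    have h1 : p x - x = (D (h x))⁻¹ • ∑ y ∈ A, ψ y (h x) • (v y x - x) := by
      simp only [smul_sub, Finset.sum_sub_distrib, ← Finset.sum_smul]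
      rw [inv_smul_smul₀ hD0.ne']
    rw [h1, norm_smul, norm_inv, Real.norm_of_nonneg hD0.le, inv_mul_le_iff₀ hD0, hD,
      Finset.sum_mul]
    refine norm_sum_le_of_le _ fun y hy => ?_
    rw [norm_smul, Real.norm_of_nonneg (ψ y).nonneg]
    by_cases hxy : dist (h x) y ≤ δ y / 2
    · have := (hv y x hx (hclose x hx y hy hxy)).2
      rw [dist_eq_norm] at this
      exact mul_le_mul_of_nonneg_left this (ψ y).nonneg
    · rw [(ψ y).zero_of_le_dist (not_le.1 hxy).le, zero_mul, zero_mul]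
  let Q : (A → (Fin k → ℝ)) → (Fin k → ℝ) → (Fin k → ℝ) := fun s z =>
    (D z)⁻¹ • ∑ y : A, ψ y z • s y
  have hnull : volume (p '' P) = 0 := by
    have hsub : p '' P ⊆ ⋃ s ∈ Set.pi Set.univ fun y : A => Set.range (v y), Q s '' (h '' P) := by
      rintro _ ⟨x, hx, rfl⟩
      refine Set.mem_biUnion (show (fun y : A => v y x) ∈ _ from fun y _ => ⟨x, rfl⟩)
        ⟨h x, ⟨x, hx, rfl⟩, ?_⟩
      simp only [Q, p]
      rw [← Finset.sum_coe_sort A]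
    refine measure_mono_null hsub ((measure_biUnion_null_iff
      (Set.Finite.pi fun y : A => hvr y).countable).2 fun s _ => ?_)
    refine addHaar_image_eq_zero_of_differentiableOn_of_addHaar_eq_zero volume ?_ hhn
    rintro _ ⟨x, hx, rfl⟩
    have hDd : Differentiable ℝ D := Differentiable.fun_sum fun y _ => hψd y
    have h1 : DifferentiableAt ℝ (fun z => ∑ y : A, ψ y z • s y) (h x) :=
      DifferentiableAt.fun_sum fun y _ => (hψd y _).smul_const _
    exact (((hDd _).inv (hDpos x hx).ne').smul h1).differentiableWithinAt
  have hball : closedBall c (a * R) ⊆ p '' P := fun y hy => by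
    obtain ⟨x, hx, hxy⟩ := hsurj c R hR p hpc hpx y hy
    exact ⟨x, hx, hxy⟩
  exact (measure_closedBall_pos volume c hη).ne' (measure_mono_null hball hnull)

end StableValue

/-- The properties of a Busemann convex geodesic structure with the measure contraction property
that enter the argument: `F c x t` is the point at parameter `t` of the geodesic from `c` to `x`. -/
structure ContractionFamily {X : Type*} [MetricSpace X] [MeasurableSpace X] (m : Measure X)
    (U : Set X) (F : X → X → ℝ → X) (κ : ℝ → ℝ) : Prop where
  isOpen : IsOpen U
  mem : ∀ c ∈ U, ∀ x ∈ U, ∀ t ∈ Set.Icc (0 : ℝ) 1, F c x t ∈ U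
  apply_zero : ∀ c ∈ U, ∀ x ∈ U, F c x 0 = c
  apply_one : ∀ c ∈ U, ∀ x ∈ U, F c x 1 = x
  dist_eq : ∀ c ∈ U, ∀ x ∈ U, ∀ s ∈ Set.Icc (0 : ℝ) 1, ∀ t ∈ Set.Icc (0 : ℝ) 1,
    dist (F c x s) (F c x t) = |s - t| * dist c x
  comp : ∀ c ∈ U, ∀ x ∈ U, ∀ s ∈ Set.Icc (0 : ℝ) 1, ∀ t ∈ Set.Icc (0 : ℝ) 1,
    F c (F c x t) s = F c x (s * t)
  convex : ∀ c ∈ U, ∀ x ∈ U, ∀ y ∈ U, ∀ t ∈ Set.Icc (0 : ℝ) 1,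
    dist (F c x t) (F c y t) ≤ t * dist x y
  coeff_pos : ∀ t, 0 < t → 0 < κ t
  coeff_mono : ∀ s t, 0 < s → s ≤ t → t ≤ 1 → κ s ≤ κ t
  coeff_one : κ 1 = 1
  coeff_continuousAt : ContinuousAt κ 1
  measure_image : ∀ c ∈ U, ∀ A ⊆ U, MeasurableSet A → c ∉ A → ∀ t ∈ Set.Ioc (0 : ℝ) 1,
    ENNReal.ofReal (κ t) * m A ≤ m ((fun a => F c a t) '' A)

theorem mul_exp_le_sinh_div_sinh {t d : ℝ} (ht0 : 0 < t) (ht1 : t ≤ 1) (hd : 0 < d) :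
    t * Real.exp (-((1 - t) * d)) ≤ Real.sinh (t * d) / Real.sinh d := by
  have hs : 0 < Real.sinh d := Real.sinh_pos_iff.2 hd
  rw [le_div_iff₀ hs, Real.sinh_eq, Real.sinh_eq]
  have hconv := convexOn_exp.2 (Set.mem_univ (-(2 * d))) (Set.mem_univ 0) ht0.le
    (sub_nonneg.2 ht1) (by ring)
  simp only [smul_eq_mul, mul_zero, add_zero, Real.exp_zero, mul_one] at hconv
  have h1 : Real.exp (-((1 - t) * d)) * Real.exp d = Real.exp (t * d) := by
    rw [← Real.exp_add]; congr 1; ring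
  have h2 : Real.exp (-((1 - t) * d)) * Real.exp (-d) = Real.exp (t * d) * Real.exp (-(2 * d)) := by
    rw [← Real.exp_add, ← Real.exp_add]; congr 1; ring
  have h3 : Real.exp (-(t * d)) = Real.exp (t * d) * Real.exp (t * -(2 * d)) := by
    rw [← Real.exp_add]; congr 1; ring
  have h4 := mul_le_mul_of_nonneg_left hconv (Real.exp_pos (t * d)).le
  rw [h3]
  have h5 : t * Real.exp (-((1 - t) * d)) * ((Real.exp d - Real.exp (-d)) / 2) =
      t * (Real.exp (-((1 - t) * d)) * Real.exp d -
        Real.exp (-((1 - t) * d)) * Real.exp (-d)) / 2 := by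
    ring
  rw [h5, h1, h2]
  nlinarith

/-- A lower bound of the distortion coefficients that is uniform on bounded sets. -/
noncomputable def coeffBound (N Θ t : ℝ) : ℝ := t * (t * Real.exp (-((1 - t) * Θ))) ^ (N - 1)

theorem coeffBound_le_mcpCoeff {K N t d D : ℝ} (hK : K ≤ 0) (hN : 1 ≤ N) (ht0 : 0 < t)
    (ht1 : t ≤ 1) (hd : 0 < d) (hdD : d ≤ D) :
    coeffBound N (D * Real.sqrt (-K / (N - 1))) t ≤ mcpCoeff K N t d := by
  have hexp : Real.exp (-((1 - t) * (D * Real.sqrt (-K / (N - 1))))) ≤ 1 := by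
    rw [Real.exp_le_one_iff, neg_nonpos]
    have : 0 ≤ D := by linarith
    have : 0 ≤ 1 - t := by linarith
    positivity
  unfold coeffBound mcpCoeff
  split_ifs with hKN
  · calc _ ≤ t * t ^ (N - 1) := by
          refine mul_le_mul_of_nonneg_left
            (Real.rpow_le_rpow (by positivity) ?_ (by linarith)) ht0.le
          exact mul_le_of_le_one_right ht0.le hexp
      _ = t ^ N := by
          rw [← Real.rpow_one_add' ht0.le (by linarith)]
          congr 1; ring
  · push Not at hKN
    have hN1 : 0 < N - 1 := by
      have := lt_of_le_of_ne hN hKN.2.symm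
      linarith
    have hs : 0 < Real.sqrt (-K / (N - 1)) := by
      have : 0 < -K := by
        have := lt_of_le_of_ne hK hKN.1
        linarith
      exact Real.sqrt_pos.2 (by positivity)
    refine mul_le_mul_of_nonneg_left (Real.rpow_le_rpow (by positivity) ?_ hN1.le) ht0.le
    rw [mul_assoc t d]
    refine le_trans ?_ (mul_exp_le_sinh_div_sinh ht0 ht1 (by positivity))
    have : 0 ≤ 1 - t := by linarith
    gcongr

theorem exists_contractionFamily {X : Type*} [MetricSpace X] [MeasurableSpace X] [BorelSpace X]
    {m : Measure X} {K N : ℝ} (hK : K ≤ 0) (hN : 1 ≤ N) (h : LocalBusemannMCP X m K N) (z : X) :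
    ∃ r > 0, ∃ F κ, ContractionFamily m (ball z r) F κ := by
  obtain ⟨-, -, h⟩ := h
  obtain ⟨r, hr, L, hconv, hmcp⟩ := h z
  set Θ := (2 * r) * Real.sqrt (-K / (N - 1)) with hΘ
  have hΘ0 : 0 ≤ Θ := by positivity
  refine ⟨r, hr, L.σ, coeffBound N Θ, isOpen_ball, L.σ_mem, L.σ_zero, L.σ_one, L.dist_σ, L.σ_comp,
    hconv, fun t ht => ?_, fun s t hs hst ht => ?_, ?_, ?_, fun p hp A hA hAm hpA t ht => ?_⟩
  · unfold coeffBound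
    positivity
  · unfold coeffBound
    refine mul_le_mul hst (Real.rpow_le_rpow (by positivity) ?_ (by linarith)) (by positivity)
      (by linarith)
    have : 0 < t := by linarith
    gcongr
  · simp [coeffBound]
  · unfold coeffBound
    refine continuousAt_id.mul (ContinuousAt.rpow_const ?_ (Or.inl ?_))
    · fun_prop
    · simp
  · refine le_trans ?_ (hmcp p hp A hA hAm t ⟨ht.1.le, ht.2⟩)
    rw [← setLIntegral_const]
    refine setLIntegral_mono' hAm fun a ha => ENNReal.ofReal_le_ofReal ?_
    refine coeffBound_le_mcpCoeff hK hN ht.1 ht.2 (dist_pos.2 fun h => hpA (h ▸ ha)) ?_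
    have h1 := mem_ball.1 (hA ha)
    have h2 := mem_ball.1 hp
    linarith [dist_triangle_right p a z]

/-- Small balls at `w` have at least `κ` times the mass of small balls at `u`. -/
def MassLE {X : Type*} [MetricSpace X] [MeasurableSpace X] (m : Measure X) (κ : ℝ) (u w : X) :
    Prop :=
  ∀ᶠ ε in nhdsWithin (0 : ℝ) (Set.Ioi 0),
    ENNReal.ofReal κ * m (closedBall u ε) ≤ m (closedBall w ε)

section MassLE

variable {X : Type*} [MetricSpace X] [MeasurableSpace X] {m : Measure X} {κ κ' : ℝ} {u v w : X}

theorem MassLE.refl (h : κ ≤ 1) (u : X) : MassLE m κ u u :=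
  Eventually.of_forall fun _ => mul_le_of_le_one_left' (by simpa using h)

theorem MassLE.mono (h : MassLE m κ u v) (hκ : κ' ≤ κ) : MassLE m κ' u v :=
  Eventually.mono h fun _ hε => le_trans (by gcongr) hε

theorem MassLE.trans (h : MassLE m κ u v) (h' : MassLE m κ' v w) (hκ' : 0 ≤ κ') :
    MassLE m (κ' * κ) u w := by
  filter_upwards [h, h'] with ε h1 h2
  rw [ENNReal.ofReal_mul hκ', mul_assoc]
  exact le_trans (by gcongr) h2

end MassLE

theorem eventually_closedBall_subset_of_isOpen {X : Type*} [MetricSpace X] {U : Set X}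
    (hU : IsOpen U) {x : X} (hx : x ∈ U) :
    ∀ᶠ ε in nhdsWithin (0 : ℝ) (Set.Ioi 0), closedBall x ε ⊆ U := by
  obtain ⟨ε, hε, hsub⟩ := Metric.isOpen_iff.1 hU x hx
  filter_upwards [nhdsWithin_le_nhds (Iio_mem_nhds hε)] with ε' hε'
  exact (closedBall_subset_ball hε').trans hsub

namespace ContractionFamily

variable {X : Type*} [MetricSpace X] [MeasurableSpace X] {m : Measure X} {U : Set X}
  {F : X → X → ℝ → X} {κ : ℝ → ℝ}

theorem dist_le {c x y : X} {s t : ℝ} (hF : ContractionFamily m U F κ) (hc : c ∈ U) (hx : x ∈ U)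
    (hy : y ∈ U) (hs : s ∈ Set.Icc (0 : ℝ) 1) (ht : t ∈ Set.Icc (0 : ℝ) 1) :
    dist (F c x s) (F c y t) ≤ s * dist x y + |s - t| * dist c y :=
  (dist_triangle _ (F c y s) _).trans
    (add_le_add (hF.convex c hc x hx y hy s hs) (hF.dist_eq c hc y hy s hs t ht).le)

theorem dist_self_right {c x : X} {t : ℝ} (hF : ContractionFamily m U F κ) (hc : c ∈ U) (hx : x ∈ U)
    (ht : t ∈ Set.Icc (0 : ℝ) 1) : dist (F c x t) x = (1 - t) * dist c x := by
  have := hF.dist_eq c hc x hx t ht 1 (by simp)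
  rwa [hF.apply_one c hc x hx, abs_sub_comm, abs_of_nonneg (sub_nonneg.2 ht.2)] at this

theorem dist_self_left {c x : X} {t : ℝ} (hF : ContractionFamily m U F κ) (hc : c ∈ U) (hx : x ∈ U)
    (ht : t ∈ Set.Icc (0 : ℝ) 1) : dist (F c x t) c = t * dist c x := by
  have := hF.dist_eq c hc x hx t ht 0 (by simp)
  rwa [hF.apply_zero c hc x hx, sub_zero, abs_of_nonneg ht.1] at this

theorem continuousOn_comp {Y : Type*} [TopologicalSpace Y] {P : Set Y} {f : Y → X} {τ : Y → ℝ}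
    {c : X} (hF : ContractionFamily m U F κ) (hc : c ∈ U) (hf : ContinuousOn f P)
    (hτ : ContinuousOn τ P) (hfU : ∀ q ∈ P, f q ∈ U) (hτI : ∀ q ∈ P, τ q ∈ Set.Icc (0 : ℝ) 1) :
    ContinuousOn (fun q => F c (f q) (τ q)) P := by
  intro q hq
  rw [ContinuousWithinAt, tendsto_iff_dist_tendsto_zero]
  have h1 : Tendsto (fun q' => τ q' * dist (f q') (f q) + |τ q' - τ q| * dist c (f q))
      (nhdsWithin q P) (nhds (τ q * dist (f q) (f q) + |τ q - τ q| * dist c (f q))) :=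
    ((hτ q hq).mul ((hf q hq).dist tendsto_const_nhds)).add
      (((hτ q hq).sub tendsto_const_nhds).abs.mul tendsto_const_nhds)
  simp only [dist_self, sub_self, abs_zero, mul_zero, zero_mul, add_zero] at h1
  refine squeeze_zero' (Eventually.of_forall fun _ => dist_nonneg) ?_ h1
  filter_upwards [self_mem_nhdsWithin] with q' hq'
  exact hF.dist_le hc (hfU q' hq') (hfU q hq) (hτI q' hq') (hτI q hq)

theorem coeff_le_one {t : ℝ} (hF : ContractionFamily m U F κ) (ht : t ∈ Set.Ioc (0 : ℝ) 1) :
    κ t ≤ 1 :=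
  (hF.coeff_mono t 1 ht.1 ht.2 le_rfl).trans hF.coeff_one.le

theorem image_closedBall_subset {c u : X} {t ε : ℝ} (hF : ContractionFamily m U F κ) (hc : c ∈ U)
    (hu : u ∈ U) (ht : t ∈ Set.Icc (0 : ℝ) 1) (hsub : closedBall u ε ⊆ U) :
    (fun a => F c a t) '' closedBall u ε ⊆ closedBall (F c u t) ε := by
  rintro _ ⟨a, ha, rfl⟩
  exact (hF.convex c hc a (hsub ha) u hu t ht).trans
    ((mul_le_of_le_one_left dist_nonneg ht.2).trans ha)

theorem massLE [BorelSpace X] {c u : X} {t : ℝ} (hF : ContractionFamily m U F κ) (hc : c ∈ U)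
    (hu : u ∈ U) (ht : t ∈ Set.Ioc (0 : ℝ) 1) : MassLE m (κ t) u (F c u t) := by
  have ht' : t ∈ Set.Icc (0 : ℝ) 1 := ⟨ht.1.le, ht.2⟩
  rcases eq_or_ne u c with rfl | hne
  · have : F u u t = u := by
      rw [← dist_eq_zero, hF.dist_self_right hu hu ht', dist_self, mul_zero]
    rw [this]
    exact MassLE.refl (hF.coeff_le_one ht) u
  · filter_upwards [eventually_closedBall_subset_of_isOpen hF.isOpen hu,
      eventually_closedBall_subset_of_isOpen (isOpen_compl_singleton (x := c)) hne] with ε h1 h2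
    exact (hF.measure_image c hc _ h1 isClosed_closedBall.measurableSet (fun h => h2 h rfl) t
      ht).trans (measure_mono (hF.image_closedBall_subset hc hu ht' h1))

/-- The points of a set on which a contraction is constant are few, if small balls at each of them
have mass comparable to those at `v` and `v` is comparable to every point. -/
theorem card_le_of_constant [BorelSpace X] [ProperSpace X] [IsLocallyFiniteMeasure m]
    [m.IsOpenPosMeasure] {v : X} {κ₀ κ₁ : ℝ} (hF : ContractionFamily m U F κ)
    (hκ₀ : 0 < κ₀) (hκ₁ : 0 < κ₁) (hv : ∀ y ∈ U, MassLE m κ₀ y v) {c : X} (hc : c ∈ U) {t : ℝ}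
    (ht : t ∈ Set.Ioc (0 : ℝ) 1) : ∃ L : ℕ, ∀ S : Finset X, (∀ u ∈ S, u ∈ U ∧ MassLE m κ₁ v u) →
      (∀ u ∈ S, ∀ u' ∈ S, F c u t = F c u' t) → S.card ≤ L := by
  have ht' : t ∈ Set.Icc (0 : ℝ) 1 := ⟨ht.1.le, ht.2⟩
  obtain ⟨L, hL⟩ := exists_nat_ge (κ t * κ₁ * κ₀)⁻¹
  have hκt := hF.coeff_pos t ht.1
  refine ⟨max 1 L, fun S hS hconst => ?_⟩
  by_cases hcS : c ∈ S
  · refine le_max_of_le_left (Finset.card_le_one.2 ?_)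
    have key : ∀ u ∈ S, u = c := by
      intro u hu
      have h1 := hF.dist_self_left hc (hS u hu).1 ht'
      have h2 := hF.dist_self_left hc hc ht'
      rw [hconst u hu c hcS, h2, dist_self, mul_zero] at h1
      rcases mul_eq_zero.1 h1.symm with h | h
      · exact absurd h ht.1.ne'
      · exact (dist_eq_zero.1 h).symm
    exact fun u hu u' hu' => (key u hu).trans (key u' hu').symm
  rcases S.eq_empty_or_nonempty with rfl | ⟨u₀, hu₀⟩
  · simp
  refine le_max_of_le_right ?_
  set y := F c u₀ t with hy
  have hyU : y ∈ U := hF.mem c hc u₀ (hS u₀ hu₀).1 t ht'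
  obtain ⟨s, hs, hsep⟩ : ∃ s > 0, ∀ w ∈ S, ∀ w' ∈ S, w ≠ w' → s ≤ dist w w' := by
    by_cases hne : S.offDiag.Nonempty
    · obtain ⟨p, hp, hmin⟩ := Finset.exists_min_image S.offDiag (fun p => dist p.1 p.2) hne
      rw [Finset.mem_offDiag] at hp
      exact ⟨dist p.1 p.2, dist_pos.2 hp.2.2, fun w hw w' hw' hww =>
        hmin (w, w') (Finset.mem_offDiag.2 ⟨hw, hw', hww⟩)⟩
    · exact ⟨1, one_pos, fun w hw w' hw' hww =>
        absurd ⟨(w, w'), Finset.mem_offDiag.2 ⟨hw, hw', hww⟩⟩ hne⟩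
  have hs2 : (0 : ℝ) < s / 2 := by linarith
  have hev : ∀ᶠ ε in nhdsWithin (0 : ℝ) (Set.Ioi 0), ∀ u ∈ S,
      ENNReal.ofReal κ₁ * m (closedBall v ε) ≤ m (closedBall u ε) ∧ closedBall u ε ⊆ U ∧
        closedBall u ε ⊆ {c}ᶜ := by
    rw [Finset.eventually_all]
    intro u hu
    exact (hS u hu).2.and ((eventually_closedBall_subset_of_isOpen hF.isOpen (hS u hu).1).and
      (eventually_closedBall_subset_of_isOpen isOpen_compl_singleton fun h => hcS (h ▸ hu)))
  obtain ⟨ε, ⟨h1, h2⟩, hε0, hε⟩ := ((hev.and (hv y hyU)).and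
    (Ioo_mem_nhdsGT hs2)).exists
  have hdisj : (S : Set X).PairwiseDisjoint fun u => closedBall u ε := by
    intro u hu u' hu' hne
    exact closedBall_disjoint_closedBall (by linarith [hsep u hu u' hu' hne])
  have hA : m (⋃ u ∈ S, closedBall u ε) = ∑ u ∈ S, m (closedBall u ε) :=
    measure_biUnion_finset hdisj fun u _ => isClosed_closedBall.measurableSet
  have hAU : (⋃ u ∈ S, closedBall u ε) ⊆ U := Set.iUnion₂_subset fun u hu => (h1 u hu).2.1
  have himg : (fun a => F c a t) '' (⋃ u ∈ S, closedBall u ε) ⊆ closedBall y ε := by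
    rw [Set.image_iUnion₂]
    refine Set.iUnion₂_subset fun u hu => ?_
    rw [hy, hconst u₀ hu₀ u hu]
    exact hF.image_closedBall_subset hc (hS u hu).1 ht' (h1 u hu).2.1
  have hm := hF.measure_image c hc _ hAU
    (S.measurableSet_biUnion fun u _ => isClosed_closedBall.measurableSet) (fun h => by
      obtain ⟨u, hu, hcu⟩ := Set.mem_iUnion₂.1 h
      exact (h1 u hu).2.2 hcu rfl) t ht
  rw [hA] at hm
  have hfin : m (closedBall y ε) ≠ ∞ := measure_closedBall_lt_top.ne
  have hpos : m (closedBall y ε) ≠ 0 := (measure_closedBall_pos m y hε0).ne'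
  have hfinv : m (closedBall v ε) ≠ ∞ := measure_closedBall_lt_top.ne
  have hchain : ENNReal.ofReal (κ t) * (S.card * (ENNReal.ofReal κ₁ *
      (ENNReal.ofReal κ₀ * m (closedBall y ε)))) ≤ m (closedBall y ε) := by
    calc _ ≤ ENNReal.ofReal (κ t) * ∑ u ∈ S, m (closedBall u ε) := by
          gcongr
          rw [← nsmul_eq_mul, ← Finset.sum_const]
          exact Finset.sum_le_sum fun u hu => le_trans (by gcongr) (h1 u hu).1
      _ ≤ _ := hm
      _ ≤ _ := measure_mono himg
  have h3 : ENNReal.ofReal (κ t * κ₁ * κ₀ * S.card) ≤ 1 := by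
    rw [ENNReal.ofReal_mul (by positivity), ENNReal.ofReal_mul (by positivity),
      ENNReal.ofReal_mul hκt.le, ENNReal.ofReal_natCast]
    refine (ENNReal.mul_le_mul_iff_left hpos hfin).1 ?_
    rw [one_mul]
    refine le_trans (le_of_eq ?_) hchain
    ring
  rw [ENNReal.ofReal_le_one, ← le_div_iff₀' (by positivity), one_div] at h3
  exact_mod_cast h3.trans hL

end ContractionFamily

namespace ContractionFamily

variable {X : Type*} [MetricSpace X] [MeasurableSpace X] {m : Measure X} {U : Set X}
  {F : X → X → ℝ → X} {κ : ℝ → ℝ}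

/-- Contract `y` successively towards the points of a list, the amount of each contraction being
determined by the distance of its center from a target `w`. -/
def steer (F : X → X → ℝ → X) (τ : ℝ → ℝ) (y w : X) : List X → X
  | [] => y
  | z :: l => F z (steer F τ y w l) (τ (dist w z))

theorem steer_mem {τ : ℝ → ℝ} (hF : ContractionFamily m U F κ)
    (hτ : ∀ d, τ d ∈ Set.Icc (0 : ℝ) 1) {y : X} (hy : y ∈ U) (w : X) (l : List X)
    (hl : ∀ z ∈ l, z ∈ U) : steer F τ y w l ∈ U := by
  induction l with
  | nil => exact hy
  | cons z l ih =>
    exact hF.mem z (hl z (by simp)) _ (ih fun z' hz' => hl z' (by simp [hz'])) _ (hτ _)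

theorem continuousOn_steer {Y : Type*} [TopologicalSpace Y] {P : Set Y} {f : Y → X} {τ : ℝ → ℝ}
    (hF : ContractionFamily m U F κ) (hτ : ∀ d, τ d ∈ Set.Icc (0 : ℝ) 1) (hτc : Continuous τ)
    (hf : ContinuousOn f P) {y : X} (hy : y ∈ U) (l : List X) (hl : ∀ z ∈ l, z ∈ U) :
    ContinuousOn (fun q => steer F τ y (f q) l) P := by
  induction l with
  | nil => exact continuousOn_const
  | cons z l ih =>
    have hl' : ∀ z ∈ l, z ∈ U := fun z' hz' => hl z' (by simp [hz'])
    exact hF.continuousOn_comp (hl z (by simp)) (ih hl')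
      ((hτc.comp (continuous_id.dist continuous_const)).comp_continuousOn hf)
      (fun q _ => hF.steer_mem hτ hy _ l hl') fun q _ => hτ _

theorem massLE_steer [BorelSpace X] {τ : ℝ → ℝ} {τ₀ : ℝ} (hF : ContractionFamily m U F κ)
    (hτ₀ : 0 < τ₀) (hτ : ∀ d, τ d ∈ Set.Icc τ₀ 1) {y : X} (hy : y ∈ U) (w : X) (l : List X)
    (hl : ∀ z ∈ l, z ∈ U) : MassLE m (κ τ₀ ^ l.length) y (steer F τ y w l) := by
  induction l with
  | nil => exact MassLE.refl (by simp) y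
  | cons z l ih =>
    have hl' : ∀ z ∈ l, z ∈ U := fun z' hz' => hl z' (by simp [hz'])
    have hτ' : ∀ d, τ d ∈ Set.Icc (0 : ℝ) 1 := fun d => ⟨hτ₀.le.trans (hτ d).1, (hτ d).2⟩
    rw [List.length_cons, pow_succ']
    exact (ih hl').trans ((hF.massLE (hl z (by simp)) (hF.steer_mem hτ' hy w l hl')
      ⟨hτ₀.trans_le (hτ _).1, (hτ _).2⟩).mono (hF.coeff_mono _ _ hτ₀ (hτ _).1 (hτ _).2))
      (hF.coeff_pos _ hτ₀).le

theorem dist_steer_le {τ : ℝ → ℝ} {D ε : ℝ} (hF : ContractionFamily m U F κ)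
    (hD : ∀ x ∈ U, ∀ y ∈ U, dist x y ≤ D) (hτ : ∀ d, τ d ∈ Set.Icc (0 : ℝ) 1)
    (hτ₁ : ∀ d, ε ≤ d → τ d = 1) (hτ₂ : ∀ d, d ≤ ε / 2 → τ d * D ≤ ε) (hε : 0 < ε) {y w : X}
    (hy : y ∈ U) (hw : w ∈ U) (l : List X) (hl : ∀ z ∈ l, z ∈ U) (hwl : ∃ z ∈ l, dist w z ≤ ε / 2) :
    dist (steer F τ y w l) w ≤ 2 * ε := by
  induction l with
  | nil => simp at hwl
  | cons z l ih =>
    have hl' : ∀ z ∈ l, z ∈ U := fun z' hz' => hl z' (by simp [hz'])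
    have hz := hl z (by simp)
    have hE := hF.steer_mem hτ hy w l hl'
    set u := steer F τ y w l with hu
    have hstep : dist (F z u (τ (dist w z))) w ≤
        τ (dist w z) * dist u w + (1 - τ (dist w z)) * dist w z := by
      refine (dist_triangle _ (F z w (τ (dist w z))) _).trans (add_le_add
        (hF.convex z hz u hE w hw _ (hτ _)) ?_)
      rw [hF.dist_self_right hz hw (hτ _), dist_comm z w]
    refine hstep.trans ?_
    obtain ⟨h0, h1⟩ := hτ (dist w z)
    have hwz := dist_nonneg (x := w) (y := z)
    by_cases hc : dist w z ≤ ε / 2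
    · have h2 := hτ₂ _ hc
      have h3 := mul_le_mul_of_nonneg_left (hD u hE w hw) h0
      nlinarith
    · have h2 : dist u w ≤ 2 * ε := by
        refine ih hl' ?_
        obtain ⟨z', hz', h⟩ := hwl
        rcases List.mem_cons.1 hz' with rfl | hz'
        · exact absurd h hc
        · exact ⟨z', hz', h⟩
      by_cases hc' : ε ≤ dist w z
      · rw [hτ₁ _ hc']
        linarith
      · have h3 := mul_le_mul_of_nonneg_left h2 h0
        have h4 := mul_le_mul_of_nonneg_left (not_le.1 hc').le (sub_nonneg.2 h1)
        nlinarith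

end ContractionFamily

theorem Topology.IsOpenEmbedding.exists_continuousOn_leftInverse {V X : Type*} [TopologicalSpace V]
    [Nonempty V] [TopologicalSpace X] {ψ : V → X} (hψ : IsOpenEmbedding ψ) :
    ∃ θ : X → V, (∀ q, θ (ψ q) = q) ∧ ContinuousOn θ (Set.range ψ) := by
  refine ⟨(hψ.toOpenPartialHomeomorph ψ).symm, fun q => ?_, ?_⟩
  · exact (hψ.toOpenPartialHomeomorph ψ).left_inv (by simp)
  · simpa using (hψ.toOpenPartialHomeomorph ψ).continuousOn_symm

/-- Near a point of a chart, small balls have mass comparable to those at every other point. -/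
theorem ContractionFamily.exists_massLE_chart {X : Type*} [MetricSpace X] [MeasurableSpace X]
    [BorelSpace X] {m : Measure X} {U : Set X} {F : X → X → ℝ → X} {κ : ℝ → ℝ}
    (hF : ContractionFamily m U F κ) (hU : Bornology.IsBounded U) {k : ℕ} {ψ : (Fin k → ℝ) → X}
    (hψ : Topology.IsOpenEmbedding ψ) {q₀ : Fin k → ℝ} (hq₀ : ψ q₀ ∈ U) :
    ∃ κ₀ > 0, ∃ R > 0, ψ '' closedBall q₀ R ⊆ U ∧
      ∀ y ∈ U, ∀ q ∈ closedBall q₀ R, MassLE m κ₀ y (ψ q) := by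
  obtain ⟨θ, hθψ, hθ⟩ := hψ.exists_continuousOn_leftInverse
  obtain ⟨a, ha0, ha1, hA⟩ := exists_near_id_surjective k
  obtain ⟨D, hD⟩ := Metric.isBounded_iff.1 hU
  obtain ⟨R, hR, hRU⟩ : ∃ R > 0, closedBall q₀ R ⊆ ψ ⁻¹' U :=
    Metric.nhds_basis_closedBall.mem_iff.1
      ((hF.isOpen.preimage hψ.continuous).mem_nhds hq₀)
  have hcomp : IsCompact (ψ '' closedBall q₀ R) :=
    (isCompact_closedBall q₀ R).image hψ.continuous
  have hsub : ψ '' closedBall q₀ R ⊆ U := Set.image_subset_iff.2 hRU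
  obtain ⟨δ₁, hδ₁, hδ₁'⟩ := hcomp.exists_cthickening_subset_open hψ.isOpen_range
    (Set.image_subset_range ψ _)
  have haR : 0 < a * R := by positivity
  have hunif := hcomp.uniformContinuousAt_of_continuousAt θ (fun x hx =>
    hθ.continuousAt (hψ.isOpen_range.mem_nhds (Set.image_subset_range ψ _ hx)))
    (Metric.dist_mem_uniformity haR)
  obtain ⟨δ₂, hδ₂, hδ₂'⟩ := Metric.mem_uniformity_dist.1 hunif
  set ε := min δ₁ δ₂ / 4 with hεdef
  have hmin : 0 < min δ₁ δ₂ := lt_min hδ₁ hδ₂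
  have hε : 0 < ε := by positivity
  have hnear : ∀ q ∈ closedBall q₀ R, ∀ x, dist x (ψ q) ≤ 2 * ε →
      x ∈ Set.range ψ ∧ dist (θ x) q ≤ a * R := by
    intro q hq x hx
    refine ⟨hδ₁' (mem_cthickening_of_dist_le x (ψ q) _ _ (Set.mem_image_of_mem ψ hq) ?_), ?_⟩
    · linarith [min_le_left δ₁ δ₂]
    · have := hδ₂' (a := ψ q) (b := x) (by rw [dist_comm]; linarith [min_le_right δ₁ δ₂])
        (Set.mem_image_of_mem ψ hq)
      simp only [Set.mem_ofPred_eq, hθψ] at this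
      rw [dist_comm]
      exact this.le
  obtain ⟨S, hSsub, hScov⟩ := hcomp.elim_nhds_subcover (fun x => ball x (ε / 2))
    fun x _ => ball_mem_nhds x (by positivity)
  have hSU : ∀ z ∈ S.toList, z ∈ U := fun z hz => hsub (hSsub z (Finset.mem_toList.1 hz))
  set τ₀ := min (1 / 2) (ε / (|D| + 1)) with hτ₀def
  have hτ₀ : 0 < τ₀ := by positivity
  have hτ₀1 : τ₀ ≤ 1 := (min_le_left _ _).trans (by norm_num)
  set τ : ℝ → ℝ := fun d => max τ₀ (min 1 (2 * d / ε - 1)) with hτdef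
  have hτ : ∀ d, τ d ∈ Set.Icc τ₀ 1 := fun d =>
    ⟨le_max_left _ _, max_le hτ₀1 (min_le_left _ _)⟩
  have hτ' : ∀ d, τ d ∈ Set.Icc (0 : ℝ) 1 := fun d => ⟨hτ₀.le.trans (hτ d).1, (hτ d).2⟩
  have hτc : Continuous τ := by fun_prop
  have hτ₁ : ∀ d, ε ≤ d → τ d = 1 := by
    intro d hd
    have : 1 ≤ d / ε := (one_le_div hε).2 hd
    simp only [hτdef]
    rw [min_eq_left (by rw [mul_div_assoc]; linarith), max_eq_right hτ₀1]
  have hτ₂ : ∀ d, d ≤ ε / 2 → τ d * D ≤ ε := by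
    intro d hd
    have h1 : d / ε ≤ 1 / 2 := by
      rw [div_le_iff₀ hε]
      linarith
    have h2 : τ d = τ₀ := by
      simp only [hτdef]
      refine max_eq_left ((min_le_right _ _).trans ?_)
      rw [mul_div_assoc]
      linarith
    rw [h2]
    calc τ₀ * D ≤ ε / (|D| + 1) * (|D| + 1) :=
          mul_le_mul_of_nonneg (min_le_right _ _) ((le_abs_self D).trans (by linarith)) hτ₀.le
            (by positivity)
      _ = ε := div_mul_cancel₀ _ (by positivity)
  refine ⟨κ τ₀ ^ S.toList.length, pow_pos (hF.coeff_pos _ hτ₀) _, a * R, haR, ?_, ?_⟩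
  · exact (Set.image_mono (closedBall_subset_closedBall (mul_le_of_le_one_left hR.le ha1.le))).trans
      hsub
  intro y hy q hq
  have hdist : ∀ q ∈ closedBall q₀ R,
      dist (ContractionFamily.steer F τ y (ψ q) S.toList) (ψ q) ≤ 2 * ε := by
    intro q hq
    refine hF.dist_steer_le (fun x hx y hy => hD hx hy) hτ' hτ₁ hτ₂ hε hy (hRU hq) _ hSU ?_
    obtain ⟨z, hz, hzq⟩ := Set.mem_iUnion₂.1 (hScov (Set.mem_image_of_mem ψ hq))
    exact ⟨z, Finset.mem_toList.2 hz, (mem_ball.1 hzq).le⟩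
  obtain ⟨q', hq', hEq⟩ := hA q₀ R hR
    (fun q => θ (ContractionFamily.steer F τ y (ψ q) S.toList))
    (hθ.comp (hF.continuousOn_steer hτ' hτc hψ.continuous.continuousOn hy _ hSU)
      fun q hq => (hnear q hq _ (hdist q hq)).1)
    (fun q hq => by rw [← dist_eq_norm]; exact (hnear q hq _ (hdist q hq)).2) q hq
  obtain ⟨q'', hq''⟩ := (hnear q' hq' _ (hdist q' hq')).1
  have : ψ q = ContractionFamily.steer F τ y (ψ q') S.toList := by
    rw [← hEq, ← hq'', hθψ]
  rw [this]
  exact hF.massLE_steer hτ₀ hτ hy _ _ hSU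

theorem StablyAttained.mono {V : Type*} [PseudoMetricSpace V] {P W W' : Set V} {g : V → V} {y : V}
    (h : StablyAttained P W g y) (hWW' : P ∩ W ⊆ W') : StablyAttained P W' g y := by
  obtain ⟨ε, hε, h⟩ := h
  refine ⟨ε, hε, fun g' hg' hd => ?_⟩
  obtain ⟨x, hx, hxW, hxy⟩ := h g' hg' hd
  exact ⟨x, hx, hWW' ⟨hx, hxW⟩, hxy⟩

theorem StablyAttained.exists_eq {V : Type*} [PseudoMetricSpace V] {P W : Set V} {g : V → V} {y : V}
    (h : StablyAttained P W g y) (hg : ContinuousOn g P) : ∃ x ∈ P, x ∈ W ∧ g x = y := by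
  obtain ⟨ε, hε, h⟩ := h
  exact h g hg fun x _ => by rwa [dist_self]

theorem StablyAttained.eventually {V : Type*} [NormedAddCommGroup V] {P W : Set V} {g : V → V}
    {y : V} (h : StablyAttained P W g y) : ∀ᶠ y' in nhds y, StablyAttained P W g y' := by
  obtain ⟨ε, hε, h⟩ := h
  filter_upwards [ball_mem_nhds y (half_pos hε)] with y' hy'
  refine ⟨ε / 2, half_pos hε, fun g' hg' hd => ?_⟩
  obtain ⟨x, hx, hxW, hxy⟩ := h (fun x => g' x + (y - y')) (hg'.add continuousOn_const)
    fun x hx => by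
      have h1 : dist (g' x + (y - y')) (g' x) = dist y' y := by
        rw [dist_eq_norm, add_sub_cancel_left, dist_comm, dist_eq_norm]
      linarith [dist_triangle (g' x + (y - y')) (g' x) (g x), hd x hx, mem_ball.1 hy']
  exact ⟨x, hx, hxW, by simpa [add_comm, sub_eq_zero, ← sub_add] using eq_sub_of_add_eq hxy⟩

/-- A stable value of a map factoring through a space in which its fiber is finite is stable already
near one point of that fiber. -/
theorem StablyAttained.exists_localization {V X : Type*} [NormedAddCommGroup V] [NormedSpace ℝ V]
    [MetricSpace X] {P : Set V} (hP : IsCompact P) {φ : V → X} (hφ : ContinuousOn φ P) {θ : X → V}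
    (hθ : ContinuousOn θ (φ '' P)) {y : V} (hfin : (φ '' P ∩ θ ⁻¹' {y}).Finite) {W : Set X}
    (h : StablyAttained P (φ ⁻¹' W) (θ ∘ φ) y) :
    ∃ w ∈ φ '' P, w ∈ W ∧ θ w = y ∧
      ∀ δ > 0, StablyAttained P (φ ⁻¹' (W ∩ ball w δ)) (θ ∘ φ) y := by
  have hg : ContinuousOn (θ ∘ φ) P := hθ.comp hφ (Set.mapsTo_image φ P)
  set T := hfin.toFinset with hT
  have hmemT : ∀ w, w ∈ T ↔ w ∈ φ '' P ∧ θ w = y := fun w => by simp [hT]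
  obtain ⟨s₀, hs₀, hsep⟩ : ∃ s > 0, ∀ w ∈ T, ∀ w' ∈ T, w ≠ w' → s ≤ dist w w' := by
    by_cases hne : T.offDiag.Nonempty
    · obtain ⟨p, hp, hmin⟩ := Finset.exists_min_image T.offDiag (fun p => dist p.1 p.2) hne
      rw [Finset.mem_offDiag] at hp
      exact ⟨dist p.1 p.2, dist_pos.2 hp.2.2, fun w hw w' hw' hww =>
        hmin (w, w') (Finset.mem_offDiag.2 ⟨hw, hw', hww⟩)⟩
    · exact ⟨1, one_pos, fun w hw w' hw' hww =>
        absurd ⟨(w, w'), Finset.mem_offDiag.2 ⟨hw, hw', hww⟩⟩ hne⟩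
  suffices hmain : ∃ w ∈ T, ∀ δ > 0, StablyAttained P (φ ⁻¹' (W ∩ ball w δ)) (θ ∘ φ) y by
    obtain ⟨w, hw, hst⟩ := hmain
    refine ⟨w, ((hmemT w).1 hw).1, ?_, ((hmemT w).1 hw).2, hst⟩
    obtain ⟨x, hx, hxW, hxy⟩ := (hst s₀ hs₀).exists_eq hg
    by_cases hxw : φ x = w
    · exact hxw ▸ hxW.1
    · exact absurd (mem_ball.1 hxW.2) (not_lt.2
        (hsep (φ x) ((hmemT _).2 ⟨Set.mem_image_of_mem φ hx, hxy⟩) w hw hxw))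
  by_contra! hcon
  have hsmall : ∃ s > 0, s ≤ s₀ / 2 ∧
      ∀ w ∈ T, ¬ StablyAttained P (φ ⁻¹' (W ∩ ball w s)) (θ ∘ φ) y := by
    choose! δ hδ hδ' using hcon
    have hev : ∀ᶠ s in nhdsWithin (0 : ℝ) (Set.Ioi 0), ∀ w ∈ T, s < δ w := by
      rw [Finset.eventually_all]
      exact fun w hw => nhdsWithin_le_nhds (Iio_mem_nhds (hδ w hw))
    obtain ⟨s, hs, hs0, hs1⟩ := (hev.and (Ioo_mem_nhdsGT (half_pos hs₀))).exists
    exact ⟨s, hs0, hs1.le, fun w hw hst => hδ' w hw (hst.mono fun x hx =>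
      ⟨hx.2.1, ball_subset_ball (hs w hw).le hx.2.2⟩)⟩
  obtain ⟨s, hs, hs₀s, hun⟩ := hsmall
  obtain ⟨ε, hε, hst⟩ := h
  obtain ⟨η, hη, haway⟩ : ∃ η > 0, ∀ x ∈ P, dist (θ (φ x)) y < η →
      ∃ w ∈ T, dist (φ x) w ≤ s / 2 := by
    set C := P ∩ φ ⁻¹' (⋂ w ∈ T, (ball w (s / 2))ᶜ) with hC
    have hCcomp : IsCompact C := by
      obtain ⟨D, hD, hDeq⟩ := continuousOn_iff_isClosed.1 hφ _
        (isClosed_biInter fun w (_ : w ∈ T) => (isOpen_ball (x := w) (ε := s / 2)).isClosed_compl)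
      have : C = P ∩ D := by rw [hC, Set.inter_comm P D, ← hDeq, Set.inter_comm]; simp
      rw [this]
      exact hP.inter_right hD
    rcases C.eq_empty_or_nonempty with hempty | hne
    · refine ⟨1, one_pos, fun x hx _ => ?_⟩
      by_contra! hfar
      have : x ∈ C := ⟨hx, by simpa using fun w hw => (hfar w hw).le⟩
      rw [hempty] at this
      exact this
    · obtain ⟨x₀, hx₀, hmin⟩ := hCcomp.exists_isMinOn hne
        ((continuous_id.dist continuous_const).comp_continuousOn (hg.mono Set.inter_subset_left) :
          ContinuousOn (fun x => dist ((θ ∘ φ) x) y) C)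
      refine ⟨dist (θ (φ x₀)) y, dist_pos.2 fun heq => ?_, fun x hx hlt => ?_⟩
      · have h1 := Set.mem_iInter₂.1 hx₀.2 (φ x₀)
          ((hmemT _).2 ⟨Set.mem_image_of_mem φ hx₀.1, heq⟩)
        exact h1 (mem_ball_self (by positivity))
      · by_contra! hfar
        have : x ∈ C := ⟨hx, by simpa using fun w hw => (hfar w hw).le⟩
        exact absurd hlt (not_lt.2 (isMinOn_iff.1 hmin x this))
  set ε' := min ε η with hε'
  have hε'0 : 0 < ε' := lt_min hε hη
  have hG : ∀ w ∈ T, ∃ G : V → V, ContinuousOn G P ∧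
      (∀ x ∈ P, dist (G x) ((θ ∘ φ) x) < ε') ∧ ∀ x ∈ P, φ x ∈ W ∩ ball w s → G x ≠ y := by
    intro w hw
    have := hun w hw
    simp only [StablyAttained, not_exists, not_and, not_forall, exists_prop] at this
    obtain ⟨G, hG1, hG2, hG3⟩ := this ε' hε'0
    exact ⟨G, hG1, hG2, hG3⟩
  choose! G hG1 hG2 hG3 using hG
  obtain ⟨Hm, hH1, hH2, hH3⟩ := exists_glued_perturbation T hg hε'0
    (fun w x => tentCutoff w s (φ x)) (fun w _ => continuous_tentCutoff.comp_continuousOn hφ)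
    (fun _ _ => tentCutoff_nonneg) (fun _ _ => tentCutoff_le_one)
    (fun x _ w hw w' hw' h1 h2 => by
      by_contra hne
      have h3 := dist_lt_of_tentCutoff_ne_zero hs h1
      have h4 := dist_lt_of_tentCutoff_ne_zero hs h2
      linarith [hsep w hw w' hw' hne, dist_triangle_left w w' (φ x)]) G hG1 hG2
  obtain ⟨x, hx, hxW, hxy⟩ := hst Hm hH1 fun x hx => (hH2 x hx).trans_le (min_le_left _ _)
  obtain ⟨w, hw, hxw⟩ := haway x hx (by
    have := (hH2 x hx).trans_le (min_le_right ε η)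
    rwa [hxy, dist_comm] at this)
  refine hG3 w hw x hx ⟨hxW, mem_ball.2 (by linarith)⟩ ?_
  rw [← hH3 x hx w hw (tentCutoff_eq_one hs hxw), hxy]

/-- If only boundedly many disjoint open sets can have a property `Q · y`, then some open set with
this property is indecomposable with respect to it, locally uniformly in `y`. -/
theorem exists_indecomposable {X Y : Type*} [TopologicalSpace X] [TopologicalSpace Y]
    {Q : Set X → Y → Prop} {good : Y → X → Prop} (hgood : ∀ W y, Q W y → ∃ w ∈ W, good y w) {L : ℕ}
    (hL : ∀ y, ∀ S : Finset X, (∀ w ∈ S, good y w) → S.card ≤ L)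
    (hev : ∀ W y, Q W y → ∀ᶠ y' in nhds y, Q W y') {W : Set X} {y : Y} (hW : IsOpen W)
    (hQ : Q W y) :
    ∃ W y, IsOpen W ∧ Q W y ∧ ∀ᶠ y' in nhds y, ∀ A A', IsOpen A → IsOpen A' → Disjoint A A' →
      Q (W ∩ A) y' → ¬ Q (W ∩ A') y' := by
  classical
  set C : ℕ → Prop := fun n => ∃ y, ∃ l : List (Set X), l.length = n ∧ l.Pairwise Disjoint ∧
    ∀ W ∈ l, IsOpen W ∧ Q W y with hC
  have hbound : ∀ y, ∀ l : List (Set X), l.Pairwise Disjoint → (∀ W ∈ l, Q W y) →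
      ∃ S : Finset X, S.card = l.length ∧ ∀ w ∈ S, good y w ∧ ∃ W ∈ l, w ∈ W := by
    intro y l
    induction l with
    | nil => exact fun _ _ => ⟨∅, by simp⟩
    | cons W l ih =>
      intro hl hQ
      obtain ⟨hl1, hl2⟩ := List.pairwise_cons.1 hl
      obtain ⟨S, hS, hS'⟩ := ih hl2 fun W' hW' => hQ W' (List.mem_cons_of_mem _ hW')
      obtain ⟨w, hwW, hw⟩ := hgood W y (hQ W List.mem_cons_self)
      have hwS : w ∉ S := fun hwS => by
        obtain ⟨-, W', hW', hwW'⟩ := hS' w hwS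
        exact Set.disjoint_left.1 (hl1 W' hW') hwW hwW'
      refine ⟨insert w S, by rw [Finset.card_insert_of_notMem hwS, hS, List.length_cons], ?_⟩
      intro w' hw'
      rcases Finset.mem_insert.1 hw' with rfl | hw'
      · exact ⟨hw, W, List.mem_cons_self, hwW⟩
      · obtain ⟨h1, W', hW', h2⟩ := hS' w' hw'
        exact ⟨h1, W', List.mem_cons_of_mem _ hW', h2⟩
  by_contra! hcon
  have hstep : ∀ n, C (n + 1) := by
    intro n
    induction n with
    | zero => exact ⟨y, [W], by simp [hW, hQ]⟩
    | succ n ih =>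
      obtain ⟨y, l, hl, hdisj, hlQ⟩ := ih
      obtain ⟨W, l, rfl⟩ := List.exists_cons_of_length_eq_add_one hl
      have hWQ := hlQ W List.mem_cons_self
      have hev' : ∀ᶠ y' in nhds y, ∀ W' ∈ l, Q W' y' := by
        have := (l.toFinset.eventually_all (l := nhds y) (p := fun W' y' => Q W' y')).2
          fun W' hW' => hev W' y (hlQ W' (List.mem_cons_of_mem _ (List.mem_toFinset.1 hW'))).2
        simpa using this
      obtain ⟨y', ⟨A, A', hA, hA', hAA', h1, h2⟩, h3⟩ :=
        ((hcon W y hWQ.1 hWQ.2).and_eventually hev').exists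
      obtain ⟨hd1, hd2⟩ := List.pairwise_cons.1 hdisj
      refine ⟨y', (W ∩ A) :: (W ∩ A') :: l, by simpa using hl, ?_, ?_⟩
      · refine List.pairwise_cons.2 ⟨fun W' hW' => ?_, List.pairwise_cons.2 ⟨fun W' hW' => ?_, hd2⟩⟩
        · rcases List.mem_cons.1 hW' with rfl | hW'
          · exact hAA'.mono Set.inter_subset_right Set.inter_subset_right
          · exact (hd1 W' hW').mono_left Set.inter_subset_left
        · exact (hd1 W' hW').mono_left Set.inter_subset_left
      · intro W' hW'
        rcases List.mem_cons.1 hW' with rfl | hW'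
        · exact ⟨hWQ.1.inter hA, h1⟩
        · rcases List.mem_cons.1 hW' with rfl | hW'
          · exact ⟨hWQ.1.inter hA', h2⟩
          · exact ⟨(hlQ W' (List.mem_cons_of_mem _ hW')).1, h3 W' hW'⟩
  obtain ⟨y, l, hl, hdisj, hlQ⟩ := hstep L
  obtain ⟨S, hS, hS'⟩ := hbound y l hdisj fun W hW => (hlQ W hW).2
  have := hL y S fun w hw => (hS' w hw).1
  omega

theorem OpenPartialHomeomorph.isManifoldPoint {X : Type*} [TopologicalSpace X] {k : ℕ}
    (e : OpenPartialHomeomorph X (Fin k → ℝ)) {x : X} (hx : x ∈ e.source) :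
    IsManifoldPoint k x := by
  obtain ⟨ρ, hρ, hsub⟩ := Metric.isOpen_iff.1 e.open_target (e x) (e.map_source hx)
  set b : OpenPartialHomeomorph (Fin k → ℝ) (Fin k → ℝ) :=
    OpenPartialHomeomorph.univBall (e x) ρ with hb
  set f := b.trans e.symm with hf
  have hsource : f.source = Set.univ := by
    rw [hf, OpenPartialHomeomorph.trans_source, hb, OpenPartialHomeomorph.univBall_source,
      Set.univ_inter, Set.eq_univ_iff_forall]
    intro v
    refine hsub ?_
    have := b.map_source (x := v) (by simp [hb])
    rwa [hb, OpenPartialHomeomorph.univBall_target _ hρ] at this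
  refine ⟨f.target, f.open_target, ?_, ⟨f.toPartialHomeomorph.toHomeomorphSourceTarget.symm.trans
    ((Homeomorph.setCongr hsource).trans (Homeomorph.Set.univ _))⟩⟩
  have h0 : f 0 = x := by
    simp [hf, hb, e.left_inv hx]
  rw [← h0]
  exact f.map_source (by rw [hsource]; trivial)

/-- `y` is a stable value of `θ` along a compact family of points of some `H κ` with `κ > κ'`,
stably attained in `W`. -/
def StableValue {V X : Type*} [PseudoMetricSpace V] [TopologicalSpace X] (H : ℝ → Set X) (θ : X → V)
    (κ' : ℝ) (W : Set X) (y : V) : Prop :=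
  ∃ κ > κ', ∃ P : Set V, IsCompact P ∧ ∃ φ : V → X, ContinuousOn φ P ∧ Set.MapsTo φ P (H κ) ∧
    StablyAttained P (φ ⁻¹' W) (θ ∘ φ) y

theorem Set.Finite.of_card_le {α : Type*} {A : Set α} {L : ℕ}
    (h : ∀ S : Finset α, (∀ x ∈ S, x ∈ A) → S.card ≤ L) : A.Finite := by
  by_contra hinf
  obtain ⟨S, hS, hcard⟩ := Set.Infinite.exists_subset_card_eq hinf (L + 1)
  have := h S hS
  omega

/-- A map with finite fibers and a stable value has a continuous section through which all nearby
stable families factor. -/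
theorem exists_section_of_stableValue {V X : Type*} [NormedAddCommGroup V] [NormedSpace ℝ V]
    [MetricSpace X] {H : ℝ → Set X} (hH : ∀ κ κ', κ' ≤ κ → H κ ⊆ H κ') {θ : X → V} {κ' : ℝ}
    (hθ : ∀ κ > κ', ContinuousOn θ (H κ)) {L : ℕ}
    (hL : ∀ S : Finset X, (∀ w ∈ S, w ∈ H κ') → (∀ w ∈ S, ∀ w' ∈ S, θ w = θ w') → S.card ≤ L)
    {y : V} (hy : StableValue H θ κ' Set.univ y) :
    ∃ W, IsOpen W ∧ ∃ B : Set V, IsOpen B ∧ B.Nonempty ∧ ∃ κ > κ', ∃ ι : V → X, ContinuousOn ι B ∧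
      (∀ y ∈ B, ι y ∈ W ∧ ι y ∈ H κ ∧ θ (ι y) = y) ∧
      ∀ κ₁ > κ', ∀ P : Set V, IsCompact P → ∀ φ : V → X, ContinuousOn φ P →
        Set.MapsTo φ P (H κ₁ ∩ W) → ∀ y, StablyAttained P Set.univ (θ ∘ φ) y →
          ∃ x ∈ P, θ (φ x) = y ∧ (y ∈ B → φ x = ι y) := by
  have hfin : ∀ κ > κ', ∀ y, (H κ ∩ θ ⁻¹' {y}).Finite := fun κ hκ y =>
    Set.Finite.of_card_le (L := L) fun S hS => hL S (fun w hw => hH κ κ' hκ.le (hS w hw).1)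
      fun w hw w' hw' => (hS w hw).2.trans (hS w' hw').2.symm
  have hloc : ∀ κ > κ', ∀ P : Set V, IsCompact P → ∀ φ : V → X, ContinuousOn φ P →
      Set.MapsTo φ P (H κ) → ∀ W y, StablyAttained P (φ ⁻¹' W) (θ ∘ φ) y →
      ∃ w ∈ φ '' P, w ∈ W ∧ θ w = y ∧
        ∀ δ > 0, StablyAttained P (φ ⁻¹' (W ∩ ball w δ)) (θ ∘ φ) y :=
    fun κ hκ P hP φ hφ hφH W y h => h.exists_localization hP hφ ((hθ κ hκ).mono hφH.image_subset)
      ((hfin κ hκ y).subset (Set.inter_subset_inter_left _ hφH.image_subset))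
  obtain ⟨W, y₀, hW, ⟨κ, hκ, P, hP, φ, hφ, hφH, hst⟩, hind⟩ := exists_indecomposable
    (Q := StableValue H θ κ') (good := fun y w => w ∈ H κ' ∧ θ w = y) (L := L)
    (by
      rintro W y ⟨κ, hκ, P, hP, φ, hφ, hφH, hst⟩
      obtain ⟨_, ⟨x, hx, rfl⟩, hwW, hwy, -⟩ := hloc κ hκ P hP φ hφ hφH W y hst
      exact ⟨φ x, hwW, hH κ κ' hκ.le (hφH hx), hwy⟩)
    (fun y S hS => hL S (fun w hw => (hS w hw).1) fun w hw w' hw' =>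
      (hS w hw).2.trans (hS w' hw').2.symm)
    (by
      rintro W y ⟨κ, hκ, P, hP, φ, hφ, hφH, hst⟩
      filter_upwards [hst.eventually] with y' hy'
      exact ⟨κ, hκ, P, hP, φ, hφ, hφH, hy'⟩) isOpen_univ hy
  obtain ⟨B, hBsub, hB, hy₀B⟩ := _root_.eventually_nhds_iff.1 (hst.eventually.and hind)
  have : Nonempty X := ⟨φ 0⟩
  choose! ι hιP hιW hιθ hιst using fun y (hy : y ∈ B) =>
    hloc κ hκ P hP φ hφ hφH W y (hBsub y hy).1
  have huniq : ∀ y ∈ B, ∀ w, (∀ δ > 0, StableValue H θ κ' (W ∩ ball w δ) y) → w = ι y := by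
    intro y hy w hw
    by_contra hne
    have hpos : 0 < dist w (ι y) / 2 := half_pos (dist_pos.2 hne)
    refine (hBsub y hy).2 (ball w (dist w (ι y) / 2)) (ball (ι y) (dist w (ι y) / 2)) isOpen_ball
      isOpen_ball (ball_disjoint_ball (by linarith)) (hw _ hpos) ?_
    exact ⟨κ, hκ, P, hP, φ, hφ, hφH, hιst y hy _ hpos⟩
  refine ⟨W, hW, B, hB, ⟨y₀, hy₀B⟩, κ, hκ, ι, fun y hy => ?_,
    fun y hy => ⟨hιW y hy, ?_, hιθ y hy⟩, ?_⟩
  · refine ContinuousAt.continuousWithinAt (Metric.tendsto_nhds.2 fun δ hδ => ?_)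
    filter_upwards [(hιst y hy δ hδ).eventually, hB.mem_nhds hy] with y' hy' hy'B
    obtain ⟨w, -, hwW, -, hwst⟩ := hloc κ hκ P hP φ hφ hφH _ y' hy'
    rw [← huniq y' hy'B w fun δ' hδ' => ⟨κ, hκ, P, hP, φ, hφ, hφH, (hwst δ' hδ').mono
      fun x hx => ⟨hx.2.1.1, hx.2.2⟩⟩]
    exact hwW.2
  · obtain ⟨x, hx, hxy⟩ := hιP y hy
    exact hxy ▸ hφH hx
  · intro κ₁ hκ₁ P₁ hP₁ φ₁ hφ₁ hφH₁ y hst₁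
    have hφH₁' : Set.MapsTo φ₁ P₁ (H κ₁) := fun x hx => (hφH₁ hx).1
    obtain ⟨_, ⟨x, hx, rfl⟩, -, hwy, hwst⟩ := hloc κ₁ hκ₁ P₁ hP₁ φ₁ hφ₁ hφH₁' W y
      (hst₁.mono fun x hx => (hφH₁ hx.1).2)
    exact ⟨x, hx, hwy, fun hyB => huniq y hyB _ fun δ hδ =>
      ⟨κ₁, hκ₁, P₁, hP₁, φ₁, hφ₁, hφH₁', hwst δ hδ⟩⟩

namespace ContractionFamily

variable {X : Type*} [MetricSpace X] [MeasurableSpace X] [BorelSpace X] [ProperSpace X]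
  {m : Measure X} [IsLocallyFiniteMeasure m] [m.IsOpenPosMeasure] {U : Set X}
  {F : X → X → ℝ → X} {κ : ℝ → ℝ} {v : X} {κ₀ : ℝ}

/-- Contracting an injective family of comparable points and then applying a map with finite fibers
yields a map with finite fibers. -/
theorem finite_fiber_comp {V Z : Type*} (hF : ContractionFamily m U F κ) (hκ₀ : 0 < κ₀)
    (hv : ∀ y ∈ U, MassLE m κ₀ y v) {θ : X → Z}
    (hθ : ∀ κ₁ > 0, ∀ y, {u | u ∈ U ∧ MassLE m κ₁ v u ∧ θ u = y}.Finite) {c : X} (hc : c ∈ U)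
    {t : ℝ} (ht : t ∈ Set.Ioc (0 : ℝ) 1) {P : Set V} {ι : V → X} (hι : Set.InjOn ι P) {κ₁ : ℝ}
    (hκ₁ : 0 < κ₁) (hιP : ∀ q ∈ P, ι q ∈ U ∧ MassLE m κ₁ v (ι q)) (y : Z) :
    (P ∩ (fun q => θ (F c (ι q) t)) ⁻¹' {y}).Finite := by
  have ht' : t ∈ Set.Icc (0 : ℝ) 1 := ⟨ht.1.le, ht.2⟩
  have hκt := hF.coeff_pos t ht.1
  refine Set.Finite.of_finite_fibers (fun q => F c (ι q) t) ?_ fun x _ => ?_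
  · refine (hθ (κ t * κ₁) (by positivity) y).subset ?_
    rintro _ ⟨q, ⟨hq, hqy⟩, rfl⟩
    exact ⟨hF.mem c hc _ (hιP q hq).1 t ht',
      (hιP q hq).2.trans (hF.massLE hc (hιP q hq).1 ht) hκt.le,
      hqy⟩
  · obtain ⟨L, hL⟩ := hF.card_le_of_constant hκ₀ hκ₁ hv hc ht
    refine Set.Finite.of_finite_image (f := ι) (Set.Finite.of_card_le (L := L) fun S hS => ?_)
      (hι.mono fun q hq => hq.1.1)
    refine hL S (fun u hu => ?_) fun u hu u' hu' => ?_
    · obtain ⟨q, ⟨⟨hq, -⟩, -⟩, rfl⟩ := hS u hu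
      exact hιP q hq
    · obtain ⟨q, ⟨-, hq⟩, rfl⟩ := hS u hu
      obtain ⟨q', ⟨-, hq'⟩, rfl⟩ := hS u' hu'
      exact hq.trans hq'.symm

theorem exists_isManifoldPoint_of_stableValue (hF : ContractionFamily m U F κ) (hκ₀ : 0 < κ₀)
    (hv : ∀ y ∈ U, MassLE m κ₀ y v) {O : Set X} (hO : IsOpen O) (hOU : O ⊆ U) {k : ℕ}
    {θ : X → Fin k → ℝ} (hθ : ContinuousOn θ U)
    (hθL : ∀ κ₁ > 0, ∃ L : ℕ, ∀ S : Finset X, (∀ u ∈ S, u ∈ U ∧ MassLE m κ₁ v u) →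
      (∀ u ∈ S, ∀ u' ∈ S, θ u = θ u') → S.card ≤ L)
    {κ' : ℝ} (hκ' : 0 < κ') {y : Fin k → ℝ}
    (hy : StableValue (fun κ₁ => {w | w ∈ O ∧ MassLE m κ₁ v w}) θ κ' Set.univ y) :
    ∃ w ∈ O, IsManifoldPoint k w := by
  have hθfin : ∀ κ₁ > 0, ∀ y, {u | u ∈ U ∧ MassLE m κ₁ v u ∧ θ u = y}.Finite := by
    intro κ₁ hκ₁ y
    obtain ⟨L, hL⟩ := hθL κ₁ hκ₁
    exact Set.Finite.of_card_le (L := L) fun S hS => hL S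
      (fun u hu => ⟨(hS u hu).1, (hS u hu).2.1⟩) fun u hu u' hu' =>
        (hS u hu).2.2.trans (hS u' hu').2.2.symm
  obtain ⟨L, hL⟩ := hθL κ' hκ'
  obtain ⟨W, hW, B, hB, ⟨y₀, hy₀⟩, κ₂, hκ₂, ι, hι, hιB, hkey⟩ := exists_section_of_stableValue
    (H := fun κ₁ => {w | w ∈ O ∧ MassLE m κ₁ v w}) (fun _ _ h _ hw => ⟨hw.1, hw.2.mono h⟩)
    (fun _ _ => hθ.mono fun _ hw => hOU hw.1)
    (fun S hS => hL S fun w hw => ⟨hOU (hS w hw).1, (hS w hw).2⟩) hy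
  have hιU : ∀ q ∈ B, ι q ∈ U ∧ MassLE m κ₂ v (ι q) := fun q hq =>
    ⟨hOU (hιB q hq).2.1.1, (hιB q hq).2.1.2⟩
  have hιinj : Set.InjOn ι B := fun q hq q' hq' h => by
    rw [← (hιB q hq).2.2, h, (hιB q' hq').2.2]
  have hκ₂0 : 0 < κ₂ := hκ'.trans hκ₂
  obtain ⟨r, hr, hball⟩ : ∃ r > 0, ball (ι y₀) r ⊆ (W ∩ O) ∩ (U ∩ θ ⁻¹' B) :=
    Metric.isOpen_iff.1 ((hW.inter hO).inter (hθ.isOpen_inter_preimage hF.isOpen hB)) _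
      ⟨⟨(hιB y₀ hy₀).1, (hιB y₀ hy₀).2.1.1⟩, (hιU y₀ hy₀).1, by
        rw [Set.mem_preimage, (hιB y₀ hy₀).2.2]; exact hy₀⟩
  set G := ball (ι y₀) r with hG
  obtain ⟨τ, hτκ, hτ0, hτ1⟩ : ∃ τ, κ' < κ τ * κ₂ ∧ 0 < τ ∧ τ < 1 := by
    have h1 : Tendsto (fun τ => κ τ * κ₂) (nhds 1) (nhds (κ 1 * κ₂)) :=
      hF.coeff_continuousAt.tendsto.mul_const κ₂
    rw [hF.coeff_one, one_mul] at h1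
    obtain ⟨τ, h2, h3⟩ := (((h1.eventually_const_lt hκ₂).filter_mono nhdsWithin_le_nhds).and
      (Ioo_mem_nhdsLT zero_lt_one)).exists
    exact ⟨τ, h2, h3⟩
  have hτ : τ ∈ Set.Ioc (0 : ℝ) 1 := ⟨hτ0, hτ1.le⟩
  have hτ' : τ ∈ Set.Icc (0 : ℝ) 1 := ⟨hτ0.le, hτ1.le⟩
  have hflow : ∀ c ∈ U, ∀ y ∈ B, F c (ι y) τ ∈ G → F c (ι y) τ = ι (θ (F c (ι y) τ)) := by
    intro c hc y hy hyG
    have hT : ContinuousOn (fun q => F c (ι q) τ) B :=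
      hF.continuousOn_comp hc hι continuousOn_const (fun q hq => (hιU q hq).1) fun _ _ => hτ'
    have hTG : IsOpen (B ∩ (fun q => F c (ι q) τ) ⁻¹' G) := hT.isOpen_inter_preimage hB isOpen_ball
    have hTy : ContinuousAt (fun q => F c (ι q) τ) y := hT.continuousAt (hB.mem_nhds hy)
    have hθTy : ContinuousAt (fun q => θ (F c (ι q) τ)) y :=
      ContinuousAt.comp (g := θ) (f := fun q => F c (ι q) τ)
        (hθ.continuousAt (hF.isOpen.mem_nhds (hball hyG).2.1)) hTy
    have hιθTy : ContinuousAt (fun q => ι (θ (F c (ι q) τ))) y :=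
      ContinuousAt.comp (g := ι) (hι.continuousAt (hB.mem_nhds (hball hyG).2.2)) hθTy
    refine tendsto_nhds_unique_of_frequently_eq hTy hιθTy
      (Metric.nhds_basis_closedBall.frequently_iff.2 fun ρ hρ => ?_)
    obtain ⟨ρ', hρ', hρsub⟩ := Metric.nhds_basis_closedBall.mem_iff.1 (hTG.mem_nhds ⟨hy, hyG⟩)
    have hsub : closedBall y (min ρ ρ') ⊆ B ∩ (fun q => F c (ι q) τ) ⁻¹' G :=
      (closedBall_subset_closedBall (min_le_right _ _)).trans hρsub
    have hTc : ContinuousOn (fun q => F c (ι q) τ) (closedBall y (min ρ ρ')) :=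
      hT.mono fun q hq => (hsub hq).1
    obtain ⟨y', hy'⟩ := exists_stablyAttained (lt_min hρ hρ')
      (g := θ ∘ fun q => F c (ι q) τ) (hθ.comp hTc fun q hq => (hball (hsub hq).2).2.1)
      (hF.finite_fiber_comp hκ₀ hv hθfin hc hτ (hιinj.mono fun q hq => (hsub hq).1) hκ₂0
        fun q hq => hιU q (hsub hq).1)
    obtain ⟨q, hq, hqy, hqι⟩ := hkey (κ τ * κ₂) hτκ _ (isCompact_closedBall y (min ρ ρ')) _ hTc
      (fun q hq => ⟨⟨(hball (hsub hq).2).1.2, (hιU q (hsub hq).1).2.trans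
        (hF.massLE hc (hιU q (hsub hq).1).1 hτ) (hF.coeff_pos τ hτ0).le⟩, (hball (hsub hq).2).1.1⟩)
      y' hy'
    refine ⟨q, closedBall_subset_closedBall (min_le_left _ _) hq, ?_⟩
    rw [hqy]
    exact hqι (hqy ▸ (hball (hsub hq).2).2.2)
  have hsec : ∀ u ∈ G, ι (θ u) = u := by
    intro u hu
    have huU := (hball hu).2.1
    have hw := (hιU y₀ hy₀).1
    have hpow : ∀ n : ℕ, τ ^ n ∈ Set.Icc (0 : ℝ) 1 := fun n =>
      ⟨by positivity, pow_le_one₀ hτ0.le hτ1.le⟩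
    have hγ : ∀ n : ℕ, F u (ι y₀) (τ ^ n) ∈ G := by
      intro n
      rw [hG, mem_ball, hF.dist_self_right huU hw (hpow n)]
      have h1 : 0 < τ ^ n := by positivity
      exact (mul_le_of_le_one_left dist_nonneg (by linarith)).trans_lt (mem_ball.1 hu)
    have hind : ∀ n : ℕ, F u (ι y₀) (τ ^ n) = ι (θ (F u (ι y₀) (τ ^ n))) := by
      intro n
      induction n with
      | zero => rw [pow_zero, hF.apply_one u huU _ hw, (hιB y₀ hy₀).2.2]
      | succ n ih =>
        have hcomp := hF.comp u huU _ hw τ hτ' _ (hpow n)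
        have hGn := hγ (n + 1)
        rw [pow_succ', ← hcomp] at hGn ⊢
        rw [ih] at hGn ⊢
        exact hflow u huU _ (hball (hγ n)).2.2 hGn
    have hlim : Tendsto (fun n : ℕ => F u (ι y₀) (τ ^ n)) atTop (nhds u) := by
      rw [tendsto_iff_dist_tendsto_zero]
      have h1 := (tendsto_pow_atTop_nhds_zero_of_lt_one hτ0.le hτ1).mul_const (dist u (ι y₀))
      rw [zero_mul] at h1
      exact h1.congr fun n => (hF.dist_self_left huU hw (hpow n)).symm
    have hlim' : Tendsto (fun n : ℕ => ι (θ (F u (ι y₀) (τ ^ n)))) atTop (nhds (ι (θ u))) :=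
      (hι.continuousAt (hB.mem_nhds (hball hu).2.2)).tendsto.comp
        ((hθ.continuousAt (hF.isOpen.mem_nhds huU)).tendsto.comp hlim)
    exact tendsto_nhds_unique (hlim'.congr fun n => (hind n).symm) hlim
  let e : OpenPartialHomeomorph X (Fin k → ℝ) :=
    { toFun := θ
      invFun := ι
      source := G
      target := B ∩ ι ⁻¹' G
      map_source' := fun u hu => ⟨(hball hu).2.2, by rwa [Set.mem_preimage, hsec u hu]⟩
      map_target' := fun y hy => hy.2
      left_inv' := hsec
      right_inv' := fun y hy => (hιB y hy.1).2.2
      open_source := isOpen_ball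
      open_target := hι.isOpen_inter_preimage hB isOpen_ball
      continuousOn_toFun := hθ.mono fun u hu => (hball hu).2.1
      continuousOn_invFun := hι.mono Set.inter_subset_left }
  exact ⟨ι y₀, (hιB y₀ hy₀).2.1.1, e.isManifoldPoint (x := ι y₀) (mem_ball_self hr)⟩

end ContractionFamily

theorem ContractionFamily.exists_mapsTo {X : Type*} [MetricSpace X] [MeasurableSpace X]
    {m : Measure X} {U : Set X} {F : X → X → ℝ → X} {κ : ℝ → ℝ} (hF : ContractionFamily m U F κ)
    (hU : Bornology.IsBounded U) {c : X} (hc : c ∈ U) {O : Set X} (hO : IsOpen O) (hcO : c ∈ O) :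
    ∃ t ∈ Set.Ioc (0 : ℝ) 1, ∀ u ∈ U, F c u t ∈ O := by
  obtain ⟨ρ, hρ, hsub⟩ := Metric.isOpen_iff.1 hO c hcO
  obtain ⟨D, hD⟩ := Metric.isBounded_iff.1 hU
  have hpos : 0 < ρ / (|D| + 1) := by positivity
  refine ⟨min 1 (ρ / (|D| + 1)), ⟨lt_min one_pos hpos, min_le_left _ _⟩, fun u hu => hsub ?_⟩
  rw [mem_ball, hF.dist_self_left hc hu ⟨(lt_min one_pos hpos).le, min_le_left _ _⟩]
  calc min 1 (ρ / (|D| + 1)) * dist c u ≤ ρ / (|D| + 1) * |D| := by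
        gcongr
        · exact min_le_right _ _
        · exact (hD hc hu).trans (le_abs_self D)
    _ < ρ / (|D| + 1) * (|D| + 1) := by
        gcongr
        linarith
    _ = ρ := div_mul_cancel₀ _ (by positivity)

theorem IsManifoldPoint.exists_isOpenEmbedding {X : Type*} [TopologicalSpace X] {k : ℕ} {p : X}
    (hp : IsManifoldPoint k p) :
    ∃ ψ : (Fin k → ℝ) → X, Topology.IsOpenEmbedding ψ ∧ ∃ q, ψ q = p := by
  obtain ⟨C, hC, hpC, ⟨e⟩⟩ := hp
  exact ⟨fun q => (e.symm q : X), hC.isOpenEmbedding_subtypeVal.comp e.symm.isOpenEmbedding,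
    e ⟨p, hpC⟩, by simp⟩

/-- A contraction family around a manifold point has manifold points in every open set. -/
theorem ContractionFamily.exists_isManifoldPoint {X : Type*} [MetricSpace X] [MeasurableSpace X]
    [BorelSpace X] [ProperSpace X] {m : Measure X} [IsLocallyFiniteMeasure m] [m.IsOpenPosMeasure]
    {U : Set X} {F : X → X → ℝ → X} {κ : ℝ → ℝ} (hF : ContractionFamily m U F κ)
    (hU : Bornology.IsBounded U) {k : ℕ} {p : X} (hpU : p ∈ U) (hp : IsManifoldPoint k p)
    {O : Set X} (hO : IsOpen O) (hOU : O ⊆ U) (hne : O.Nonempty) : ∃ w ∈ O, IsManifoldPoint k w := by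
  obtain ⟨ψ, hψ, q₀, rfl⟩ := hp.exists_isOpenEmbedding
  obtain ⟨κ₀, hκ₀, R, hR, hRU, hreach⟩ := hF.exists_massLE_chart hU hψ hpU
  have hv : ∀ y ∈ U, MassLE m κ₀ y (ψ q₀) := fun y hy => hreach y hy q₀ (mem_closedBall_self hR.le)
  obtain ⟨s, hs, hsψ⟩ := hF.exists_mapsTo hU hpU hψ.isOpen_range ⟨q₀, rfl⟩
  obtain ⟨x, hx⟩ := hne
  obtain ⟨t, ht, htO⟩ := hF.exists_mapsTo hU (hOU hx) hO hx
  obtain ⟨θ, hθψ, hθ⟩ := hψ.exists_continuousOn_leftInverse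
  have hs' : s ∈ Set.Icc (0 : ℝ) 1 := ⟨hs.1.le, hs.2⟩
  have ht' : t ∈ Set.Icc (0 : ℝ) 1 := ⟨ht.1.le, ht.2⟩
  have hκt := hF.coeff_pos t ht.1
  have hΘ : ContinuousOn (fun u => θ (F (ψ q₀) u s)) U :=
    hθ.comp (hF.continuousOn_comp hpU continuousOn_id continuousOn_const (fun _ h => h)
      fun _ _ => hs') hsψ
  have hΘL : ∀ κ₁ > 0, ∃ L : ℕ, ∀ S : Finset X, (∀ u ∈ S, u ∈ U ∧ MassLE m κ₁ (ψ q₀) u) →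
      (∀ u ∈ S, ∀ u' ∈ S, θ (F (ψ q₀) u s) = θ (F (ψ q₀) u' s)) → S.card ≤ L := by
    intro κ₁ hκ₁
    obtain ⟨L, hL⟩ := hF.card_le_of_constant hκ₀ hκ₁ hv hpU hs
    refine ⟨L, fun S hS hconst => hL S hS fun u hu u' hu' => ?_⟩
    obtain ⟨q, hq⟩ := hsψ u (hS u hu).1
    obtain ⟨q', hq'⟩ := hsψ u' (hS u' hu').1
    have := hconst u hu u' hu'
    rw [← hq, ← hq', hθψ, hθψ] at this
    rw [← hq, ← hq', this]
  have hφ : ContinuousOn (fun q => F x (ψ q) t) (closedBall q₀ R) :=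
    hF.continuousOn_comp (hOU hx) hψ.continuous.continuousOn continuousOn_const
      (fun q hq => hRU (Set.mem_image_of_mem ψ hq)) fun _ _ => ht'
  have hψR : ∀ q ∈ closedBall q₀ R, ψ q ∈ U ∧ MassLE m κ₀ (ψ q₀) (ψ q) := fun q hq =>
    ⟨hRU (Set.mem_image_of_mem ψ hq), hreach _ hpU q hq⟩
  obtain ⟨y, hy⟩ := exists_stablyAttained hR
    (g := (fun u => θ (F (ψ q₀) u s)) ∘ fun q => F x (ψ q) t)
    (hΘ.comp hφ fun q hq => hOU (htO _ (hψR q hq).1))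
    (hF.finite_fiber_comp hκ₀ hv (fun κ₁ hκ₁ y => by
      obtain ⟨L, hL⟩ := hΘL κ₁ hκ₁
      exact Set.Finite.of_card_le (L := L) fun S hS => hL S
        (fun u hu => ⟨(hS u hu).1, (hS u hu).2.1⟩) fun u hu u' hu' =>
          (hS u hu).2.2.trans (hS u' hu').2.2.symm) (hOU hx) ht hψ.injective.injOn hκ₀ hψR)
  have hpos : 0 < κ t * κ₀ := by positivity
  exact hF.exists_isManifoldPoint_of_stableValue hκ₀ hv hO hOU hΘ hΘL (half_pos hpos)
    ⟨κ t * κ₀, half_lt_self hpos, closedBall q₀ R, isCompact_closedBall q₀ R, _, hφ, fun q hq =>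
      ⟨htO _ (hψR q hq).1, (hψR q hq).2.trans (hF.massLE (hOU hx) (hψR q hq).1 ht) hκt.le⟩, hy⟩

theorem isOpen_setOf_isManifoldPoint {X : Type*} [TopologicalSpace X] (k : ℕ) :
    IsOpen {p : X | IsManifoldPoint k p} :=
  isOpen_iff_forall_mem_open.2 fun _ ⟨U, hU, hpU, e⟩ => ⟨U, fun _ hq => ⟨U, hU, hq, e⟩, hU, hpU⟩

theorem IsManifoldPoint.dimension_le {X : Type*} [TopologicalSpace X] {k k' : ℕ} {p : X}
    (hp : IsManifoldPoint k p) (hp' : IsManifoldPoint k' p) : k' ≤ k := by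
  by_contra! hlt
  obtain ⟨ψ, hψ, q, hq⟩ := hp.exists_isOpenEmbedding
  obtain ⟨ψ', hψ', q', hq'⟩ := hp'.exists_isOpenEmbedding
  obtain ⟨θ, hθψ, hθ⟩ := hψ.exists_continuousOn_leftInverse
  obtain ⟨R, hR, hsub⟩ : ∃ R > 0, closedBall q' R ⊆ ψ' ⁻¹' Set.range ψ :=
    Metric.nhds_basis_closedBall.mem_iff.1
      ((hψ.isOpen_range.preimage hψ'.continuous).mem_nhds ⟨q, by rw [hq, hq']⟩)
  set E : (Fin k → ℝ) → Fin k' → ℝ := fun v j => if h : (j : ℕ) < k then v ⟨j, h⟩ else 0 with hE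
  have hEc : Continuous E := by
    refine continuous_pi fun j => ?_
    by_cases h : (j : ℕ) < k
    · simpa [hE, h] using continuous_apply _
    · simpa [hE, h] using continuous_const
  have hEinj : Function.Injective E := fun v v' h => funext fun i => by
    have := congrFun h ⟨i, i.2.trans hlt⟩
    simpa [hE] using this
  have hE0 : ∀ v, E v ⟨k, hlt⟩ = 0 := fun v => by simp [hE]
  set g : (Fin k' → ℝ) → Fin k' → ℝ := fun x => E (θ (ψ' x)) with hg
  have hgc : ContinuousOn g (closedBall q' R) :=
    hEc.comp_continuousOn (hθ.comp hψ'.continuous.continuousOn hsub)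
  have hginj : Set.InjOn g (closedBall q' R) := by
    intro x hx x' hx' h
    obtain ⟨v, hv⟩ := hsub hx
    obtain ⟨v', hv'⟩ := hsub hx'
    have := hEinj h
    rw [← hv, ← hv', hθψ, hθψ] at this
    exact hψ'.injective (by rw [← hv, ← hv', this])
  obtain ⟨y, hy⟩ := exists_stablyAttained hR hgc fun y => Set.Subsingleton.finite
    fun x hx x' hx' => hginj hx.1 hx'.1 (hx.2.trans hx'.2.symm)
  obtain ⟨x, -, -, hxy⟩ := hy.exists_eq hgc
  obtain ⟨ε, hε, hst⟩ := hy
  obtain ⟨x', -, -, hxy'⟩ := hst (fun x => g x + fun _ => ε / 2) (hgc.add continuousOn_const)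
    fun x _ => by
      rw [dist_eq_norm, add_sub_cancel_left]
      refine (pi_norm_const_le _).trans_lt ?_
      rw [Real.norm_of_nonneg (by positivity)]
      linarith
  have h1 := congrFun hxy ⟨k, hlt⟩
  have h2 := congrFun hxy' ⟨k, hlt⟩
  rw [Pi.add_apply] at h2
  simp only [hg, hE0] at h1 h2
  linarith

theorem IsGeodesicMetricSpace.preconnectedSpace {X : Type*} [MetricSpace X]
    (h : IsGeodesicMetricSpace X) : PreconnectedSpace X := by
  refine ⟨isPreconnected_of_forall_pair fun x _ y _ => ?_⟩
  obtain ⟨g, h0, h1, hg⟩ := h x y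
  refine ⟨g '' Set.Icc 0 (dist x y), Set.subset_univ _, ⟨0, by simp, h0⟩, ⟨dist x y, by simp, h1⟩,
    isPreconnected_Icc.image g ?_⟩
  refine (LipschitzOnWith.of_dist_le_mul (K := 1) fun s hs t ht => ?_).continuousOn
  rw [hg s hs t ht, NNReal.coe_one, one_mul, Real.dist_eq]

theorem dense_setOf_isManifoldPoint {X : Type*} [MetricSpace X] [ProperSpace X] [MeasurableSpace X]
    [BorelSpace X] (hgeo : IsGeodesicMetricSpace X) {m : Measure X} {K N : ℝ} (hK : K ≤ 0)
    (hN : 1 ≤ N) (h : LocalBusemannMCP X m K N) {k : ℕ} (hk : ∃ p : X, IsManifoldPoint k p) :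
    Dense {p : X | IsManifoldPoint k p} := by
  have := hgeo.preconnectedSpace
  have := h.1
  have := h.2.1
  obtain ⟨p, hp⟩ := hk
  rw [dense_iff_closure_eq]
  refine IsClopen.eq_univ ⟨isClosed_closure, isOpen_iff_mem_nhds.2 fun z hz => ?_⟩
    ⟨p, subset_closure hp⟩
  obtain ⟨r, hr, F, κ, hF⟩ := exists_contractionFamily hK hN h z
  obtain ⟨p', hp'U, hp'⟩ := mem_closure_iff.1 hz _ isOpen_ball (mem_ball_self hr)
  refine mem_of_superset (ball_mem_nhds z hr) fun x hx => mem_closure_iff.2 fun O hO hxO => ?_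
  obtain ⟨w, hw, hwk⟩ := hF.exists_isManifoldPoint isBounded_ball hp'U hp' (hO.inter isOpen_ball)
    Set.inter_subset_right ⟨x, hxO, hx⟩
  exact ⟨w, hw.1, hwk⟩

theorem busemann_mcp_manifold_dimension_unique_and_dense
    (X : Type*) [MetricSpace X] [Nonempty X] [CompleteSpace X] [ProperSpace X]
    [MeasurableSpace X] [BorelSpace X]
    (hgeo : IsGeodesicMetricSpace X)
    (m : Measure X) (K N : ℝ) (hK : K ≤ 0) (hN : 1 ≤ N)
    (h : LocalBusemannMCP X m K N) :
    (∀ k k' : ℕ, (∃ p : X, IsManifoldPoint k p) → (∃ p : X, IsManifoldPoint k' p) → k = k') ∧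
    (∀ k : ℕ, (∃ p : X, IsManifoldPoint k p) → Dense {p : X | IsManifoldPoint k p}) := by
  have hdense := fun k => dense_setOf_isManifoldPoint hgeo hK hN h (k := k)
  refine ⟨fun k k' hk hk' => ?_, hdense⟩
  obtain ⟨p, hpk', hpk⟩ := (hdense k hk).inter_open_nonempty _ (isOpen_setOf_isManifoldPoint k') hk'
  exact le_antisymm (hpk'.dimension_le hpk) (hpk.dimension_le hpk')
end

section
/- Let k ∈ ℕ, let X be a nonempty proper metric space with a basepoint o ∈ X, and for each i ∈ ℕ let V_i be a real normed vector space with FiniteDimensional ℝ V_i and finrank ℝ V_i = k. Suppose that for every r > 0 the Gromov–Hausdorff distance between the closed ball of radius r centered at 0 in V_i and the closed ball of radius r centered at o in X tends to 0 as i → ∞. Then there exists a real normed vector space V with FiniteDimensional ℝ V and finrank ℝ V = k such that X is isometric to V. -/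
open Metric Filter

theorem GromovHausdorff.exists_correspondence {X Y : Type*} [MetricSpace X] [CompactSpace X]
    [Nonempty X] [MetricSpace Y] [CompactSpace Y] [Nonempty Y] {ε : ℝ} (h : ghDist X Y < ε) :
    ∃ R : X → Y → Prop, (∀ x, ∃ y, R x y) ∧ (∀ y, ∃ x, R x y) ∧
      ∀ x y x' y', R x y → R x' y' → |dist x x' - dist y y'| ≤ 2 * ε := by
  obtain ⟨Φ, Ψ, hΦ, hΨ, heq⟩ := ghDist_eq_hausdorffDist X Y
  rw [heq] at h
  have hfin : hausdorffEDist (Set.range Φ) (Set.range Ψ) ≠ ⊤ :=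
    hausdorffEDist_ne_top_of_nonempty_of_bounded (Set.range_nonempty _) (Set.range_nonempty _)
      (isCompact_range hΦ.continuous).isBounded (isCompact_range hΨ.continuous).isBounded
  refine ⟨fun x y => dist (Φ x) (Ψ y) < ε, fun x => ?_, fun y => ?_, ?_⟩
  · obtain ⟨_, ⟨y, rfl⟩, hy⟩ := exists_dist_lt_of_hausdorffDist_lt (Set.mem_range_self x) h hfin
    exact ⟨y, hy⟩
  · obtain ⟨_, ⟨x, rfl⟩, hx⟩ := exists_dist_lt_of_hausdorffDist_lt' (Set.mem_range_self y) h hfin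
    exact ⟨x, hx⟩
  · intro x y x' y' hxy hxy'
    rw [← hΦ.dist_eq, ← hΨ.dist_eq, ← Real.dist_eq]
    linarith [dist_dist_dist_le (Φ x) (Φ x') (Ψ y) (Ψ y')]

/-- An Auerbach basis: unit-ball vectors whose coordinate functionals have norm at most one. -/
theorem exists_auerbach_basis (E : Type*) [NormedAddCommGroup E] [NormedSpace ℝ E]
    [FiniteDimensional ℝ E] {k : ℕ} (hk : Module.finrank ℝ E = k) :
    ∃ b : Module.Basis (Fin k) ℝ E, (∀ j, ‖b j‖ ≤ 1) ∧ ∀ j v, |b.repr v j| ≤ ‖v‖ := by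
  let b₀ : Module.Basis (Fin k) ℝ E := Module.finBasisOfFinrankEq ℝ E hk
  have hcont : Continuous fun v : Fin k → E => |b₀.det v| := by
    simp_rw [Module.Basis.det_apply]
    refine (Continuous.matrix_det ?_).abs
    refine continuous_matrix fun i j => ?_
    simp only [Module.Basis.toMatrix_apply]
    exact (b₀.coord i).continuous_of_finiteDimensional.comp (continuous_apply j)
  obtain ⟨e, he, hmax⟩ := (isCompact_univ_pi fun _ : Fin k =>
    isCompact_closedBall (0 : E) 1).exists_isMaxOn ⟨0, by simp⟩ hcont.continuousOn
  have he1 : ∀ j, ‖e j‖ ≤ 1 := fun j => by simpa using he j (Set.mem_univ j)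
  have hpos : b₀.det e ≠ 0 := by
    let u : Fin k → ℝˣ := fun j =>
      Units.mk0 (‖b₀ j‖⁻¹) (inv_ne_zero (norm_ne_zero_iff.2 (b₀.ne_zero j)))
    have hu : |b₀.det (b₀.unitsSMul u)| ≤ |b₀.det e| := by
      refine hmax fun j _ => ?_
      have := norm_ne_zero_iff.2 (b₀.ne_zero j)
      simp [u, Module.Basis.unitsSMul_apply, Units.smul_def, norm_smul, this]
    intro h0
    rw [h0, abs_zero, abs_nonpos_iff] at hu
    exact (b₀.isUnit_det (b₀.unitsSMul u)).ne_zero hu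
  obtain ⟨hli, hsp⟩ := b₀.is_basis_iff_det.2 (isUnit_iff_ne_zero.2 hpos)
  let b := Module.Basis.mk hli hsp.ge
  refine ⟨b, fun j => by simpa [b] using he1 j, fun j v => ?_⟩
  have key : ∀ v, ‖v‖ ≤ 1 → |b.coord j v| ≤ 1 := by
    intro v hv
    have h1 := LinearMap.congr_fun (b₀.det_smul_mk_coord_eq_det_update hli hsp.ge j) v
    have h2 : |b₀.det (Function.update e j v)| ≤ |b₀.det e| := by
      refine hmax fun i _ => ?_
      rcases eq_or_ne i j with rfl | hij
      · simpa using hv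
      · simpa [hij] using he1 i
    have h3 : b₀.det e * b.coord j v = b₀.det (Function.update e j v) := h1
    rw [← h3, abs_mul] at h2
    exact le_of_mul_le_mul_left (by simpa using h2) (abs_pos.2 hpos)
  rcases eq_or_ne v 0 with rfl | hv
  · simp
  · have hv' := norm_pos_iff.2 hv
    have := key (‖v‖⁻¹ • v) (by rw [norm_smul, norm_inv, norm_norm, inv_mul_cancel₀ hv'.ne'])
    rw [map_smul, smul_eq_mul, abs_mul, abs_of_pos (inv_pos.2 hv'), inv_mul_le_iff₀ hv',
      mul_one] at this
    exact this

theorem Ultrafilter.exists_tendsto_of_eventually_dist_le {α Y : Type*} [PseudoMetricSpace Y]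
    [ProperSpace Y] (l : Ultrafilter α) {u : α → Y} {y : Y} {C : ℝ}
    (hu : ∀ᶠ n in (l : Filter α), dist (u n) y ≤ C) : ∃ z, Tendsto u l (nhds z) := by
  obtain ⟨z, -, hz⟩ := (isCompact_closedBall y C).ultrafilter_le_nhds (l.map u)
    (le_principal_iff.2 hu)
  exact ⟨z, hz⟩

/-- A correspondence between large balls almost matches the centres, because the centre of a ball
in a normed space is metrically characterised. -/
theorem exists_approx_of_ghDist_closedBall_lt {E X : Type*} [NormedAddCommGroup E]
    [NormedSpace ℝ E] [MetricSpace X] (o : X) {r δ : ℝ} (hr : 0 < r)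
    [CompactSpace (closedBall (0 : E) r)] [CompactSpace (closedBall o r)]
    [Nonempty (closedBall (0 : E) r)] [Nonempty (closedBall o r)]
    (h : GromovHausdorff.ghDist (closedBall (0 : E) r) (closedBall o r) < δ) :
    ∃ S : E → X → Prop, (∀ v, ‖v‖ ≤ r → ∃ x, S v x) ∧ (∀ x, dist x o ≤ r → ∃ v, S v x) ∧
      (∀ v x v' x', S v x → S v' x' → |‖v - v'‖ - dist x x'| ≤ 2 * δ) ∧
      ∀ v x, S v x → |‖v‖ - dist x o| ≤ 4 * δ := by
  obtain ⟨R, hR₁, hR₂, hR⟩ := GromovHausdorff.exists_correspondence h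
  obtain ⟨p, hp⟩ := hR₂ ⟨o, mem_closedBall_self hr.le⟩
  have hδ : 0 ≤ 2 * δ := (abs_nonneg _).trans (hR _ _ _ _ hp hp)
  have hpδ : ‖(p : E)‖ ≤ 2 * δ := by
    rcases eq_or_ne (p : E) 0 with h0 | h0
    · simpa [h0] using hδ
    · have hp0 := norm_pos_iff.2 h0
      let q : E := -(r / ‖(p : E)‖) • (p : E)
      have hq : ‖q‖ ≤ r := by
        simp [q, norm_smul, abs_of_pos hr, hp0.ne']
      obtain ⟨y, hy⟩ := hR₁ ⟨q, by simpa using hq⟩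
      have h1 := (abs_le.1 (hR _ _ _ _ hp hy)).2
      have h2 : dist (⟨o, mem_closedBall_self hr.le⟩ : closedBall o r) y ≤ r := by
        rw [dist_comm]; exact y.2
      have h3 : dist p ⟨q, by simpa using hq⟩ = ‖(p : E)‖ + r := by
        have : (p : E) - q = (1 + r / ‖(p : E)‖) • (p : E) := by
          simp only [q]; module
        rw [Subtype.dist_eq, dist_eq_norm, this, norm_smul, Real.norm_of_nonneg (by positivity)]
        field_simp
      linarith
  refine ⟨fun v x => ∃ hv hx, R ⟨v, hv⟩ ⟨x, hx⟩, fun v hv => ?_, fun x hx => ?_, ?_, ?_⟩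
  · obtain ⟨y, hy⟩ := hR₁ ⟨v, by simpa using hv⟩
    exact ⟨y, _, y.2, hy⟩
  · obtain ⟨v, hv⟩ := hR₂ ⟨x, hx⟩
    exact ⟨v, v.2, _, hv⟩
  · rintro v x v' x' ⟨hv, hx, h1⟩ ⟨hv', hx', h2⟩
    simpa [Subtype.dist_eq, dist_eq_norm] using hR _ _ _ _ h1 h2
  · rintro v x ⟨hv, hx, h1⟩
    have h2 : |‖v - p‖ - dist x o| ≤ 2 * δ := by
      simpa [Subtype.dist_eq, dist_eq_norm] using hR _ _ _ _ h1 hp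
    have h3 := norm_sub_norm_le v (v - p)
    have h4 := norm_sub_le v (p : E)
    rw [sub_sub_cancel] at h3
    rw [abs_le] at h2 ⊢
    constructor <;> linarith

theorem exists_normedSpace_isometryEquiv {W : Type} [AddCommGroup W] [Module ℝ W]
    [FiniteDimensional ℝ W] {X : Type*} [MetricSpace X] (N : W → ℝ)
    (hsmul : ∀ (c : ℝ) a, N (c • a) = |c| * N a) (hadd : ∀ a b, N (a + b) ≤ N a + N b)
    (hpos : ∀ a, 0 ≤ N a) (hzero : ∀ a, N a = 0 → a = 0)
    (f : W → X) (hf : ∀ a b, dist (f a) (f b) = N (a - b)) (hsurj : Function.Surjective f) :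
    ∃ (E : Type) (_ : NormedAddCommGroup E) (_ : NormedSpace ℝ E),
      FiniteDimensional ℝ E ∧ Module.finrank ℝ E = Module.finrank ℝ W ∧ Nonempty (X ≃ᵢ E) := by
  let : Norm W := ⟨N⟩
  have core : NormedSpace.Core ℝ W :=
    { norm_nonneg := hpos
      norm_smul := hsmul
      norm_triangle := hadd
      norm_eq_zero_iff := fun a => ⟨hzero a, fun h => by
        simpa [h] using! hsmul 0 0⟩ }
  let : NormedAddCommGroup W := NormedAddCommGroup.ofCore core
  let : NormedSpace ℝ W := NormedSpace.ofCore core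
  have hiso : Isometry f := Isometry.of_dist_eq fun a b => by rw [hf, dist_eq_norm]; rfl
  exact ⟨W, inferInstance, inferInstance, ‹FiniteDimensional ℝ W›, rfl,
    ⟨(IsometryEquiv.mk (Equiv.ofBijective f ⟨hiso.injective, hsurj⟩) hiso).symm⟩⟩

theorem gh_limit_of_banach_balls_is_banach
    (k : ℕ) (X : Type*) [MetricSpace X] [Nonempty X] [ProperSpace X] (o : X)
    (V : ℕ → Type) [∀ i, NormedAddCommGroup (V i)] [∀ i, NormedSpace ℝ (V i)]
    [∀ i, FiniteDimensional ℝ (V i)] (hV : ∀ i, Module.finrank ℝ (V i) = k)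
    (hGH : ∀ r : ℝ, ∀ hr : 0 < r,
      Filter.Tendsto (fun i : ℕ =>
        letI : CompactSpace (closedBall (0 : V i) r) :=
          isCompact_iff_compactSpace.mp (isCompact_closedBall _ _)
        letI : CompactSpace (closedBall o r) :=
          isCompact_iff_compactSpace.mp (isCompact_closedBall _ _)
        letI : Nonempty (closedBall (0 : V i) r) := ⟨⟨0, mem_closedBall_self hr.le⟩⟩
        letI : Nonempty (closedBall o r) := ⟨⟨o, mem_closedBall_self hr.le⟩⟩
        GromovHausdorff.ghDist (closedBall (0 : V i) r) (closedBall o r))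
        atTop (nhds 0)) :
    ∃ (W : Type) (_ : NormedAddCommGroup W) (_ : NormedSpace ℝ W),
      FiniteDimensional ℝ W ∧ Module.finrank ℝ W = k ∧ Nonempty (X ≃ᵢ W) := by
  have happrox : ∀ n : ℕ, ∃ (i : ℕ) (S : V i → X → Prop),
      (∀ v, ‖v‖ ≤ n + 1 → ∃ x, S v x) ∧ (∀ x, dist x o ≤ n + 1 → ∃ v, S v x) ∧
      (∀ v x v' x', S v x → S v' x' → |‖v - v'‖ - dist x x'| ≤ 2 * (1 / ((n : ℝ) + 1))) ∧
      ∀ v x, S v x → |‖v‖ - dist x o| ≤ 4 * (1 / ((n : ℝ) + 1)) := by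
    intro n
    have hn : (0 : ℝ) < n + 1 := by positivity
    obtain ⟨i, hi⟩ := ((hGH (n + 1) hn).eventually_lt_const (by positivity :
      (0 : ℝ) < 1 / ((n : ℝ) + 1))).exists
    exact ⟨i, @exists_approx_of_ghDist_closedBall_lt _ _ _ _ _ o _ _ hn
      (isCompact_iff_compactSpace.mp (isCompact_closedBall _ _))
      (isCompact_iff_compactSpace.mp (isCompact_closedBall _ _))
      ⟨⟨0, mem_closedBall_self hn.le⟩⟩ ⟨⟨o, mem_closedBall_self hn.le⟩⟩ hi⟩
  choose i S hS₁ hS₂ hS₃ hS₄ using happrox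
  choose e he₁ he₂ using fun n => exists_auerbach_basis (V (i n)) (hV (i n))
  let l : Ultrafilter ℕ := hyperfilter ℕ
  have hl : (l : Filter ℕ) ≤ atTop := Nat.hyperfilter_le_atTop
  have hδ : Tendsto (fun n : ℕ => 1 / ((n : ℝ) + 1)) l (nhds 0) :=
    tendsto_one_div_add_atTop_nhds_zero_nat.mono_left hl
  have hδ1 : ∀ n : ℕ, 1 / ((n : ℝ) + 1) ≤ 1 := fun n => by
    rw [div_le_one (by positivity)]; linarith [n.cast_nonneg (α := ℝ)]
  have hlarge : ∀ C : ℝ, ∀ᶠ n : ℕ in (l : Filter ℕ), C ≤ n + 1 := fun C =>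
    hl ((tendsto_atTop_add_const_right _ 1 tendsto_natCast_atTop_atTop).eventually_ge_atTop C)
  let T : ∀ n, (Fin k → ℝ) ≃ₗ[ℝ] V (i n) := fun n => (e n).equivFun.symm
  have hT_le : ∀ n a, ‖T n a‖ ≤ ∑ j, |a j| := by
    intro n a
    rw [show T n a = ∑ j, a j • e n j from (e n).equivFun_symm_apply a]
    refine (norm_sum_le _ _).trans (Finset.sum_le_sum fun j _ => ?_)
    rw [norm_smul, Real.norm_eq_abs]
    exact mul_le_of_le_one_right (abs_nonneg _) (he₁ n j)
  have hT_ge : ∀ n a j, |a j| ≤ ‖T n a‖ := by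
    intro n a j
    have : (e n).repr (T n a) j = a j := congr_fun ((e n).equivFun.apply_symm_apply a) j
    rw [← this]
    exact he₂ n j _
  choose N hN using fun a : Fin k → ℝ => l.exists_tendsto_of_eventually_dist_le
    (u := fun n => ‖T n a‖) (y := 0) (Eventually.of_forall fun n => by simpa using hT_le n a)
  have hF : ∀ n a, ∃ x, ‖T n a‖ ≤ n + 1 → S n (T n a) x := fun n a => by
    by_cases h : ‖T n a‖ ≤ n + 1
    · exact (hS₁ n _ h).imp fun x hx _ => hx
    · exact ⟨o, fun h' => absurd h' h⟩
  choose F hF using hF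
  have hFS : ∀ a, ∀ᶠ n in (l : Filter ℕ), S n (T n a) (F n a) := fun a =>
    (hlarge (∑ j, |a j|)).mono fun n hn => hF n a ((hT_le n a).trans hn)
  choose f hf using fun a : Fin k → ℝ => l.exists_tendsto_of_eventually_dist_le
    (u := fun n => F n a) (y := o) (C := ∑ j, |a j| + 4) ((hFS a).mono fun n hn => by
      linarith [(abs_le.1 (hS₄ n _ _ hn)).1, hT_le n a, hδ1 n])
  have hdist : ∀ a b, dist (f a) (f b) = N (a - b) := by
    intro a b
    have h1 : Tendsto (fun n => ‖T n (a - b)‖ - dist (F n a) (F n b)) l (nhds 0) := by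
      refine squeeze_zero_norm' ?_ (by simpa using hδ.const_mul 2)
      filter_upwards [hFS a, hFS b] with n ha hb
      simpa using hS₃ n _ _ _ _ ha hb
    have h2 := (hN (a - b)).sub ((hf a).dist (hf b))
    linarith [tendsto_nhds_unique h1 h2]
  have hsurj : Function.Surjective f := by
    intro x
    have hG : ∀ n : ℕ, ∃ a, dist x o ≤ n + 1 → S n (T n a) x := fun n => by
      by_cases h : dist x o ≤ n + 1
      · obtain ⟨v, hv⟩ := hS₂ n x h
        exact ⟨(T n).symm v, fun _ => by simpa using hv⟩
      · exact ⟨0, fun h' => absurd h' h⟩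
    choose G hG using hG
    have hGS : ∀ᶠ n in (l : Filter ℕ), S n (T n (G n)) x :=
      (hlarge (dist x o)).mono fun n hn => hG n hn
    obtain ⟨a, ha⟩ := l.exists_tendsto_of_eventually_dist_le (u := G) (y := 0)
      (C := dist x o + 4) (hGS.mono fun n hn => by
        have h4 := (abs_le.1 (hS₄ n _ _ hn)).2
        have h1 := hδ1 n
        rw [dist_pi_le_iff (by positivity)]
        intro j
        simpa using (hT_ge n (G n) j).trans (by linarith))
    refine ⟨a, tendsto_nhds_unique (hf a) (tendsto_iff_dist_tendsto_zero.2 ?_)⟩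
    have hsum : Tendsto (fun n => ∑ j, |(a - G n) j| + 2 * (1 / ((n : ℝ) + 1))) l (nhds 0) := by
      have h0 : Tendsto (fun n => ∑ j, |(a - G n) j|) l (nhds (∑ j, |(a - a) j|)) :=
        tendsto_finsetSum _ fun j _ =>
          (((continuous_apply j).tendsto _).comp (ha.const_sub a)).abs
      simpa using h0.add (hδ.const_mul 2)
    refine squeeze_zero' (Eventually.of_forall fun _ => dist_nonneg) ?_ hsum
    filter_upwards [hFS a, hGS] with n h1 h2
    have h3 := (abs_le.1 (hS₃ n _ _ _ _ h1 h2)).1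
    rw [← map_sub] at h3
    linarith [hT_le n (a - G n)]
  have hmain := exists_normedSpace_isometryEquiv N
    (fun c a => tendsto_nhds_unique (hN (c • a))
      (by simpa [norm_smul] using (hN a).const_mul |c|))
    (fun a b => le_of_tendsto_of_tendsto' (hN (a + b)) ((hN a).add (hN b))
      fun n => by simpa using norm_add_le (T n a) (T n b))
    (fun a => ge_of_tendsto' (hN a) fun n => norm_nonneg _)
    (fun a h => funext fun j => abs_nonpos_iff.1
      (h ▸ ge_of_tendsto' (hN a) fun n => hT_ge n a j))
    f hdist hsurj
  simpa using hmain
end
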